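/- Let n ≥ 2, 1 ≤ j ≤ n−1, 0 < D < 1 and r ≥ 1. Then, as N → ∞ (over all positive integers), the proportion of sublattices L ∈ L_{N,j}(n) satisfying #{v ∈ L : ‖v‖∞ ≤ D·N^{j/n}} = r tends to c_{n,r} = μ(Ω̃_{n,r}); equivalently, the number of Hecke translates of ℤⁿ by T_{N,j} lying in Ω̃_{n,r} is (μ(Ω̃_{n,r}) + o(1))·#L_{N,j}(n). -/

import Mathlib

open Matrix MeasureTheory

noncomputable section

/-- The subgroup `Γ = SL_n(ℤ)` inside `G = SL_n(ℝ)`, realized as the range of the map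
induced by the ring homomorphism `ℤ → ℝ`. -/
def Gamma (n : ℕ) : Subgroup (Matrix.SpecialLinearGroup (Fin n) ℝ) :=
  (Matrix.SpecialLinearGroup.map (Int.castRingHom ℝ)).range

/-- The homogeneous space `X = Γ\G = SL_n(ℤ)\SL_n(ℝ)` (right cosets `Γg`). -/
def XSpace (n : ℕ) : Type :=
  Quotient (QuotientGroup.rightRel (Gamma n))

/-- The topology on `SL_n(ℝ)` induced from the space of matrices. -/
instance (n : ℕ) : TopologicalSpace (Matrix.SpecialLinearGroup (Fin n) ℝ) :=
  TopologicalSpace.induced (fun g => (g : Matrix (Fin n) (Fin n) ℝ)) inferInstance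

/-- The quotient topology on `X = Γ\G`. -/
instance (n : ℕ) : TopologicalSpace (XSpace n) :=
  instTopologicalSpaceQuotient

/-- The Borel σ-algebra on `X`. -/
instance (n : ℕ) : MeasurableSpace (XSpace n) := borel _

instance (n : ℕ) : BorelSpace (XSpace n) := ⟨rfl⟩

/-- Right translation `Γx ↦ Γxg` of `G` on `X = Γ\G`. -/
def rightTranslate (n : ℕ) (g : Matrix.SpecialLinearGroup (Fin n) ℝ) :
    XSpace n → XSpace n :=
  Quotient.map' (fun x => x * g) (fun x y hxy => by
    simp only [QuotientGroup.rightRel_apply] at hxy ⊢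
    simpa [mul_assoc] using hxy)

/-- `Ω̃_{n,r}` : the set of cosets `Γg ∈ X` such that the lattice `ℤⁿg` contains exactly
`r` points `vg` (for `v ∈ ℤⁿ`) of sup-norm at most `D`. -/
def OmegaTilde (n : ℕ) (D : ℝ) (r : ℕ) : Set (XSpace n) :=
  {x | ∃ g : Matrix.SpecialLinearGroup (Fin n) ℝ,
    (Quotient.mk'' g : XSpace n) = x ∧
    Set.ncard {v : Fin n → ℤ |
      ‖Matrix.vecMul (fun i => (v i : ℝ)) (g : Matrix (Fin n) (Fin n) ℝ)‖ ≤ D} = r}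


/-- `L_{N,j}(n)`: the set of subgroups `L ≤ ℤⁿ` with `ℤⁿ/L ≅ (ℤ/Nℤ)ʲ`. -/
def latticeSet (N n j : ℕ) : Set (AddSubgroup (Fin n → ℤ)) :=
  {L | Nonempty (((Fin n → ℤ) ⧸ L) ≃+ (Fin j → ZMod N))}

section
/-! ### Divisor bound -/

lemma succ_pow_le_two (t : ℕ) : ∃ C : ℕ, 1 ≤ C ∧ ∀ e : ℕ, (e + 1) ^ t ≤ C * 2 ^ e := by
  have h := tendsto_pow_const_div_const_pow_of_one_lt t (r := (2:ℝ)) (by norm_num)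
  have h2 := h.bddAbove_range
  obtain ⟨B, hB⟩ := h2
  refine ⟨max 1 (2 * ⌈B⌉₊), le_max_left _ _, fun e => ?_⟩
  have h3 : (((e+1 : ℕ)) : ℝ) ^ t / 2 ^ (e+1) ≤ B := hB ⟨e+1, rfl⟩
  rw [div_le_iff₀ (by positivity)] at h3
  have h4 : (((e+1)^t : ℕ) : ℝ) ≤ ((2 * ⌈B⌉₊ * 2^e : ℕ) : ℝ) := by
    push_cast at h3 ⊢
    calc ((e:ℝ)+1)^t ≤ B * 2 ^ (e+1) := h3
      _ ≤ ⌈B⌉₊ * 2^(e+1) := by gcongr; exact Nat.le_ceil B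
      _ = _ := by ring
  have h5 := Nat.cast_le.mp h4
  exact h5.trans (Nat.mul_le_mul_right _ (le_max_right _ _))

lemma card_divisors_pow_le (t : ℕ) : ∃ C : ℕ, 1 ≤ C ∧ ∀ N : ℕ, N ≠ 0 →
    (N.divisors.card) ^ t ≤ C * N := by
  obtain ⟨C, hC1, hC⟩ := succ_pow_le_two t
  refine ⟨C ^ (2 ^ t), Nat.one_le_pow _ _ hC1, fun N hN => ?_⟩
  rw [Nat.card_divisors hN, ← Finset.prod_pow]
  calc ∏ x ∈ N.primeFactors, (N.factorization x + 1) ^ t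
      ≤ ∏ x ∈ N.primeFactors, ((if x < 2 ^ t then C else 1) * x ^ N.factorization x) := by
        refine Finset.prod_le_prod' fun p hp => ?_
        have hp2 : 2 ≤ p := (Nat.prime_of_mem_primeFactors hp).two_le
        split_ifs with h
        · exact (hC _).trans (Nat.mul_le_mul_left _ (Nat.pow_le_pow_left hp2 _))
        · push Not at h
          rw [one_mul]
          calc (N.factorization p + 1) ^ t ≤ (2 ^ N.factorization p) ^ t := by
                gcongr; exact Nat.lt_two_pow_self
            _ = (2 ^ t) ^ N.factorization p := by rw [← pow_mul, ← pow_mul, mul_comm]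
            _ ≤ _ := by gcongr
    _ = (∏ x ∈ N.primeFactors, (if x < 2 ^ t then C else 1)) * N := by
        rw [Finset.prod_mul_distrib]; congr 1
        exact Nat.prod_factorization_pow_eq_self hN
    _ ≤ _ := by
        gcongr
        rw [← Finset.prod_filter, Finset.prod_const]
        refine Nat.pow_le_pow_right hC1 ?_
        calc _ ≤ (Finset.range (2^t)).card := Finset.card_le_card (by
              intro x hx; simp only [Finset.mem_filter] at hx; simpa using hx.2)
          _ = _ := by simp

/-! ### Generating tuples -/

lemma exists_dual_zmod {W : Type*} [AddCommGroup W] {p : ℕ} [Fact p.Prime] [Module (ZMod p) W]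
    {w : W} (hw : w ≠ 0) : ∃ f : W →+ ZMod p, f w ≠ 0 := by
  obtain ⟨f, hf⟩ := Module.Projective.exists_dual_ne_zero (ZMod p) hw
  exact ⟨f.toAddMonoidHom, hf⟩

lemma exists_hom_zmod {W : Type*} [AddCommGroup W] {p : ℕ} [Fact p.Prime] (h : ∀ x : W, p • x = 0)
    {w : W} (hw : w ≠ 0) : ∃ f : W →+ ZMod p, f w ≠ 0 := by
  letI : Module (ZMod p) W := AddCommGroup.zmodModule h
  exact exists_dual_zmod hw

/-- number of maps killed -/
lemma exists_prime_functional {N : ℕ} [NeZero N] {k : ℕ} (T : AddSubgroup (Fin k → ZMod N))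
    (hT : T ≠ ⊤) : ∃ p : ℕ, p.Prime ∧ p ∣ N ∧ ∃ u : (Fin k → ZMod N) →+ ZMod p, u ≠ 0 ∧
      ∀ x ∈ T, u x = 0 := by
  have hnt : Nontrivial ((Fin k → ZMod N) ⧸ T) :=
    QuotientAddGroup.nontrivial_iff.mpr hT
  -- some prime with p Q ≠ Q
  by_contra hcon
  push Not at hcon
  have key : ∀ p : ℕ, p.Prime → p ∣ N → ∀ q : (Fin k → ZMod N) ⧸ T, ∃ q', p • q' = q := by
    intro p hp hpN
    by_contra hq
    push Not at hq
    obtain ⟨q0, hq0⟩ := hq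
    haveI := Fact.mk hp
    let Q := (Fin k → ZMod N) ⧸ T
    let S : AddSubgroup Q := (nsmulAddMonoidHom (α := Q) p).range
    have hpk : ∀ x : Q ⧸ S, p • x = 0 := by
      intro x
      obtain ⟨y, rfl⟩ := QuotientAddGroup.mk_surjective x
      rw [← QuotientAddGroup.mk_nsmul, QuotientAddGroup.eq_zero_iff]
      exact ⟨y, rfl⟩
    have hne : (QuotientAddGroup.mk q0 : Q ⧸ S) ≠ 0 := by
      rw [Ne, QuotientAddGroup.eq_zero_iff]
      rintro ⟨y, hy⟩
      exact hq0 y hy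
    obtain ⟨f, hf⟩ := exists_hom_zmod hpk hne
    obtain ⟨v, rfl⟩ := QuotientAddGroup.mk_surjective q0
    obtain ⟨x, hx, hx2⟩ := hcon p hp hpN ((f.comp (QuotientAddGroup.mk' S)).comp
      (QuotientAddGroup.mk' T)) (fun h0 => hf (DFunLike.congr_fun h0 v))
    apply hx2
    have : (QuotientAddGroup.mk' T) x = 0 := (QuotientAddGroup.eq_zero_iff x).mpr hx
    simp only [AddMonoidHom.comp_apply, this, map_zero]
  have key2 : ∀ M : ℕ, M ∣ N → ∀ q : (Fin k → ZMod N) ⧸ T, ∃ q', M • q' = q := by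
    intro M
    induction M using Nat.recOnMul with
    | zero => intro h; exact absurd (zero_dvd_iff.mp h) (NeZero.ne N)
    | one => intro _ q; exact ⟨q, one_smul _ _⟩
    | prime p hp => intro h; exact key p hp h
    | mul a b ha hb =>
      intro h q
      obtain ⟨q1, h1⟩ := ha (dvd_trans (dvd_mul_right a b) h) q
      obtain ⟨q2, h2⟩ := hb (dvd_trans (dvd_mul_left b a) h) q1
      exact ⟨q2, by rw [mul_smul, h2, h1]⟩
  obtain ⟨q, hq⟩ := exists_ne (0 : (Fin k → ZMod N) ⧸ T)
  obtain ⟨q', hq'⟩ := key2 N dvd_rfl q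
  apply hq
  rw [← hq']
  obtain ⟨v, rfl⟩ := QuotientAddGroup.mk_surjective q'
  rw [← QuotientAddGroup.mk_nsmul]
  have : N • v = 0 := by ext i; simp
  rw [this]; rfl

lemma card_ker_functional {N : ℕ} [NeZero N] {k p : ℕ} (hp : p.Prime)
    (u : (Fin k → ZMod N) →+ ZMod p) (hu : u ≠ 0) :
    Nat.card {x // u x = 0} * p = N ^ k := by
  haveI := Fact.mk hp
  have hsurj : Function.Surjective u := by
    obtain ⟨x, hx⟩ := DFunLike.ne_iff.mp hu
    intro y
    refine ⟨(y * (u x)⁻¹).val • x, ?_⟩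
    rw [map_nsmul, nsmul_eq_mul, ZMod.natCast_zmod_val, mul_assoc, inv_mul_cancel₀ (by simpa using hx), mul_one]
  have h1 := AddSubgroup.card_eq_card_quotient_mul_card_addSubgroup u.ker
  have h2 : Nat.card ((Fin k → ZMod N) ⧸ u.ker) = p := by
    rw [Nat.card_congr (QuotientAddGroup.quotientKerEquivOfSurjective u hsurj).toEquiv]; simp
  rw [h2] at h1
  have h3 : Nat.card (Fin k → ZMod N) = N ^ k := by simp
  rw [← h3, h1, mul_comm]; rfl

end

section
lemma sum_prime_le (S : Finset ℕ) (hS : ∀ p ∈ S, p.Prime) :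
    ∑ p ∈ S, (1 : ℝ) / (p * (p - 1)) ≤ 11 / 12 := by
  have tele : ∀ M : ℕ, ∑ q ∈ Finset.Icc 2 (M+1), (1:ℝ) / (q * (q - 1)) ≤ 1 - 1 / (M+1) := by
    intro M
    induction M with
    | zero => simp
    | succ M ih =>
      rw [← Finset.insert_Icc_right_eq_Icc_add_one (by omega), Finset.sum_insert (by simp)]
      push_cast at *
      have : (1:ℝ) / ((M+1+1) * (M+1+1-1)) = 1/(M+1) - 1 / (M+1+1) := by field_simp; ring
      rw [this]; linarith
  have h4 : (4:ℕ) ∉ S := fun h => absurd (hS 4 h) (by norm_num)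
  have h1 : ∑ p ∈ insert 4 S, (1 : ℝ) / (p * (p - 1)) ≤ 1 := by
    refine (Finset.sum_le_sum_of_subset_of_nonneg (t := Finset.Icc 2 ((S.sup id + 4) + 1)) ?_ ?_).trans
      ((tele _).trans ?_)
    · intro p hp
      rw [Finset.mem_insert] at hp
      rcases hp with rfl | hp
      · simp
      · simp only [Finset.mem_Icc]
        have := Finset.le_sup (f := id) hp
        exact ⟨(hS p hp).two_le, by simp at this; omega⟩
    · intro q hq _
      have : (2:ℝ) ≤ q := by exact_mod_cast (Finset.mem_Icc.mp hq).1
      have : (0:ℝ) ≤ q - 1 := by linarith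
      positivity
    · have : (0:ℝ) ≤ 1 / (((S.sup id + 4 : ℕ) : ℝ) + 1) := by positivity
      linarith
  rw [Finset.sum_insert h4] at h1
  norm_num at h1 ⊢
  linarith

open Classical in
lemma card_bad_p {N : ℕ} [NeZero N] {n k p : ℕ} (hk : k < n) (hp : p.Prime) :
    ((Finset.univ.filter (fun A : Fin n → Fin k → ZMod N =>
      ∃ u : (Fin k → ZMod N) →+ ZMod p, u ≠ 0 ∧ ∀ i, u (A i) = 0)).card : ℝ) ≤
      (N:ℝ) ^ (k * n) * (1 / (p * (p - 1))) := by
  haveI := Fact.mk hp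
  set B := Finset.univ.filter (fun A : Fin n → Fin k → ZMod N =>
      ∃ u : (Fin k → ZMod N) →+ ZMod p, u ≠ 0 ∧ ∀ i, u (A i) = 0) with hB
  have hBm : ∀ A, A ∈ B ↔ ∃ u : (Fin k → ZMod N) →+ ZMod p, u ≠ 0 ∧ ∀ i, u (A i) = 0 := by
    intro A; simp [hB]
  haveI : Finite ((Fin k → ZMod N) →+ ZMod p) := Finite.of_injective (fun u => (u : (Fin k → ZMod N) → ZMod p)) DFunLike.coe_injective
  haveI : Fintype ((Fin k → ZMod N) →+ ZMod p) := Fintype.ofFinite _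
  have hcard : Fintype.card ((Fin k → ZMod N) →+ ZMod p) ≤ p ^ k := by
    have : Fintype.card (Fin k → ZMod p) = p ^ k := by simp [ZMod.card]
    rw [← this]
    refine Fintype.card_le_of_injective (fun u i => u (Pi.single i 1)) ?_
    intro u v huv
    refine AddMonoidHom.functions_ext' _ _ _ fun i => ?_
    ext x
    have := congrFun huv i
    simp only at this
    have hx : Pi.single i x = x.val • (Pi.single i 1 : Fin k → ZMod N) := by
      rw [← Pi.single_smul]; simp
    simp only [AddMonoidHom.comp_apply, AddMonoidHom.single_apply]
    rw [hx, map_nsmul, map_nsmul, this]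
  have hdc : B.card * (p - 1) ≤ p ^ k * ((Nat.card {x : Fin n → Fin k → ZMod N // True}) / p ^ n) := by
    have h1 : B.card * (p-1) ≤ ∑ A ∈ B, (Finset.univ.filter (fun u : (Fin k → ZMod N) →+ ZMod p => u ≠ 0 ∧ ∀ i, u (A i) = 0)).card := by
      rw [← smul_eq_mul]
      refine Finset.card_nsmul_le_sum _ _ _ fun A hA => ?_
      obtain ⟨u, hu, hA⟩ := (hBm A).mp hA
      have : Fintype.card (ZMod p)ˣ = p - 1 := ZMod.card_units p
      rw [← this, ← Finset.card_univ]
      refine Finset.card_le_card_of_injOn (fun c => (AddMonoidHom.mulLeft (c : ZMod p)).comp u) ?_ ?_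
      · intro c _
        simp only [Finset.coe_filter, Finset.mem_univ, true_and, Set.mem_setOf_eq]
        refine ⟨?_, fun i => by simp [hA i]⟩
        intro h0
        apply hu
        refine DFunLike.ext _ _ fun x => ?_
        have := DFunLike.congr_fun h0 x
        simpa using this
      · intro c _ d _ hcd
        obtain ⟨x, hx⟩ := DFunLike.ne_iff.mp hu
        have := DFunLike.congr_fun hcd x
        simp only [AddMonoidHom.comp_apply, AddMonoidHom.coe_mulLeft] at this
        exact Units.ext (mul_right_cancel₀ (by simpa using hx) this)
    refine h1.trans ?_
    calc _ = ∑ A ∈ B, ∑ u : (Fin k → ZMod N) →+ ZMod p, if u ≠ 0 ∧ ∀ i, u (A i) = 0 then 1 else 0 := by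
          refine Finset.sum_congr rfl fun A _ => ?_
          rw [Finset.card_filter]
      _ = ∑ u : (Fin k → ZMod N) →+ ZMod p, ∑ A ∈ B, if u ≠ 0 ∧ ∀ i, u (A i) = 0 then 1 else 0 := Finset.sum_comm
      _ ≤ ∑ u : (Fin k → ZMod N) →+ ZMod p, ((Nat.card {x : Fin n → Fin k → ZMod N // True}) / p ^ n) := by
          refine Finset.sum_le_sum fun u _ => ?_
          by_cases hu : u = 0
          · simp [hu]
          · rw [← Finset.card_filter, Nat.le_div_iff_mul_le (by have := hp.pos; positivity)]
            have hk := card_ker_functional hp u hu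
            calc _ ≤ (Fintype.card (Fin n → {x // u x = 0})) * p ^ n := by
                  gcongr
                  rw [← Fintype.card_coe]
                  refine Fintype.card_le_of_injective (fun A i => ⟨A.1 i, (Finset.mem_filter.mp A.2).2.2 i⟩) ?_
                  intro A A' h
                  ext1; funext i
                  exact congrArg Subtype.val (congrFun h i)
              _ = (N ^ k) ^ n := by
                  rw [← hk, mul_pow, Fintype.card_fun, Nat.card_eq_fintype_card, Fintype.card_fin]
              _ = _ := by simp
      _ ≤ _ := by
          rw [Finset.sum_const, smul_eq_mul, Finset.card_univ]
          gcongr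
  have hNc : Nat.card {x : Fin n → Fin k → ZMod N // True} = N ^ (k * n) := by
    simp [pow_mul]
  rw [hNc] at hdc
  have hp2 : (2:ℝ) ≤ p := by exact_mod_cast hp.two_le
  have hdc' : (B.card : ℝ) * (p - 1) ≤ p ^ k * (N ^ (k*n) / p ^ n) := by
    have : (((B.card * (p-1) : ℕ)) : ℝ) ≤ ((p ^ k * (N ^ (k*n) / p ^ n) : ℕ) : ℝ) := by exact_mod_cast hdc
    rw [Nat.cast_mul, Nat.cast_sub hp.one_le, Nat.cast_one] at this
    refine this.trans ?_
    push_cast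
    gcongr
    exact_mod_cast Nat.cast_div_le (α := ℝ) (m := N ^ (k*n)) (n := p^n)
  have : (p:ℝ)^k * (N ^ (k*n) / p ^ n) ≤ N ^ (k*n) / p := by
    have h1 : (p:ℝ) ^ (k+1) ≤ p ^ n := pow_le_pow_right₀ (by linarith) hk
    rw [mul_div_assoc', div_le_div_iff₀ (by positivity) (by positivity)]
    calc (p:ℝ)^k * N^(k*n) * p = N^(k*n) * p^(k+1) := by ring
      _ ≤ _ := by gcongr
  have h3 := hdc'.trans this
  rw [mul_one_div, le_div_iff₀ (by nlinarith)]
  calc (B.card:ℝ) * (p * (p-1)) = p * (B.card * (p-1)) := by ring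
    _ ≤ p * (N ^ (k*n) / p) := by gcongr
    _ = _ := by field_simp

open Classical in
/-- Many tuples generate. -/
lemma card_generating {N : ℕ} [NeZero N] {n k : ℕ} (hk : k < n) :
    (N:ℝ) ^ (k * n) / 12 ≤ ((Finset.univ.filter (fun A : Fin n → Fin k → ZMod N =>
      AddSubgroup.closure (Set.range A) = ⊤)).card : ℝ) := by
  have hsplit := Finset.card_filter_add_card_filter_not (s := (Finset.univ : Finset (Fin n → Fin k → ZMod N)))
    (fun A => AddSubgroup.closure (Set.range A) = ⊤)
  have hbad : ((Finset.univ.filter (fun A : Fin n → Fin k → ZMod N =>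
      ¬ AddSubgroup.closure (Set.range A) = ⊤)).card : ℝ) ≤ N ^ (k*n) * (11/12) := by
    have hsub : (Finset.univ.filter (fun A : Fin n → Fin k → ZMod N =>
      ¬ AddSubgroup.closure (Set.range A) = ⊤)) ⊆ N.primeFactors.biUnion (fun p =>
        (Finset.univ.filter (fun A : Fin n → Fin k → ZMod N =>
      ∃ u : (Fin k → ZMod N) →+ ZMod p, u ≠ 0 ∧ ∀ i, u (A i) = 0))) := by
      intro A hA
      obtain ⟨p, hp, hpN, u, hu, h⟩ := exists_prime_functional _ (Finset.mem_filter.mp hA).2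
      simp only [Finset.mem_biUnion, Finset.mem_filter, Finset.mem_univ, true_and]
      refine ⟨p, ?_, u, hu, fun i => h _ (AddSubgroup.subset_closure ⟨i, rfl⟩)⟩
      simp [hp, hpN, NeZero.ne N]
    calc _ ≤ ((∑ p ∈ N.primeFactors, _ : ℕ) : ℝ) := by
            exact_mod_cast (Finset.card_le_card hsub).trans Finset.card_biUnion_le
      _ ≤ ∑ p ∈ N.primeFactors, (N:ℝ) ^ (k * n) * (1 / (p * (p - 1))) := by
            push_cast
            exact Finset.sum_le_sum fun p hp => card_bad_p hk (Nat.prime_of_mem_primeFactors hp)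
      _ ≤ _ := by
            rw [← Finset.mul_sum]
            gcongr
            exact sum_prime_le _ fun p hp => Nat.prime_of_mem_primeFactors hp
  have htot : ((Finset.univ : Finset (Fin n → Fin k → ZMod N)).card : ℝ) = N ^ (k*n) := by
    simp [pow_mul]
  have : ((_ : ℕ) : ℝ) = _ := congrArg (Nat.cast : ℕ → ℝ) hsplit
  rw [Nat.cast_add, htot] at this
  linarith

end

section
open TensorProduct in
lemma free_of_stably_free {R : Type*} [CommRing R] [Finite R] {K : Type*} [AddCommGroup K] [Module R K]
    {n j k : ℕ} (hjk : j + k = n) (e : (K × (Fin j → R)) ≃ₗ[R] (Fin n → R)) :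
    Nonempty (K ≃ₗ[R] (Fin k → R)) := by
  haveI : Finite (MaximalSpectrum R) := inferInstance
  haveI : Module.Finite R (K × (Fin j → R)) := Module.Finite.equiv e.symm
  haveI : Module.Finite R K := Module.Finite.of_surjective (LinearMap.fst R K (Fin j → R)) LinearMap.fst_surjective
  haveI : Module.Projective R K := Module.Projective.of_split
    (e.toLinearMap ∘ₗ LinearMap.inl R K (Fin j → R)) (LinearMap.fst R K (Fin j → R) ∘ₗ e.symm.toLinearMap)
    (by ext x; simp)
  obtain ⟨b⟩ := Module.nonempty_basis_of_flat_of_finrank_eq R K k (by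
    intro P
    letI := Ideal.Quotient.field P.1
    let F := R ⧸ P.1
    have e1 : (F ⊗[R] K × F ⊗[R] (Fin j → R)) ≃ₗ[F] F ⊗[R] (Fin n → R) :=
      (TensorProduct.prodRight R F F K (Fin j → R)).symm ≪≫ₗ e.baseChange R F _ _
    have h1 := e1.finrank_eq
    haveI : Nontrivial R := (Ideal.Quotient.mk P.1).domain_nontrivial
    have h2 : ∀ i : ℕ, Module.finrank F (F ⊗[R] (Fin i → R)) = i := fun i => by
      rw [Module.finrank_baseChange, Module.finrank_fin_fun]
    rw [Module.finrank_prod, h2, h2] at h1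
    change Module.finrank F (F ⊗[R] K) = k
    omega)
  exact ⟨b.equivFun⟩

lemma ker_equiv_of_surjective {R : Type*} [CommRing R] [Finite R] {n j k : ℕ} (hjk : j + k = n)
    (S : (Fin n → R) →ₗ[R] (Fin j → R)) (hS : Function.Surjective S) :
    Nonempty (LinearMap.ker S ≃ₗ[R] (Fin k → R)) := by
  obtain ⟨σ, hσ⟩ := Module.projective_lifting_property S LinearMap.id hS
  have hσ' : ∀ y, S (σ y) = y := fun y => LinearMap.congr_fun hσ y
  refine free_of_stably_free hjk (LinearEquiv.ofBijective
    (LinearMap.coprod (LinearMap.ker S).subtype σ) ⟨?_, ?_⟩)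
  · rw [← LinearMap.ker_eq_bot, LinearMap.ker_eq_bot']
    rintro ⟨⟨x, hx⟩, y⟩ h
    simp only [LinearMap.coprod_apply, Submodule.subtype_apply] at h
    have h2 := congrArg S h
    rw [map_add, hσ', LinearMap.mem_ker.mp hx, zero_add, map_zero] at h2
    subst h2
    simp only [map_zero, add_zero] at h
    subst h
    rfl
  · intro v
    refine ⟨(⟨v - σ (S v), by simp [hσ']⟩, S v), by simp⟩

lemma closure_eq_top_iff_surj {N n k : ℕ} [NeZero N] (A : Fin n → Fin k → ZMod N) (h : AddSubgroup.closure (Set.range A) = ⊤) :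
    Function.Surjective (Fintype.linearCombination (ZMod N) A) := by
  intro v
  have hv : v ∈ AddSubgroup.closure (Set.range A) := by rw [h]; trivial
  induction hv using AddSubgroup.closure_induction with
  | mem x hx => obtain ⟨i, rfl⟩ := hx; exact ⟨Pi.single i 1, by simp⟩
  | zero => exact ⟨0, by simp⟩
  | add x y _ _ hx hy =>
    obtain ⟨a, rfl⟩ := hx; obtain ⟨b, rfl⟩ := hy; exact ⟨a + b, by simp⟩
  | neg x _ hx => obtain ⟨a, rfl⟩ := hx; exact ⟨-a, by simp⟩

/-- reduction mod N of integer vectors -/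
def redN (N n : ℕ) : (Fin n → ℤ) →+ (Fin n → ZMod N) where
  toFun v := fun i => (v i : ZMod N)
  map_zero' := by ext; simp
  map_add' := by intros; ext; simp

@[simp] lemma redN_apply (N n : ℕ) (v : Fin n → ℤ) (i : Fin n) : redN N n v i = (v i : ZMod N) := rfl

lemma redN_surjective (N n : ℕ) : Function.Surjective (redN N n) := by
  intro w
  choose f hf using fun i => ZMod.intCast_surjective (w i)
  exact ⟨f, funext hf⟩

lemma redN_eq_zero_iff (N n : ℕ) (v : Fin n → ℤ) : redN N n v = 0 ↔ ∃ w, v = (N : ℤ) • w := by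
  constructor
  · intro h
    have : ∀ i, (N:ℤ) ∣ v i := fun i => (ZMod.intCast_zmod_eq_zero_iff_dvd _ _).mp (congrFun h i)
    choose w hw using this
    exact ⟨w, by ext i; simp [hw]⟩
  · rintro ⟨w, rfl⟩; ext i; simp

/-- additive maps between free modules over `ZMod N` are linear -/
def toZModLin {N : ℕ} {n j : ℕ} (f : (Fin n → ZMod N) →+ (Fin j → ZMod N)) :
    (Fin n → ZMod N) →ₗ[ZMod N] (Fin j → ZMod N) := f.toZModLinearMap N

lemma mem_latticeSet_iff {N n j : ℕ} (L : AddSubgroup (Fin n → ℤ)) :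
    L ∈ latticeSet N n j ↔ ∃ S : (Fin n → ZMod N) →ₗ[ZMod N] (Fin j → ZMod N), Function.Surjective S ∧
      ∀ v, v ∈ L ↔ S (redN N n v) = 0 := by
  constructor
  · rintro ⟨e⟩
    let f : (Fin n → ℤ) →+ (Fin j → ZMod N) := e.toAddMonoidHom.comp (QuotientAddGroup.mk' L)
    have hf : Function.Surjective f := e.surjective.comp (QuotientAddGroup.mk'_surjective L)
    have hk : ∀ v, f v = 0 ↔ v ∈ L := by
      intro v
      simp [f]
    let q := (QuotientAddGroup.lift (redN N n).ker f (by
      intro v hv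
      obtain ⟨w, rfl⟩ := (redN_eq_zero_iff N n v).mp hv
      rw [AddMonoidHom.mem_ker, map_zsmul]; ext i; simp))
    let g : (Fin n → ZMod N) →+ (Fin j → ZMod N) := q.comp
      (QuotientAddGroup.quotientKerEquivOfSurjective (redN N n) (redN_surjective N n)).symm.toAddMonoidHom
    have hg : ∀ v, g (redN N n v) = f v := by
      intro v
      have : (QuotientAddGroup.quotientKerEquivOfSurjective (redN N n) (redN_surjective N n)).symm (redN N n v)
        = QuotientAddGroup.mk v := by
        rw [AddEquiv.symm_apply_eq]; rfl
      simp only [g, AddMonoidHom.comp_apply, AddEquiv.toAddMonoidHom_eq_coe, AddMonoidHom.coe_coe, this]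
      rfl
    refine ⟨toZModLin g, ?_, fun v => ?_⟩
    · intro y
      obtain ⟨v, rfl⟩ := hf y
      exact ⟨redN N n v, hg v⟩
    · rw [← hk, ← hg]; rfl
  · rintro ⟨S, hS, hL⟩
    let f := S.toAddMonoidHom.comp (redN N n)
    have hf : Function.Surjective f := hS.comp (redN_surjective N n)
    have : L = f.ker := by ext v; rw [hL]; rfl
    subst this
    exact ⟨QuotientAddGroup.quotientKerEquivOfSurjective f hf⟩

lemma latticeSet_finite (N n j : ℕ) [NeZero N] : (latticeSet N n j).Finite := by
  refine Set.Finite.subset (Set.finite_range (fun S : Set (Fin n → ZMod N) =>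
    (AddSubgroup.closure ((redN N n) ⁻¹' S)))) ?_
  intro L hL
  obtain ⟨S, _, h⟩ := (mem_latticeSet_iff L).mp hL
  refine ⟨{w | S w = 0}, ?_⟩
  have : (redN N n) ⁻¹' {w | S w = 0} = L := by ext v; simp [h]
  simp only [this, AddSubgroup.closure_eq]

end

section
lemma lattice_param {N n j k : ℕ} [NeZero N] (hjk : j + k = n) (L : latticeSet N n j) :
    ∃ f : (Fin k → ZMod N) →ₗ[ZMod N] (Fin n → ZMod N), Function.Injective f ∧
      ∀ v, v ∈ L.1 ↔ redN N n v ∈ LinearMap.range f := by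
  obtain ⟨S, hS, hL⟩ := (mem_latticeSet_iff L.1).mp L.2
  obtain ⟨e⟩ := ker_equiv_of_surjective hjk S hS
  refine ⟨(LinearMap.ker S).subtype ∘ₗ e.symm.toLinearMap,
    (Subtype.val_injective).comp e.symm.injective, fun v => ?_⟩
  rw [hL, LinearMap.range_comp]
  simp

lemma lattice_eq_of_range {N n j : ℕ} {k : ℕ} {L L' : latticeSet N n j}
    {f f' : (Fin k → ZMod N) →ₗ[ZMod N] (Fin n → ZMod N)}
    (h : ∀ v, v ∈ L.1 ↔ redN N n v ∈ LinearMap.range f)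
    (h' : ∀ v, v ∈ L'.1 ↔ redN N n v ∈ LinearMap.range f')
    (hff : LinearMap.range f = LinearMap.range f') : L = L' := by
  ext v
  rw [h, h', hff]

lemma exists_lattice_of_generating {N n j k : ℕ} [NeZero N] (hjk : j + k = n) (A : Matrix (Fin n) (Fin k) (ZMod N))
    (hA : AddSubgroup.closure (Set.range A.row) = ⊤) :
    ∃ L : latticeSet N n j, (∀ v, v ∈ L.1 ↔ redN N n v ∈ LinearMap.range A.mulVecLin) ∧
      Function.Injective A.mulVecLin := by
  have h1 := closure_eq_top_iff_surj _ hA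
  obtain ⟨σ, hσ⟩ := Module.projective_lifting_property _ LinearMap.id h1
  have hσ' : ∀ y, Fintype.linearCombination (ZMod N) A.row (σ y) = y := fun y => LinearMap.congr_fun hσ y
  let B := LinearMap.toMatrix' σ
  have hB : Aᵀ * B = 1 := by
    refine Matrix.toLin'.injective ?_
    rw [Matrix.toLin'_mul, Matrix.toLin'_one, Matrix.toLin'_toMatrix']
    refine LinearMap.ext fun y => ?_
    rw [LinearMap.comp_apply, LinearMap.id_apply]
    nth_rewrite 2 [← hσ' y]
    rw [Matrix.toLin'_apply, Matrix.mulVec_transpose]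
    ext t
    simp [Fintype.linearCombination_apply, Matrix.vecMul, dotProduct]
  have hB2 : Bᵀ * A = 1 := by
    have := congrArg Matrix.transpose hB
    simpa using this
  have hBA : ∀ x, Bᵀ *ᵥ (A *ᵥ x) = x := by intro x; rw [Matrix.mulVec_mulVec, hB2, Matrix.one_mulVec]
  obtain ⟨e⟩ := ker_equiv_of_surjective (R := ZMod N) (j := k) (k := j) (by omega) Bᵀ.mulVecLin (fun x => ⟨A *ᵥ x, hBA x⟩)
  let pr : (Fin n → ZMod N) →ₗ[ZMod N] LinearMap.ker Bᵀ.mulVecLin :=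
    LinearMap.codRestrict _ (LinearMap.id - A.mulVecLin ∘ₗ Bᵀ.mulVecLin) (by
      intro c
      rw [LinearMap.mem_ker]
      simp only [LinearMap.sub_apply, LinearMap.id_apply, LinearMap.comp_apply, map_sub, Matrix.mulVecLin_apply, hBA, sub_self])
  let S := e.toLinearMap ∘ₗ pr
  have hS : Function.Surjective S := by
    refine e.surjective.comp fun x => ⟨x.1, ?_⟩
    ext1
    have hx : Bᵀ *ᵥ x.1 = 0 := x.2
    simp only [pr, LinearMap.codRestrict_apply, LinearMap.sub_apply, LinearMap.id_apply, LinearMap.comp_apply,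
      Matrix.mulVecLin_apply, hx, Matrix.mulVec_zero, sub_zero]
  have hSk : ∀ w, S w = 0 ↔ w ∈ LinearMap.range A.mulVecLin := by
    intro w
    simp only [S, LinearMap.comp_apply, LinearEquiv.coe_coe, EmbeddingLike.map_eq_zero_iff]
    rw [← Subtype.val_inj]
    simp only [pr, LinearMap.codRestrict_apply, LinearMap.sub_apply, LinearMap.id_apply, LinearMap.comp_apply,
      Matrix.mulVecLin_apply, ZeroMemClass.coe_zero, LinearMap.mem_range]
    constructor
    · intro h; exact ⟨Bᵀ *ᵥ w, (sub_eq_zero.mp h).symm⟩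
    · rintro ⟨y, rfl⟩; rw [hBA, sub_self]
  refine ⟨⟨(S.toAddMonoidHom.comp (redN N n)).ker, (mem_latticeSet_iff _).mpr ⟨S, hS, fun v => Iff.rfl⟩⟩, fun v => ?_, ?_⟩
  · rw [← hSk]; rfl
  · intro x y h
    have := congrArg (Bᵀ *ᵥ ·) h
    simpa [hBA] using this

lemma param_count {N n j k m : ℕ} [NeZero N] (hj : 1 ≤ j) (hjk : j + k = n)
    (𝒞 : Set (Fin m → Fin n → ℤ)) (h𝒞 : 𝒞.Finite) :
    (N:ℝ) ^ (k * n) / 12 * Nat.card {p : latticeSet N n j × 𝒞 // ∀ l, p.2.1 l ∈ p.1.1} ≤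
    (latticeSet N n j).ncard * (Nat.card {q : ((Fin n → Fin k → ZMod N) × (Fin m → Fin k → ZMod N)) × 𝒞 //
      ∀ l i, ((q.2.1 l i : ℤ) : ZMod N) = q.1.1 i ⬝ᵥ q.1.2 l} : ℝ) := by
  classical
  haveI : Finite 𝒞 := h𝒞
  haveI : Finite (latticeSet N n j) := latticeSet_finite N n j
  let V := Fin k → ZMod N
  haveI : Finite (V ≃ₗ[ZMod N] V) := Finite.of_injective (fun u => (u : V → V)) DFunLike.coe_injective
  choose ι hι hιL using lattice_param (N := N) (n := n) (j := j) hjk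
  have key1 : (N:ℝ) ^ (k * n) / 12 ≤ (latticeSet N n j).ncard * Nat.card (V ≃ₗ[ZMod N] V) := by
    refine (card_generating (N := N) (by omega)).trans ?_
    rw [← Nat.card_coe_set_eq, ← Nat.cast_mul, ← Nat.card_prod, ← Fintype.card_coe, ← Nat.card_eq_fintype_card]
    have hex : ∀ A : {A : Fin n → Fin k → ZMod N // AddSubgroup.closure (Set.range A) = ⊤},
        ∃ p : latticeSet N n j × (V ≃ₗ[ZMod N] V), (Matrix.of A.1).mulVecLin = ι p.1 ∘ₗ p.2.toLinearMap := by
      intro A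
      obtain ⟨L, hL, hinj⟩ := exists_lattice_of_generating (j := j) hjk (Matrix.of A.1) A.2
      have hr : LinearMap.range (Matrix.of A.1).mulVecLin = LinearMap.range (ι L) := by
        ext w
        obtain ⟨v, rfl⟩ := redN_surjective N n w
        rw [← hL, hιL]
      let e1 := LinearEquiv.ofInjective _ hinj
      let e2 := LinearEquiv.ofInjective _ (hι L)
      refine ⟨(L, e1 ≪≫ₗ (LinearEquiv.ofEq _ _ hr) ≪≫ₗ e2.symm), LinearMap.ext fun x => ?_⟩
      have : ∀ y, ι L (e2.symm y) = y.1 := fun y => by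
        have := e2.apply_symm_apply y
        exact congrArg Subtype.val this
      simp only [LinearMap.comp_apply, LinearEquiv.coe_coe, LinearEquiv.trans_apply, this]
      rfl
    choose g hg using hex
    have : Nat.card {A : Fin n → Fin k → ZMod N // AddSubgroup.closure (Set.range A) = ⊤} ≤ 
        Nat.card (latticeSet N n j × (V ≃ₗ[ZMod N] V)) := by
      refine Nat.card_le_card_of_injective g fun A A' h => ?_
      have h2 := hg A
      rw [h, ← hg A'] at h2
      have h3 := Matrix.ext_iff_mulVec.mpr (fun v => LinearMap.congr_fun h2 v)
      ext1
      exact h3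
    refine le_trans (le_of_eq ?_) (Nat.cast_le.mpr this)
    congr 1
    refine Nat.card_congr (Equiv.subtypeEquivRight fun A => by simp)
  have key2 : Nat.card (V ≃ₗ[ZMod N] V) * Nat.card {p : latticeSet N n j × 𝒞 // ∀ l, p.2.1 l ∈ p.1.1} ≤
      Nat.card {q : ((Fin n → Fin k → ZMod N) × (Fin m → Fin k → ZMod N)) × 𝒞 //
      ∀ l i, ((q.2.1 l i : ℤ) : ZMod N) = q.1.1 i ⬝ᵥ q.1.2 l} := by
    rw [← Nat.card_prod]
    have hex : ∀ x : (V ≃ₗ[ZMod N] V) × {p : latticeSet N n j × 𝒞 // ∀ l, p.2.1 l ∈ p.1.1},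
        ∃ q : {q : ((Fin n → Fin k → ZMod N) × (Fin m → Fin k → ZMod N)) × 𝒞 //
          ∀ l i, ((q.2.1 l i : ℤ) : ZMod N) = q.1.1 i ⬝ᵥ q.1.2 l},
          (Matrix.of q.1.1.1).mulVecLin = ι x.2.1.1 ∘ₗ x.1.toLinearMap ∧ q.1.2 = x.2.1.2 := by
      rintro ⟨g, ⟨⟨L, C⟩, hC⟩⟩
      simp only at hC
      have : ∀ l, ∃ b, (ι L ∘ₗ g.toLinearMap) b = redN N n (C.1 l) := by
        intro l
        obtain ⟨b, hb⟩ := (hιL L _).mp (hC l)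
        exact ⟨g.symm b, by simp [hb]⟩
      choose b hb using this
      refine ⟨⟨((LinearMap.toMatrix' (ι L ∘ₗ g.toLinearMap), b), C), fun l i => ?_⟩, ?_, rfl⟩
      · have := congrFun (hb l) i
        rw [redN_apply] at this
        rw [← this, ← LinearMap.toMatrix'_mulVec (ι L ∘ₗ g.toLinearMap) (b l)]; rfl
      · exact Matrix.toLin'_toMatrix' (ι L ∘ₗ g.toLinearMap)
    choose F hF hF2 using hex
    refine Nat.card_le_card_of_injective F ?_
    rintro ⟨g, ⟨⟨L, C⟩, hC⟩⟩ ⟨g', ⟨⟨L', C'⟩, hC'⟩⟩ h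
    have e1 := hF ⟨g, ⟨⟨L, C⟩, hC⟩⟩
    have e2 := hF2 ⟨g, ⟨⟨L, C⟩, hC⟩⟩
    rw [h, hF] at e1
    rw [h, hF2] at e2
    simp only at e1 e2
    have hLL : L' = L := by
      refine lattice_eq_of_range (hιL L') (hιL L) ?_
      have := congrArg LinearMap.range e1
      rwa [LinearEquiv.range_comp, LinearEquiv.range_comp] at this
    subst hLL
    subst e2
    have : g' = g := by
      ext1 x
      exact hι _ (LinearMap.congr_fun e1 x)
    subst this
    rfl
  calc _ ≤ ((latticeSet N n j).ncard * Nat.card (V ≃ₗ[ZMod N] V) : ℝ) *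
        Nat.card {p : latticeSet N n j × 𝒞 // ∀ l, p.2.1 l ∈ p.1.1} := by gcongr
    _ = (latticeSet N n j).ncard * ((Nat.card (V ≃ₗ[ZMod N] V) * Nat.card {p : latticeSet N n j × 𝒞 // ∀ l, p.2.1 l ∈ p.1.1} : ℕ) : ℝ) := by
        push_cast; ring
    _ ≤ _ := by gcongr

end

section
lemma sum_char_dot {N k : ℕ} [NeZero N] (b : Fin k → ZMod N) :
    ∑ a : Fin k → ZMod N, (ZMod.stdAddChar (a ⬝ᵥ b) : ℂ) = if b = 0 then (N:ℂ) ^ k else 0 := by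
  classical
  let ψ : AddChar (Fin k → ZMod N) ℂ :=
    (ZMod.stdAddChar (N := N)).compAddMonoidHom
      { toFun := fun a => a ⬝ᵥ b, map_zero' := by simp, map_add' := by intros; simp [add_dotProduct] }
  have h := AddChar.sum_eq_ite ψ
  have h1 : ∀ a, ψ a = (ZMod.stdAddChar (a ⬝ᵥ b) : ℂ) := fun a => rfl
  simp only [h1] at h
  rw [h]
  have h2 : ψ = 0 ↔ b = 0 := by
    constructor
    · intro h0
      ext i
      have := DFunLike.congr_fun h0 (Pi.single i 1)
      rw [h1, AddChar.zero_apply, ← AddChar.map_zero_eq_one (ZMod.stdAddChar (N := N))] at this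
      have := ZMod.injective_stdAddChar this
      simpa using this
    · rintro rfl
      ext a
      rw [h1]; simp
  simp [h2]

lemma parseval_count {N k : ℕ} [NeZero N] {ι : Type*} [Fintype ι] (b : ι → Fin k → ZMod N)
    (hb : Function.Injective b) (θ : ι → ZMod N) :
    ∑ a : Fin k → ZMod N, ‖∑ r, (ZMod.stdAddChar (a ⬝ᵥ b r - θ r) : ℂ)‖ ^ 2 = (N:ℝ) ^ k * Fintype.card ι := by
  classical
  have : (((∑ a : Fin k → ZMod N, ‖∑ r, (ZMod.stdAddChar (a ⬝ᵥ b r - θ r) : ℂ)‖ ^ 2 : ℝ)) : ℂ) =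
      (((N:ℝ) ^ k * Fintype.card ι : ℝ) : ℂ) := by
    push_cast
    simp_rw [← Complex.mul_conj', map_sum, Finset.sum_mul_sum, ← AddChar.map_neg_eq_conj, ← AddChar.map_add_eq_mul]
    rw [Finset.sum_comm]
    have e1 : ∀ r, ∑ a : Fin k → ZMod N, ∑ r', (ZMod.stdAddChar (a ⬝ᵥ b r - θ r + -(a ⬝ᵥ b r' - θ r')) : ℂ) = (N:ℂ)^k := by
      intro r
      rw [Finset.sum_comm]
      have e2 : ∀ r', ∑ a : Fin k → ZMod N, (ZMod.stdAddChar (a ⬝ᵥ b r - θ r + -(a ⬝ᵥ b r' - θ r')) : ℂ) =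
          if r = r' then (N:ℂ)^k else 0 := by
        intro r'
        have e3 : ∀ a : Fin k → ZMod N, (ZMod.stdAddChar (a ⬝ᵥ b r - θ r + -(a ⬝ᵥ b r' - θ r')) : ℂ) =
          ZMod.stdAddChar (a ⬝ᵥ (b r - b r')) * ZMod.stdAddChar (θ r' - θ r) := by
          intro a
          rw [← AddChar.map_add_eq_mul, dotProduct_sub]
          congr 1; ring
        simp_rw [e3]
        rw [← Finset.sum_mul, sum_char_dot]
        by_cases h : r = r'
        · subst h; simp
        · have : b r - b r' ≠ 0 := fun h0 => h (hb (sub_eq_zero.mp h0))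
          simp [h, this]
      simp_rw [e2]
      simp
    simp_rw [e1]
    simp [mul_comm]
  exact_mod_cast this

lemma re_stdAddChar_ge {N : ℕ} [NeZero N] (x : ℤ) (hx : 6 * |(x:ℝ)| ≤ N) :
    1 / 2 ≤ ((ZMod.stdAddChar (x : ZMod N) : ℂ)).re := by
  have hN : (0:ℝ) < N := by exact_mod_cast Nat.pos_of_ne_zero (NeZero.ne N)
  rw [ZMod.stdAddChar_coe]
  have : (2 * (Real.pi:ℂ) * Complex.I * x / N) = ((2 * Real.pi * x / N : ℝ) : ℂ) * Complex.I := by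
    push_cast; ring
  rw [this, Complex.exp_ofReal_mul_I_re, ← Real.cos_abs, ← Real.cos_pi_div_three]
  refine Real.cos_le_cos_of_nonneg_of_le_pi (abs_nonneg _) (by linarith [Real.pi_pos]) ?_
  rw [abs_div, abs_mul, abs_of_pos hN, abs_of_pos (by positivity), div_le_div_iff₀ hN (by norm_num)]
  nlinarith [Real.pi_pos]

/-- count of pairs -/
def cntB {N k m : ℕ} (β : Fin m → Fin k → ZMod N) (S : Set (Fin m → ℤ)) : ℕ :=
  Nat.card {q : (Fin k → ZMod N) × S // ∀ l, ((q.2.1 l : ℤ) : ZMod N) = q.1 ⬝ᵥ β l}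

lemma cntB_good {N k m R : ℕ} [NeZero N] (hm : 1 ≤ m) (hR : 1 ≤ R) (β : Fin m → Fin k → ZMod N)
    (hβ : Function.Injective (fun r : Fin m → Fin R => ∑ l, ((r l : ℕ) : ZMod N) • β l))
    (T : ℝ) (hT : 6 * m * R * T ≤ N) (w : Fin m → ℤ) (S : Set (Fin m → ℤ))
    (hS : ∀ c ∈ S, ∀ l, |((c l - w l : ℤ) : ℝ)| ≤ T) : (cntB β S : ℝ) * R ^ m ≤ 4 * N ^ k := by
  classical
  have hN : (0:ℝ) < N := by exact_mod_cast Nat.pos_of_ne_zero (NeZero.ne N)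
  have hmR : (1:ℝ) ≤ m := by exact_mod_cast hm
  have hRR : (1:ℝ) ≤ R := by exact_mod_cast hR
  let D : (Fin k → ZMod N) → ℂ := fun a => ∑ r : Fin m → Fin R,
    (ZMod.stdAddChar (a ⬝ᵥ (∑ l, ((r l : ℕ) : ZMod N) • β l) - ∑ l, ((r l : ℕ) : ZMod N) * (w l : ZMod N)) : ℂ)
  have hpars := parseval_count _ hβ (fun r => ∑ l, ((r l : ℕ) : ZMod N) * (w l : ZMod N))
  let E : Finset (Fin k → ZMod N) := Finset.univ.filter (fun a => ∃ c ∈ S, ∀ l, ((c l : ℤ) : ZMod N) = a ⬝ᵥ β l)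
  have hcard : cntB β S ≤ E.card := by
    rw [← Fintype.card_coe, ← Nat.card_eq_fintype_card]
    refine Nat.card_le_card_of_injective (fun q => ⟨q.1.1, by
      simp only [E, Finset.mem_filter, Finset.mem_univ, true_and]
      exact ⟨q.1.2.1, q.1.2.2, q.2⟩⟩) ?_
    rintro ⟨⟨a, c, hc⟩, h⟩ ⟨⟨a', c', hc'⟩, h'⟩ heq
    simp only [Subtype.mk.injEq] at heq
    subst heq
    simp only at h h'
    have : c = c' := by
      funext l
      have h1 := h l
      rw [← h' l, ZMod.intCast_eq_intCast_iff_dvd_sub] at h1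
      have b1 := hS c hc l
      have b2 := hS c' hc' l
      have hT0 : 0 ≤ T := (abs_nonneg _).trans b1
      have hT3 : 6 * T ≤ N := by
        refine le_trans ?_ hT
        have : (1:ℝ) ≤ m * R := by nlinarith
        nlinarith
      have h3 : |((c' l - c l : ℤ) : ℝ)| < N := by
        push_cast at *
        rw [abs_le] at b1 b2
        rw [abs_lt]
        constructor <;> linarith
      have h4 : |c' l - c l| < (N:ℤ) := by exact_mod_cast h3
      have := Int.eq_zero_of_abs_lt_dvd h1 h4
      omega
    subst this
    rfl
  have hD : ∀ a ∈ E, ((R:ℝ) ^ m / 2) ≤ ‖D a‖ := by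
    intro a ha
    obtain ⟨c, hc, hca⟩ := (Finset.mem_filter.mp ha).2
    have h1 : ∀ r : Fin m → Fin R, (a ⬝ᵥ (∑ l, ((r l : ℕ) : ZMod N) • β l) - ∑ l, ((r l : ℕ) : ZMod N) * (w l : ZMod N))
      = ((∑ l, (r l : ℕ) * (c l - w l) : ℤ) : ZMod N) := by
      intro r
      push_cast
      rw [dotProduct_sum, ← Finset.sum_sub_distrib]
      refine Finset.sum_congr rfl fun l _ => ?_
      rw [dotProduct_smul, ← hca, smul_eq_mul]; ring
    calc (R:ℝ)^m/2 = ∑ r : Fin m → Fin R, (1/2 : ℝ) := by simp; ring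
      _ ≤ ∑ r : Fin m → Fin R, (ZMod.stdAddChar ((∑ l, (r l : ℕ) * (c l - w l) : ℤ) : ZMod N) : ℂ).re := by
          refine Finset.sum_le_sum fun r _ => re_stdAddChar_ge _ ?_
          push_cast
          calc 6 * |∑ l, ((r l : ℕ) : ℝ) * ((c l : ℝ) - w l)| ≤ 6 * ∑ l : Fin m, (R:ℝ) * T := by
                gcongr
                refine (Finset.abs_sum_le_sum_abs _ _).trans (Finset.sum_le_sum fun l _ => ?_)
                rw [abs_mul, Nat.abs_cast]
                have := hS c hc l
                push_cast at this
                have h3 : ((r l : ℕ) : ℝ) ≤ R := by exact_mod_cast (r l).2.le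
                gcongr
            _ = 6 * m * R * T := by simp; ring
            _ ≤ N := hT
      _ = (D a).re := by
          simp only [D, h1]
          rw [Complex.re_sum]
      _ ≤ _ := Complex.re_le_norm _
  have h2 : (E.card : ℝ) * ((R:ℝ)^m/2)^2 ≤ N ^ k * R ^ m := by
    calc _ = ∑ a ∈ E, ((R:ℝ)^m/2)^2 := by simp
      _ ≤ ∑ a ∈ E, ‖D a‖^2 := by
          refine Finset.sum_le_sum fun a ha => ?_
          have := hD a ha
          gcongr
      _ ≤ ∑ a, ‖D a‖^2 := Finset.sum_le_sum_of_subset_of_nonneg (Finset.subset_univ _) (fun _ _ _ => by positivity)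
      _ = _ := by rw [hpars]; simp
  have h3 : (E.card : ℝ) * R^m ≤ 4 * N^k := by
    have hp : (0:ℝ) < R^m := by positivity
    have : (E.card : ℝ) * R^m * R^m ≤ 4 * N^k * R^m := by nlinarith
    exact le_of_mul_le_mul_right this hp
  refine le_trans ?_ h3
  gcongr

end

section
lemma card_box_le {m : ℕ} (B : ℝ) (hB : 0 ≤ B) :
    Finite {x : Fin m → ℤ // ∀ l, |(x l : ℝ)| ≤ B} ∧
    (Nat.card {x : Fin m → ℤ // ∀ l, |(x l : ℝ)| ≤ B} : ℝ) ≤ (2 * B + 1) ^ m := by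
  have hmem : ∀ x : {x : Fin m → ℤ // ∀ l, |(x l : ℝ)| ≤ B}, ∀ l, x.1 l ∈ Finset.Icc (-⌊B⌋) ⌊B⌋ := by
    intro x l
    have := abs_le.mp (x.2 l)
    rw [Finset.mem_Icc]
    refine ⟨?_, Int.le_floor.mpr this.2⟩
    have : -x.1 l ≤ ⌊B⌋ := Int.le_floor.mpr (by push_cast; linarith)
    omega
  let F : {x : Fin m → ℤ // ∀ l, |(x l : ℝ)| ≤ B} → (Fin m → Finset.Icc (-⌊B⌋) ⌊B⌋) := fun x l => ⟨x.1 l, hmem x l⟩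
  have hF : Function.Injective F := by
    intro x y h
    ext l
    exact congrArg Subtype.val (congrFun h l)
  refine ⟨Finite.of_injective F hF, ?_⟩
  have h1 := Nat.card_le_card_of_injective F hF
  have h0 : 0 ≤ ⌊B⌋ := Int.floor_nonneg.mpr hB
  have h2 : ((Finset.Icc (-⌊B⌋) ⌊B⌋).card : ℝ) ≤ 2 * B + 1 := by
    rw [Int.card_Icc]
    have : (((⌊B⌋ + 1 - -⌊B⌋).toNat : ℤ) : ℝ) = 2 * ⌊B⌋ + 1 := by
      rw [Int.toNat_of_nonneg (by omega)]; push_cast; ring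
    have h3 := Int.floor_le B
    rw [Int.cast_natCast] at this
    linarith
  calc (Nat.card {x : Fin m → ℤ // ∀ l, |(x l : ℝ)| ≤ B} : ℝ) ≤ ((Finset.Icc (-⌊B⌋) ⌊B⌋).card : ℝ) ^ m := by
        refine (Nat.cast_le.mpr h1).trans (le_of_eq ?_)
        rw [Nat.card_eq_fintype_card, Fintype.card_fun, Fintype.card_coe, Fintype.card_fin, Nat.cast_pow]
    _ ≤ _ := by gcongr

lemma box_rep {m : ℕ} (c : Fin m → Fin m → ℤ) (hc : LinearIndependent ℝ (fun i l => (c i l : ℝ)))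
    (ρ : ℝ) (hρ : ∀ i l, |(c i l : ℝ)| ≤ ρ) (v : Fin m → ℤ) :
    ∃ z : Fin m → ℤ, ∀ l, |((v l - ∑ i, z i * c i l : ℤ) : ℝ)| ≤ m * ρ := by
  classical
  let b := basisOfLinearIndependentOfCardEqFinrank' _ hc (by simp)
  let t := b.repr (fun l => (v l : ℝ))
  have ht : ∀ l, (v l : ℝ) = ∑ i, t i * c i l := by
    intro l
    have := congrFun (b.sum_repr (fun l => (v l : ℝ))) l
    rw [← this, Finset.sum_apply]
    refine Finset.sum_congr rfl fun i _ => ?_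
    simp [b, t]
  refine ⟨fun i => ⌊t i⌋, fun l => ?_⟩
  push_cast
  rw [ht, ← Finset.sum_sub_distrib]
  calc _ ≤ ∑ i : Fin m, ρ := by
        refine (Finset.abs_sum_le_sum_abs _ _).trans (Finset.sum_le_sum fun i _ => ?_)
        rw [← sub_mul, abs_mul]
        have h1 : |t i - ⌊t i⌋| ≤ 1 := by
          rw [abs_le]; constructor <;> linarith [Int.floor_le (t i), Int.lt_floor_add_one (t i)]
        calc _ ≤ 1 * ρ := mul_le_mul h1 (hρ i l) (abs_nonneg _) (by norm_num)
          _ = ρ := one_mul _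
    _ = _ := by simp

/-- the map `a ↦ aβ` -/
def dotHom {N k m : ℕ} (β : Fin m → Fin k → ZMod N) : (Fin k → ZMod N) →+ (Fin m → ZMod N) where
  toFun a := fun l => a ⬝ᵥ β l
  map_zero' := by ext; simp
  map_add' := by intros; ext; simp [add_dotProduct]

lemma cntB_span {N k m : ℕ} [NeZero N] (β : Fin m → Fin k → ZMod N) (ρ : ℝ) (hρ0 : 0 ≤ ρ)
    (c : Fin m → Fin m → ℤ) (hc : LinearIndependent ℝ (fun i l => (c i l : ℝ)))
    (hρ : ∀ i l, |(c i l : ℝ)| ≤ ρ) (hcβ : ∀ i, ∃ a, redN N m (c i) = dotHom β a)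
    (S : Set (Fin m → ℤ)) (hS : ∀ x ∈ S, ∀ l, |(x l : ℝ)| ≤ ρ) :
    (cntB β S : ℝ) * N ^ m ≤ N ^ k * (2 * ((m + 1) * ρ) + 1) ^ m := by
  classical
  let φ := dotHom β
  obtain ⟨hfin, hbox⟩ := card_box_le (m := m) ((m+1) * ρ) (by positivity)
  have hrep : ∀ q : (Fin m → ZMod N) ⧸ φ.range, ∃ v : Fin m → ℤ, (∀ l, |(v l : ℝ)| ≤ m * ρ) ∧
      QuotientAddGroup.mk (redN N m v) = q := by
    intro q
    obtain ⟨w, rfl⟩ := QuotientAddGroup.mk_surjective q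
    obtain ⟨v, rfl⟩ := redN_surjective N m w
    obtain ⟨z, hz⟩ := box_rep c hc ρ hρ v
    refine ⟨fun l => v l - ∑ i, z i * c i l, hz, ?_⟩
    rw [QuotientAddGroup.eq]
    choose a ha using hcβ
    refine ⟨∑ i, z i • a i, ?_⟩
    rw [map_sum]
    simp_rw [map_zsmul]
    change ∑ i, z i • dotHom β (a i) = _
    simp_rw [← ha, ← map_zsmul]
    rw [← map_sum, ← map_neg, ← map_add]
    congr 1
    ext l
    simp
  choose rep hrep1 hrep2 using hrep
  have hsol : ∀ x : S, ∀ a0, (∀ l, ((x.1 l : ℤ) : ZMod N) = a0 ⬝ᵥ β l) → ∀ y, φ y = redN N m x.1 → a0 - y ∈ φ.ker := by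
    intro x a0 h y hy
    rw [AddMonoidHom.mem_ker, map_sub, hy, sub_eq_zero]
    ext l; exact (h l).symm
  let pick : (Fin m → ℤ) → (Fin k → ZMod N) := fun x => if h : ∃ y, φ y = redN N m x then h.choose else 0
  have hpick : ∀ x, (∃ y, φ y = redN N m x) → φ (pick x) = redN N m x := by
    intro x h
    simp only [pick, h, dif_pos]
    exact h.choose_spec
  have hinj : cntB β S * Nat.card ((Fin m → ZMod N) ⧸ φ.range) ≤ Nat.card φ.ker *
      Nat.card {x : Fin m → ℤ // ∀ l, |(x l : ℝ)| ≤ (m+1) * ρ} := by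
    rw [cntB, ← Nat.card_prod, ← Nat.card_prod]
    have hex : ∀ q : {q : (Fin k → ZMod N) × S // ∀ l, ((q.2.1 l : ℤ) : ZMod N) = q.1 ⬝ᵥ β l}, φ q.1.1 = redN N m q.1.2.1 := by
      intro q; ext l; exact (q.2 l).symm
    refine Nat.card_le_card_of_injective (fun p => (⟨p.1.1.1 - pick p.1.1.2.1,
      hsol p.1.1.2 _ p.1.2 _ (hpick _ ⟨_, hex p.1⟩)⟩, ⟨fun l => p.1.1.2.1 l + rep p.2 l, fun l => by
        push_cast
        refine (abs_add_le _ _).trans ?_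
        have h1 := hS _ p.1.1.2.2 l
        have h2 := hrep1 p.2 l
        linarith⟩)) ?_
    rintro ⟨⟨⟨a, x, hx⟩, h⟩, q⟩ ⟨⟨⟨a', x', hx'⟩, h'⟩, q'⟩ heq
    simp only [Prod.mk.injEq, Subtype.mk.injEq] at heq
    obtain ⟨h1, h2⟩ := heq
    have e1 := hex ⟨⟨a, x, hx⟩, h⟩
    have e2 := hex ⟨⟨a', x', hx'⟩, h'⟩
    simp only at e1 e2
    have hq : q = q' := by
      have h3 : ∀ (x : Fin m → ℤ) (q : (Fin m → ZMod N) ⧸ φ.range) (a), φ a = redN N m x →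
          (QuotientAddGroup.mk (redN N m (fun l => x l + rep q l)) : (Fin m → ZMod N) ⧸ φ.range) = q := by
        intro x q a ha
        have : redN N m (fun l => x l + rep q l) = redN N m x + redN N m (rep q) := by
          rw [← map_add]; rfl
        rw [this, QuotientAddGroup.mk_add, hrep2, ← ha]
        have : (QuotientAddGroup.mk (φ a) : (Fin m → ZMod N) ⧸ φ.range) = 0 :=
          (QuotientAddGroup.eq_zero_iff _).mpr ⟨a, rfl⟩
        rw [this, zero_add]
      rw [← h3 x q a e1, h2, h3 x' q' a' e2]
    subst hq
    have hxx : x = x' := by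
      funext l
      exact add_right_cancel (congrFun h2 l)
    subst hxx
    have : a = a' := sub_left_injective h1
    subst this
    rfl
  have h1 : Nat.card φ.ker * Nat.card φ.range = N ^ k := by
    have := AddSubgroup.card_eq_card_quotient_mul_card_addSubgroup φ.ker
    rw [Nat.card_congr (QuotientAddGroup.quotientKerEquivRange φ).toEquiv] at this
    have h3 : Nat.card (Fin k → ZMod N) = N ^ k := by simp
    rw [← h3, this, mul_comm]
  have h2 : Nat.card ((Fin m → ZMod N) ⧸ φ.range) * Nat.card φ.range = N ^ m := by
    have := AddSubgroup.card_eq_card_quotient_mul_card_addSubgroup φ.range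
    have h3 : Nat.card (Fin m → ZMod N) = N ^ m := by simp
    rw [← h3, this]
  have h3 : cntB β S * N ^ m ≤ N ^ k * Nat.card {x : Fin m → ℤ // ∀ l, |(x l : ℝ)| ≤ (m+1) * ρ} := by
    calc cntB β S * N ^ m = cntB β S * Nat.card ((Fin m → ZMod N) ⧸ φ.range) * Nat.card φ.range := by
          rw [← h2]; ring
      _ ≤ Nat.card φ.ker * Nat.card {x : Fin m → ℤ // ∀ l, |(x l : ℝ)| ≤ (m+1) * ρ} * Nat.card φ.range := by gcongr
      _ = _ := by rw [← h1]; ring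
  calc (cntB β S : ℝ) * N ^ m ≤ N ^ k * Nat.card {x : Fin m → ℤ // ∀ l, |(x l : ℝ)| ≤ (m+1) * ρ} := by exact_mod_cast h3
    _ ≤ _ := by gcongr

end

section
lemma exists_gcd_ker {N m : ℕ} [NeZero N] (ξ : Fin m → ℤ) :
    ∃ g ∈ N.divisors, (∀ l, (g:ℤ) ∣ ξ l) ∧
      Nat.card {b : Fin m → ZMod N // ∑ l, (ξ l : ZMod N) * b l = 0} * N = N ^ m * g := by
  let φ : (Fin m → ZMod N) →+ ZMod N :=
    { toFun := fun b => ∑ l, (ξ l : ZMod N) * b l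
      map_zero' := by simp
      map_add' := by intro x y; simp [mul_add, Finset.sum_add_distrib] }
  have hdvd : Nat.card φ.range ∣ N := by
    have := AddSubgroup.card_addSubgroup_dvd_card φ.range
    simpa using this
  obtain ⟨g, hg⟩ := hdvd
  have hN : N ≠ 0 := NeZero.ne N
  have hM : Nat.card φ.range ≠ 0 := fun h => hN (by rw [hg, h, zero_mul])
  refine ⟨g, ?_, ?_, ?_⟩
  · simp [hN]; exact ⟨_, by rw [mul_comm]; exact hg⟩
  · intro l
    have h1 : (ξ l : ZMod N) ∈ φ.range := ⟨Pi.single l 1, by simp [φ, Pi.single_apply]⟩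
    have h2 : Nat.card φ.range • (⟨_, h1⟩ : φ.range) = 0 := card_nsmul_eq_zero'
    have h3 : Nat.card φ.range • (ξ l : ZMod N) = 0 := congrArg Subtype.val h2
    have h4 : ((Nat.card φ.range * ξ l : ℤ) : ZMod N) = 0 := by
      push_cast; rw [← nsmul_eq_mul]; exact h3
    rw [ZMod.intCast_zmod_eq_zero_iff_dvd] at h4
    have h5 : ((Nat.card φ.range : ℤ) * g) ∣ Nat.card φ.range * ξ l := by
      have : (N:ℤ) = Nat.card φ.range * g := by exact_mod_cast hg
      rwa [← this]
    exact (mul_dvd_mul_iff_left (by exact_mod_cast hM)).mp h5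
  · have h1 := AddSubgroup.card_eq_card_quotient_mul_card_addSubgroup φ.ker
    rw [Nat.card_congr (QuotientAddGroup.quotientKerEquivRange φ).toEquiv] at h1
    have h3 : Nat.card (Fin m → ZMod N) = N ^ m := by simp
    have h4 : Nat.card {b : Fin m → ZMod N // ∑ l, (ξ l : ZMod N) * b l = 0} = Nat.card φ.ker := rfl
    rw [h4, ← h3, h1]
    calc Nat.card φ.ker * N = Nat.card φ.ker * (Nat.card φ.range * g) := congrArg (Nat.card φ.ker * ·) hg
      _ = _ := by ring

/-- `β` is bad if it fails to be injective on the box. -/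
def BadB {N k m : ℕ} (R : ℕ) (β : Fin m → Fin k → ZMod N) : Prop :=
  ¬ Function.Injective (fun r : Fin m → Fin R => ∑ l, ((r l : ℕ) : ZMod N) • β l)

lemma badB_exists {N k m R : ℕ} (β : Fin m → Fin k → ZMod N) (h : BadB R β) :
    ∃ ξ : Fin m → ℤ, ξ ≠ 0 ∧ (∀ l, |ξ l| < R) ∧ ∀ t, ∑ l, (ξ l : ZMod N) * β l t = 0 := by
  unfold BadB Function.Injective at h
  push Not at h
  obtain ⟨r, r', h1, h2⟩ := h
  refine ⟨fun l => ((r l : ℕ) : ℤ) - ((r' l : ℕ) : ℤ), ?_, fun l => ?_, fun t => ?_⟩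
  · intro h0
    apply h2
    funext l
    have := congrFun h0 l
    simp only [Pi.zero_apply] at this
    ext
    omega
  · rw [abs_lt]
    have := (r l).2
    have := (r' l).2
    show -(R:ℤ) < ((r l : ℕ) : ℤ) - ((r' l : ℕ) : ℤ) ∧ ((r l : ℕ) : ℤ) - ((r' l : ℕ) : ℤ) < R
    constructor <;> omega
  · have := congrFun h1 t
    simp only [Finset.sum_apply, Pi.smul_apply, smul_eq_mul] at this
    push_cast
    simp_rw [sub_mul]
    rw [Finset.sum_sub_distrib, this, sub_self]

/-- Counting the bad `β`. -/
lemma card_badB {N k m R : ℕ} [NeZero N] (hkm : k ≤ m) :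
    (Nat.card {β : Fin m → Fin k → ZMod N // BadB R β} : ℝ) * N ^ k ≤
      N.divisors.card * (3 * R) ^ m * N ^ (m * k) := by
  classical
  have hN : (0:ℝ) < N := by exact_mod_cast Nat.pos_of_ne_zero (NeZero.ne N)
  choose g hg hgd hgc using fun ξ : Fin m → ℤ => exists_gcd_ker (N := N) ξ
  -- vectors
  let Ξ := {ξ : Fin m → ℤ // ξ ≠ 0 ∧ ∀ l, |ξ l| < R}
  have hΞ : Finite Ξ := by
    have := (card_box_le (m := m) (R:ℝ) (by positivity)).1
    refine Finite.of_injective (β := {x : Fin m → ℤ // ∀ l, |(x l : ℝ)| ≤ (R:ℝ)}) (fun ξ => ⟨ξ.1, fun l => by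
      exact_mod_cast (ξ.2.2 l).le⟩) ?_
    intro x y h
    exact Subtype.ext (congrArg (fun z => z.1) h)
  haveI : Fintype Ξ := Fintype.ofFinite _
  have hβ : ∀ ξ : Ξ, (Nat.card {β : Fin m → Fin k → ZMod N // ∀ t, ∑ l, (ξ.1 l : ZMod N) * β l t = 0} : ℝ) * N ^ k
      = N ^ (m * k) * (g ξ.1) ^ k := by
    intro ξ
    have e : {β : Fin m → Fin k → ZMod N // ∀ t, ∑ l, (ξ.1 l : ZMod N) * β l t = 0} ≃
        (Fin k → {b : Fin m → ZMod N // ∑ l, (ξ.1 l : ZMod N) * b l = 0}) :=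
      { toFun := fun β t => ⟨fun l => β.1 l t, β.2 t⟩
        invFun := fun b => ⟨fun l t => (b t).1 l, fun t => (b t).2⟩
        left_inv := fun β => rfl
        right_inv := fun b => rfl }
    rw [Nat.card_congr e]
    have h2 := hgc ξ.1
    have h3 : Nat.card (Fin k → {b : Fin m → ZMod N // ∑ l, (ξ.1 l : ZMod N) * b l = 0}) =
      (Nat.card {b : Fin m → ZMod N // ∑ l, (ξ.1 l : ZMod N) * b l = 0}) ^ k := by
      rw [Nat.card_pi]; simp
    rw [h3]
    have h4 : (Nat.card {b : Fin m → ZMod N // ∑ l, (ξ.1 l : ZMod N) * b l = 0} * N) ^ k = (N ^ m * g ξ.1) ^ k := by rw [h2]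
    rw [pow_mul, ← mul_pow]
    rw [mul_pow] at h4
    rw [Nat.cast_pow, ← mul_pow]
    exact_mod_cast (by rw [mul_pow, h4] : (Nat.card {b : Fin m → ZMod N // ∑ l, (ξ.1 l : ZMod N) * b l = 0} * N) ^ k = (N ^ m * g ξ.1) ^ k)
  have hub : (Nat.card {β : Fin m → Fin k → ZMod N // BadB R β}) ≤
      ∑ ξ : Ξ, Nat.card {β : Fin m → Fin k → ZMod N // ∀ t, ∑ l, (ξ.1 l : ZMod N) * β l t = 0} := by
    rw [← Nat.card_sigma]
    have hex : ∀ β : {β : Fin m → Fin k → ZMod N // BadB R β}, ∃ ξ : Ξ, ∀ t, ∑ l, (ξ.1 l : ZMod N) * β.1 l t = 0 := by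
      intro β
      obtain ⟨ξ, h1, h2, h3⟩ := badB_exists β.1 β.2
      exact ⟨⟨ξ, h1, h2⟩, h3⟩
    choose F hF using hex
    refine Nat.card_le_card_of_injective (fun β => ⟨F β, β.1, hF β⟩) ?_
    intro β β' h
    exact Subtype.ext (congrArg (fun s : (ξ : Ξ) × {β : Fin m → Fin k → ZMod N // ∀ t, ∑ l, (ξ.1 l : ZMod N) * β l t = 0} => s.2.1) h)
  have hcount : ∀ d ∈ N.divisors, ((Finset.univ.filter (fun ξ : Ξ => g ξ.1 = d)).card : ℝ) * d ^ k ≤ (3 * R) ^ m := by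
    intro d hd
    have hd1 : 1 ≤ d := Nat.pos_of_mem_divisors hd
    have hd1' : (1:ℝ) ≤ d := by exact_mod_cast hd1
    by_cases hRd : d < R
    · have hRd' : (d:ℝ) < R := by exact_mod_cast hRd
      obtain ⟨hf, hb⟩ := card_box_le (m := m) ((R:ℝ)/d) (by positivity)
      have h1 : ((Finset.univ.filter (fun ξ : Ξ => g ξ.1 = d)).card) ≤ Nat.card {x : Fin m → ℤ // ∀ l, |(x l : ℝ)| ≤ (R:ℝ)/d} := by
        rw [← Fintype.card_coe, ← Nat.card_eq_fintype_card]
        have hdiv : ∀ ξ : {ξ // ξ ∈ Finset.univ.filter (fun ξ : Ξ => g ξ.1 = d)}, ∀ l, (d:ℤ) ∣ ξ.1.1 l := by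
          intro ξ l
          have e := (Finset.mem_filter.mp ξ.2).2
          have e2 := hgd ξ.1.1 l
          rwa [e] at e2
        choose q hq using hdiv
        refine Nat.card_le_card_of_injective (fun ξ => ⟨q ξ, fun l => ?_⟩) ?_
        · have h2 : |((ξ.1.1 l : ℤ) : ℝ)| < R := by exact_mod_cast ξ.1.2.2 l
          rw [hq ξ l] at h2
          push_cast at h2
          rw [abs_mul, Nat.abs_cast] at h2
          rw [le_div_iff₀ (by linarith), mul_comm]; exact h2.le
        · intro ξ ξ' h
          have h' : q ξ = q ξ' := congrArg Subtype.val h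
          ext l
          rw [hq, hq, h']
      calc _ ≤ (2 * ((R:ℝ)/d) + 1) ^ m * d ^ k := by
            gcongr
            exact (Nat.cast_le.mpr h1).trans hb
        _ ≤ (3 * (R/d)) ^ m * d ^ m := by
            have : 1 ≤ (R:ℝ)/d := by rw [le_div_iff₀ (by linarith)]; linarith
            gcongr
            · linarith
        _ = _ := by rw [← mul_pow]; congr 1; field_simp
    · have : (Finset.univ.filter (fun ξ : Ξ => g ξ.1 = d)) = ∅ := by
        rw [Finset.filter_eq_empty_iff]
        intro ξ _ h
        apply ξ.2.1
        funext l
        refine Int.eq_zero_of_abs_lt_dvd (hgd ξ.1 l) ?_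
        have := ξ.2.2 l
        rw [h]
        push Not at hRd
        exact lt_of_lt_of_le this (by exact_mod_cast hRd)
      rw [this]; simp
  calc (Nat.card {β : Fin m → Fin k → ZMod N // BadB R β} : ℝ) * N ^ k
      ≤ (∑ ξ : Ξ, (Nat.card {β : Fin m → Fin k → ZMod N // ∀ t, ∑ l, (ξ.1 l : ZMod N) * β l t = 0} : ℝ)) * N ^ k := by
        gcongr; exact_mod_cast hub
    _ = N ^ (m*k) * ∑ ξ : Ξ, (g ξ.1 : ℝ) ^ k := by
        rw [Finset.sum_mul, Finset.mul_sum]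
        exact Finset.sum_congr rfl fun ξ _ => hβ ξ
    _ = N ^ (m*k) * ∑ d ∈ N.divisors, ((Finset.univ.filter (fun ξ : Ξ => g ξ.1 = d)).card : ℝ) * d ^ k := by
        congr 1
        rw [← Finset.sum_fiberwise_of_maps_to (t := N.divisors) (g := fun ξ : Ξ => g ξ.1) (fun ξ _ => hg ξ.1)]
        refine Finset.sum_congr rfl fun d _ => ?_
        rw [← nsmul_eq_mul, ← Finset.sum_const]
        refine Finset.sum_congr rfl fun ξ hξ => ?_
        rw [(Finset.mem_filter.mp hξ).2]
    _ ≤ N ^ (m*k) * ∑ d ∈ N.divisors, ((3:ℝ) * R) ^ m := by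
        gcongr with d hd
        exact hcount d hd
    _ = _ := by rw [Finset.sum_const, nsmul_eq_mul]; ring

end

section
lemma exists_indep_rows {m n : ℕ} (M : Fin m → Fin n → ℝ) (hM : LinearIndependent ℝ M) :
    ∃ f : Fin m → Fin n, LinearIndependent ℝ (fun i l => M l (f i)) := by
  have h1 : (Matrix.of M).rank = m := by
    have := LinearIndependent.rank_matrix (M := Matrix.of M) hM
    simpa using this
  have h2 : Module.finrank ℝ (Submodule.span ℝ (Set.range (Matrix.of M)ᵀ)) = m :=
    (Matrix.rank_eq_finrank_span_cols _).symm.trans h1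
  obtain ⟨f, hf, -, hli⟩ := Submodule.exists_fun_fin_finrank_span_eq ℝ (Set.range (Matrix.of M)ᵀ)
  choose g hg using hf
  have hli2 := hli.comp (Fin.cast h2.symm) (Fin.cast_injective _)
  refine ⟨fun i => g (Fin.cast h2.symm i), ?_⟩
  have e : (fun i l => M l (g (Fin.cast h2.symm i))) = f ∘ Fin.cast h2.symm := by
    funext i
    exact hg _
  rw [e]; exact hli2

/-- integer vectors near a real vector -/
def nearZ {m : ℕ} (z : Fin m → ℝ) (B : ℝ) : Set (Fin m → ℤ) := {c | ∀ l, |(c l : ℝ) - z l| ≤ B}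

/-- independent integer tuples near a real tuple -/
def nearC {m n : ℕ} (z : Fin m → Fin n → ℝ) (B : ℝ) : Set (Fin m → Fin n → ℤ) :=
  {C | LinearIndependent ℝ (fun l i => (C l i : ℝ)) ∧ ∀ l i, |(C l i : ℝ) - z l i| ≤ B}

lemma nearZ_finite {m : ℕ} (z : Fin m → ℝ) (B : ℝ) : (nearZ z B).Finite := by
  have : nearZ z B ⊆ Set.pi Set.univ (fun l => Set.Icc ⌈z l - B⌉ ⌊z l + B⌋) := by
    intro c hc l _
    have := abs_le.mp (hc l)
    constructor
    · rw [Int.ceil_le]; linarith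
    · rw [Int.le_floor]; linarith
  exact (Set.Finite.pi' (fun l => Set.finite_Icc _ _)).subset (fun c hc l => this hc l trivial)

lemma nearC_finite {m n : ℕ} (z : Fin m → Fin n → ℝ) (B : ℝ) : (nearC z B).Finite := by
  refine (Set.Finite.pi' (fun l => nearZ_finite (z l) B)).subset ?_
  intro C hC l i
  exact hC.2 l i

/-- pairs for fixed `β` -/
def cntQ {N n k m : ℕ} (β : Fin m → Fin k → ZMod N) (𝒞 : Set (Fin m → Fin n → ℤ)) : ℕ :=
  Nat.card {q : (Fin n → Fin k → ZMod N) × 𝒞 // ∀ l i, ((q.2.1 l i : ℤ) : ZMod N) = q.1 i ⬝ᵥ β l}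

lemma cntQ_le {N n k m : ℕ} [NeZero N] (β : Fin m → Fin k → ZMod N) (z : Fin m → Fin n → ℝ) (B : ℝ) :
    cntQ β (nearC z B) ≤ ∏ i, cntB β (nearZ (fun l => z l i) B) := by
  classical
  unfold cntQ cntB
  rw [← Nat.card_pi]
  haveI : ∀ i, Finite (nearZ (fun l => z l i) B) := fun i => nearZ_finite _ _
  refine Nat.card_le_card_of_injective (fun q i => ⟨(q.1.1 i, ⟨fun l => q.1.2.1 l i, fun l => q.1.2.2.2 l i⟩), fun l => q.2 l i⟩) ?_
  intro q q' h
  apply Subtype.ext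
  refine Prod.ext ?_ (Subtype.ext ?_)
  · funext i
    exact congrArg (fun s => s.1.1) (congrFun h i)
  · funext l i
    exact congrFun (congrArg (fun s => s.1.2.1) (congrFun h i)) l

lemma cntQ_good {N n k m R : ℕ} [NeZero N] (hm : 1 ≤ m) (hR : 1 ≤ R) (β : Fin m → Fin k → ZMod N)
    (hβ : ¬ BadB R β) (z : Fin m → Fin n → ℝ) (B : ℝ) (hB : 1 ≤ 2 * B) (hT : 12 * m * R * B ≤ N) :
    (cntQ β (nearC z B) : ℝ) * R ^ (m * n) ≤ 4 ^ n * N ^ (k * n) := by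
  unfold BadB at hβ
  push Not at hβ
  have h1 : ∀ i : Fin n, (cntB β (nearZ (fun l => z l i) B) : ℝ) * R ^ m ≤ 4 * N ^ k := by
    intro i
    refine cntB_good hm hR β hβ (2 * B) (by linarith) (fun l => round (z l i)) _ ?_
    intro c hc l
    push_cast
    have h2 := hc l
    have h3 := abs_sub_round (z l i)
    have : (c l : ℝ) - round (z l i) = ((c l : ℝ) - z l i) + (z l i - round (z l i)) := by ring
    rw [this]
    refine (abs_add_le _ _).trans ?_
    linarith
  calc (cntQ β (nearC z B) : ℝ) * R ^ (m * n) ≤ (∏ i : Fin n, (cntB β (nearZ (fun l => z l i) B) : ℝ)) * R ^ (m * n) := by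
        gcongr; exact_mod_cast cntQ_le β z B
    _ = ∏ i : Fin n, ((cntB β (nearZ (fun l => z l i) B) : ℝ) * R ^ m) := by
        rw [Finset.prod_mul_distrib]; simp [pow_mul]
    _ ≤ ∏ i : Fin n, ((4:ℝ) * N ^ k) := Finset.prod_le_prod (fun i _ => by positivity) fun i _ => h1 i
    _ = _ := by simp [mul_pow, pow_mul]

lemma cntQ_any {N n k m : ℕ} [NeZero N] (β : Fin m → Fin k → ZMod N)
    (z : Fin m → Fin n → ℝ) (B ρ : ℝ) (hρ : 0 ≤ ρ) (hz : ∀ l i, |z l i| + B ≤ ρ) :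
    (cntQ β (nearC z B) : ℝ) * N ^ (m * n) ≤ N ^ (k * n) * (2 * ((m + 1) * ρ) + 1) ^ (m * n) := by
  by_cases h0 : cntQ β (nearC z B) = 0
  · rw [h0]; simp; positivity
  haveI : Nonempty {q : (Fin n → Fin k → ZMod N) × (nearC z B) // ∀ l i, ((q.2.1 l i : ℤ) : ZMod N) = q.1 i ⬝ᵥ β l} := by
    by_contra h
    rw [not_nonempty_iff] at h
    exact h0 (by unfold cntQ; exact Nat.card_of_isEmpty)
  obtain ⟨⟨⟨A, C⟩, hAC⟩⟩ := this
  obtain ⟨f, hf⟩ := exists_indep_rows _ C.2.1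
  have hbd : ∀ i, ∀ c ∈ nearZ (fun l => z l i) B, ∀ l, |(c l : ℝ)| ≤ ρ := by
    intro i c hc l
    have h1 := hc l
    have h2 := hz l i
    have : (c l : ℝ) = ((c l : ℝ) - z l i) + z l i := by ring
    rw [this]
    refine (abs_add_le _ _).trans ?_
    simp only at h1
    linarith
  have h1 : ∀ i : Fin n, (cntB β (nearZ (fun l => z l i) B) : ℝ) * N ^ m ≤ N ^ k * (2 * ((m + 1) * ρ) + 1) ^ m := by
    intro i
    refine cntB_span β ρ hρ (fun i l => C.1 l (f i)) hf ?_ ?_ _ (hbd i)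
    · intro i l
      exact hbd (f i) (fun l => C.1 l (f i)) (fun l => C.2.2 l (f i)) l
    · intro i
      refine ⟨A (f i), ?_⟩
      funext l
      exact hAC l (f i)
  calc (cntQ β (nearC z B) : ℝ) * N ^ (m * n) ≤ (∏ i : Fin n, (cntB β (nearZ (fun l => z l i) B) : ℝ)) * N ^ (m * n) := by
        gcongr; exact_mod_cast cntQ_le β z B
    _ = ∏ i : Fin n, ((cntB β (nearZ (fun l => z l i) B) : ℝ) * N ^ m) := by
        rw [Finset.prod_mul_distrib]; simp [pow_mul]
    _ ≤ ∏ i : Fin n, ((N:ℝ) ^ k * (2 * ((m + 1) * ρ) + 1) ^ m) := Finset.prod_le_prod (fun i _ => by positivity) fun i _ => h1 i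
    _ = _ := by simp [mul_pow, pow_mul]

lemma card_Q_eq {N n k m : ℕ} [NeZero N] (𝒞 : Set (Fin m → Fin n → ℤ)) (h𝒞 : 𝒞.Finite) :
    Nat.card {q : ((Fin n → Fin k → ZMod N) × (Fin m → Fin k → ZMod N)) × 𝒞 //
      ∀ l i, ((q.2.1 l i : ℤ) : ZMod N) = q.1.1 i ⬝ᵥ q.1.2 l} = ∑ β : Fin m → Fin k → ZMod N, cntQ β 𝒞 := by
  classical
  haveI : Finite 𝒞 := h𝒞
  unfold cntQ
  rw [← Nat.card_sigma]
  exact Nat.card_congr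
    { toFun := fun q => ⟨q.1.1.2, ⟨(q.1.1.1, q.1.2), q.2⟩⟩
      invFun := fun q => ⟨((q.2.1.1, q.1), q.2.1.2), q.2.2⟩
      left_inv := fun _ => rfl
      right_inv := fun _ => rfl }


lemma count_bound {m j k : ℕ} (hm : 1 ≤ m) (hj : 1 ≤ j) (hk : 1 ≤ k) (hjk : j + k = m + 1)
    (N : ℕ) [NeZero N] (S ε ρ : ℝ) (hε : 0 < ε) (hρ : 0 < ρ) (hSN : S ^ (m + 1) = (N:ℝ) ^ j) (hS1 : 1 ≤ S)
    (h2 : 1 ≤ 2 * (ε * S)) (h3 : 12 * m * (ε * S) ≤ N)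
    (h4 : (2 * ((m + 1) * (ρ + ε)) + 1) ^ (m * (m + 1)) * N.divisors.card * (N:ℝ) ^ m ≤
      ε ^ (m * (m + 1)) * (4 * m * ε) ^ m * S ^ m * N ^ k)
    (z : Fin m → Fin (m + 1) → ℝ) (hz : ∀ l i, |z l i| ≤ S * ρ) :
    (Nat.card {p : latticeSet N (m + 1) j × nearC z (ε * S) // ∀ l, p.2.1 l ∈ p.1.1} : ℝ) ≤
      12 * (4 ^ (m + 1) * (24 * m) ^ (m * (m + 1)) + 1) * ε ^ (m * (m + 1)) * (latticeSet N (m + 1) j).ncard := by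
  classical
  have hN : (0:ℝ) < N := by exact_mod_cast Nat.pos_of_ne_zero (NeZero.ne N)
  have hmR : (1:ℝ) ≤ m := by exact_mod_cast hm
  have hS0 : 0 < S := by linarith
  have hd0 : 0 < 12 * m * (ε * S) := by positivity
  set R : ℕ := ⌊(N:ℝ) / (12 * m * (ε * S))⌋₊ with hRdef
  have hR0 : (1:ℝ) ≤ (N:ℝ) / (12 * m * (ε * S)) := by rw [le_div_iff₀ hd0]; linarith
  have hR1 : 1 ≤ R := by rw [hRdef, Nat.one_le_floor_iff]; exact hR0
  have hR1' : (1:ℝ) ≤ R := by exact_mod_cast hR1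
  have hRu : (R:ℝ) ≤ (N:ℝ) / (12 * m * (ε * S)) := Nat.floor_le (by positivity)
  have hRl : (N:ℝ) / (12 * m * (ε * S)) ≤ 2 * R := by
    have := Nat.lt_floor_add_one ((N:ℝ) / (12 * m * (ε * S)))
    rw [← hRdef] at this
    linarith
  have hRu' : 12 * m * R * (ε * S) ≤ N := by
    rw [le_div_iff₀ hd0] at hRu; linarith
  have hRl' : (N:ℝ) / S ≤ 24 * m * ε * R := by
    rw [div_le_iff₀ hd0] at hRl
    rw [div_le_iff₀ hS0]; linarith
  have hSp : S ^ (m * (m + 1)) = (N:ℝ) ^ (j * m) := by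
    rw [mul_comm m, pow_mul, hSN, ← pow_mul]
  have hNp : (N:ℝ) ^ (m * (m + 1)) = N ^ (k * m) * N ^ (j * m) := by
    rw [← pow_add]; congr 1; rw [← hjk]; ring
  -- good
  have hgood : ∀ β : Fin m → Fin k → ZMod N, ¬ BadB R β →
      (cntQ β (nearC z (ε * S)) : ℝ) * N ^ (k * m) ≤ 4 ^ (m + 1) * (24 * m) ^ (m * (m + 1)) * ε ^ (m * (m + 1)) * N ^ (k * (m + 1)) := by
    intro β hβ
    have h := cntQ_good hm hR1 β hβ z (ε * S) h2 hRu'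
    have h5 : (N:ℝ) ^ (k * m) ≤ (24 * m * ε * R) ^ (m * (m + 1)) := by
      calc (N:ℝ) ^ (k * m) = (N / S) ^ (m * (m + 1)) := by
            rw [div_pow, hSp, hNp]; field_simp
        _ ≤ _ := by gcongr
    calc (cntQ β (nearC z (ε * S)) : ℝ) * N ^ (k * m) ≤ cntQ β (nearC z (ε * S)) * (24 * m * ε * R) ^ (m * (m + 1)) := by gcongr
      _ = (cntQ β (nearC z (ε * S)) * R ^ (m * (m + 1))) * ((24 * m) ^ (m * (m + 1)) * ε ^ (m * (m + 1))) := by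
          rw [mul_pow, mul_pow]; ring
      _ ≤ (4 ^ (m + 1) * N ^ (k * (m + 1))) * ((24 * m) ^ (m * (m + 1)) * ε ^ (m * (m + 1))) := by gcongr
      _ = _ := by ring
  have hbad : ∀ β : Fin m → Fin k → ZMod N,
      (cntQ β (nearC z (ε * S)) : ℝ) * N ^ (k * m) ≤ N ^ (k * (m + 1)) * (2 * ((m + 1) * (ρ + ε)) + 1) ^ (m * (m + 1)) := by
    intro β
    have h := cntQ_any β z (ε * S) (S * (ρ + ε)) (by positivity) (fun l i => by
      have := hz l i; linarith)
    have h5 : (2 * ((m + 1) * (S * (ρ + ε))) + 1) ^ (m * (m + 1)) ≤ (2 * ((m + 1) * (ρ + ε)) + 1) ^ (m * (m + 1)) * (N:ℝ) ^ (j * m) := by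
      rw [← hSp, ← mul_pow]
      gcongr
      nlinarith
    have h6 : (cntQ β (nearC z (ε * S)) : ℝ) * N ^ (m * (m + 1)) ≤ N ^ (k * (m + 1)) * ((2 * ((m + 1) * (ρ + ε)) + 1) ^ (m * (m + 1)) * (N:ℝ) ^ (j * m)) :=
      h.trans (by gcongr)
    rw [hNp, ← mul_assoc, ← mul_assoc] at h6
    exact le_of_mul_le_mul_right h6 (by positivity)
  have hcb := card_badB (N := N) (k := k) (m := m) (R := R) (by omega)
  have hQ : (Nat.card {q : ((Fin (m+1) → Fin k → ZMod N) × (Fin m → Fin k → ZMod N)) × (nearC z (ε * S)) //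
      ∀ l i, ((q.2.1 l i : ℤ) : ZMod N) = q.1.1 i ⬝ᵥ q.1.2 l} : ℝ) ≤
      (4 ^ (m + 1) * (24 * m) ^ (m * (m + 1)) + 1) * ε ^ (m * (m + 1)) * N ^ (k * (m + 1)) := by
    rw [card_Q_eq _ (nearC_finite _ _)]
    push_cast
    refine le_of_mul_le_mul_right (a := (N:ℝ) ^ (k * m)) ?_ (by positivity)
    rw [Finset.sum_mul]
    have hsplit : ∀ β : Fin m → Fin k → ZMod N, (cntQ β (nearC z (ε * S)) : ℝ) * N ^ (k * m) ≤
        4 ^ (m + 1) * (24 * m) ^ (m * (m + 1)) * ε ^ (m * (m + 1)) * N ^ (k * (m + 1)) +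
        (if BadB R β then (1:ℝ) else 0) * (N ^ (k * (m + 1)) * (2 * ((m + 1) * (ρ + ε)) + 1) ^ (m * (m + 1))) := by
      intro β
      by_cases hb : BadB R β
      · rw [if_pos hb, one_mul]
        have : (0:ℝ) ≤ 4 ^ (m + 1) * (24 * m) ^ (m * (m + 1)) * ε ^ (m * (m + 1)) * N ^ (k * (m + 1)) := by positivity
        linarith [hbad β]
      · rw [if_neg hb, zero_mul, add_zero]; exact hgood β hb
    refine (Finset.sum_le_sum fun β _ => hsplit β).trans ?_
    rw [Finset.sum_add_distrib, Finset.sum_const, nsmul_eq_mul, ← Finset.sum_mul]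
    have hcardb : (∑ β : Fin m → Fin k → ZMod N, if BadB R β then (1:ℝ) else 0) = Nat.card {β : Fin m → Fin k → ZMod N // BadB R β} := by
      rw [Finset.sum_boole, Nat.card_eq_fintype_card, Fintype.card_subtype]
    rw [hcardb]
    have hc : ((Finset.univ : Finset (Fin m → Fin k → ZMod N)).card : ℝ) = N ^ (k * m) := by
      simp [Finset.card_univ, ZMod.card, pow_mul]
    rw [hc]
    have h7 : (Nat.card {β : Fin m → Fin k → ZMod N // BadB R β} : ℝ) * (2 * ((m + 1) * (ρ + ε)) + 1) ^ (m * (m + 1)) ≤ ε ^ (m * (m + 1)) * N ^ (k * m) := by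
      have h8 : (3 * (R:ℝ)) ^ m * ((4 * m * ε) ^ m * S ^ m) ≤ N ^ m := by
        rw [← mul_pow, ← mul_pow]
        gcongr
        linarith
      refine le_of_mul_le_mul_right (a := ((4 * m * ε) ^ m * S ^ m * N ^ k)) ?_ (by positivity)
      calc _ = (Nat.card {β : Fin m → Fin k → ZMod N // BadB R β} * (N:ℝ) ^ k) * ((2 * ((m + 1) * (ρ + ε)) + 1) ^ (m * (m + 1)) * ((4 * m * ε) ^ m * S ^ m)) := by ring
        _ ≤ (N.divisors.card * (3 * R) ^ m * (N:ℝ) ^ (m * k)) * ((2 * ((m + 1) * (ρ + ε)) + 1) ^ (m * (m + 1)) * ((4 * m * ε) ^ m * S ^ m)) := by gcongr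
        _ = ((3 * (R:ℝ)) ^ m * ((4 * m * ε) ^ m * S ^ m)) * (N.divisors.card * (N:ℝ) ^ (m * k) * (2 * ((m + 1) * (ρ + ε)) + 1) ^ (m * (m + 1))) := by ring
        _ ≤ (N:ℝ) ^ m * (N.divisors.card * (N:ℝ) ^ (m * k) * (2 * ((m + 1) * (ρ + ε)) + 1) ^ (m * (m + 1))) := by gcongr
        _ = ((2 * ((m + 1) * (ρ + ε)) + 1) ^ (m * (m + 1)) * N.divisors.card * (N:ℝ) ^ m) * (N:ℝ) ^ (m * k) := by ring
        _ ≤ (ε ^ (m * (m + 1)) * (4 * m * ε) ^ m * S ^ m * N ^ k) * (N:ℝ) ^ (m * k) := by gcongr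
        _ = _ := by rw [mul_comm m k]; ring
    have h9 := mul_le_mul_of_nonneg_right h7 (by positivity : (0:ℝ) ≤ N ^ (k * (m + 1)))
    nlinarith [h9]
  have hp := param_count (N := N) (n := m + 1) (j := j) (k := k) (m := m) hj hjk (nearC z (ε * S)) (nearC_finite _ _)
  have hfin := hp.trans (mul_le_mul_of_nonneg_left hQ (Nat.cast_nonneg _))
  refine le_of_mul_le_mul_left (a := (N:ℝ) ^ (k * (m + 1)) / 12) ?_ (by positivity)
  refine hfin.trans (le_of_eq ?_)
  ring

end

section
/-- scale -/
def scl (N n j : ℕ) : ℝ := (N:ℝ) ^ ((j:ℝ) / (n:ℝ))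

lemma scl_pow (N n j : ℕ) (hn : n ≠ 0) : scl N n j ^ n = (N:ℝ) ^ j := by
  unfold scl
  rw [← Real.rpow_natCast, ← Real.rpow_mul (Nat.cast_nonneg N), div_mul_cancel₀ _ (by exact_mod_cast hn), Real.rpow_natCast]

lemma scl_pos (N n j : ℕ) [NeZero N] : 0 < scl N n j := by
  have hN : (0:ℝ) < N := by exact_mod_cast Nat.pos_of_ne_zero (NeZero.ne N)
  unfold scl; positivity

open Filter Topology in
lemma ev_conditions {m j k : ℕ} (hm : 1 ≤ m) (hj : 1 ≤ j) (hk : 1 ≤ k) (hjk : j + k = m + 1)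
    (ε A B : ℝ) (hε : 0 < ε) (hB : 0 < B) :
    ∀ᶠ N : ℕ in atTop, 1 ≤ scl N (m + 1) j ∧ 1 ≤ 2 * (ε * scl N (m + 1) j) ∧ 12 * m * (ε * scl N (m + 1) j) ≤ N ∧
      A * N.divisors.card * (N:ℝ) ^ m ≤ B * scl N (m + 1) j ^ m * N ^ k := by
  have hN : Tendsto (fun N : ℕ => (N:ℝ)) atTop atTop := tendsto_natCast_atTop_atTop
  have hn0 : (0:ℝ) < ((m + 1 : ℕ) : ℝ) := by positivity
  have hj0 : (0:ℝ) < j := by exact_mod_cast hj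
  have hk0 : (0:ℝ) < k := by exact_mod_cast hk
  have hS : Tendsto (fun N : ℕ => scl N (m + 1) j) atTop atTop :=
    (tendsto_rpow_atTop (by positivity)).comp hN
  have hjk' : (j:ℝ) + k = ((m + 1 : ℕ) : ℝ) := by exact_mod_cast hjk
  have h3 : ∀ᶠ N : ℕ in atTop, 12 * m * ε ≤ (N:ℝ) ^ ((k:ℝ) / ((m + 1 : ℕ) : ℝ)) :=
    ((tendsto_rpow_atTop (by positivity)).comp hN).eventually_ge_atTop _
  obtain ⟨C, hC1, hC⟩ := card_divisors_pow_le (m + 2)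
  have hn2 : (0:ℝ) < ((m + 2 : ℕ) : ℝ) := by positivity
  set e1 : ℝ := 1 / ((m + 2 : ℕ) : ℝ)
  set e2 : ℝ := (k:ℝ) / ((m + 1 : ℕ) : ℝ)
  have he : 0 < e2 - e1 := by
    have : e1 < e2 := by
      simp only [e1, e2]
      rw [div_lt_div_iff₀ hn2 hn0]
      have : (1:ℝ) ≤ k := by exact_mod_cast hk
      push_cast
      nlinarith
    linarith
  have h4 : ∀ᶠ N : ℕ in atTop, |A| * (C:ℝ) ≤ B * (N:ℝ) ^ (e2 - e1) := by
    have := ((tendsto_rpow_atTop he).comp hN).const_mul_atTop hB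
    exact this.eventually_ge_atTop _
  filter_upwards [hS.eventually_ge_atTop 1, hS.eventually_ge_atTop (1 / (2 * ε)), h3, h4, eventually_ge_atTop 1] with N a1 a2 a3 a4 a5
  have hN0 : (0:ℝ) < N := by exact_mod_cast a5
  refine ⟨a1, ?_, ?_, ?_⟩
  · rw [div_le_iff₀ (by positivity)] at a2; linarith
  · have : (N:ℝ) = (N:ℝ) ^ ((k:ℝ) / ((m + 1 : ℕ) : ℝ)) * scl N (m + 1) j := by
      unfold scl
      rw [← Real.rpow_add hN0, ← add_div, add_comm, hjk', div_self hn0.ne', Real.rpow_one]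
    calc 12 * m * (ε * scl N (m + 1) j) = (12 * m * ε) * scl N (m + 1) j := by ring
      _ ≤ (N:ℝ) ^ ((k:ℝ) / ((m + 1 : ℕ) : ℝ)) * scl N (m + 1) j := by gcongr
      _ = N := this.symm
  · have hd : (N.divisors.card : ℝ) ≤ C * (N:ℝ) ^ e1 := by
      have h5 : (N.divisors.card : ℝ) ^ (m + 2) ≤ C * N := by exact_mod_cast hC N (by omega)
      have h6 : (C:ℝ) * N ≤ (C * (N:ℝ) ^ e1) ^ (m + 2) := by
        rw [mul_pow, ← Real.rpow_natCast ((N:ℝ) ^ e1), ← Real.rpow_mul hN0.le]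
        have : e1 * ((m + 2 : ℕ) : ℝ) = 1 := by simp only [e1]; field_simp
        rw [this, Real.rpow_one]
        gcongr
        exact le_self_pow₀ (by exact_mod_cast hC1) (by omega)
      exact (pow_le_pow_iff_left₀ (by positivity) (by positivity) (by omega)).mp (h5.trans h6)
    have hSm : scl N (m + 1) j ^ m * (N:ℝ) ^ k = (N:ℝ) ^ m * (N:ℝ) ^ e2 := by
      unfold scl
      rw [← Real.rpow_natCast, ← Real.rpow_natCast, ← Real.rpow_natCast, ← Real.rpow_mul hN0.le, ← Real.rpow_add hN0, ← Real.rpow_add hN0]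
      congr 1
      simp only [e2]
      field_simp
      push_cast at hjk' ⊢
      nlinarith
    calc A * N.divisors.card * (N:ℝ) ^ m ≤ |A| * (C * (N:ℝ) ^ e1) * (N:ℝ) ^ m := by
          gcongr; exact le_abs_self A
      _ = (|A| * C) * (N:ℝ) ^ e1 * (N:ℝ) ^ m := by ring
      _ ≤ (B * (N:ℝ) ^ (e2 - e1)) * (N:ℝ) ^ e1 * (N:ℝ) ^ m := by gcongr
      _ = B * ((N:ℝ) ^ m * (N:ℝ) ^ e2) := by
          have : (N:ℝ) ^ e2 = (N:ℝ) ^ (e2 - e1) * (N:ℝ) ^ e1 := by rw [← Real.rpow_add hN0]; congr 1; ring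
          rw [this]; ring
      _ = _ := by rw [← hSm]; ring

/-- pairs of a lattice and an independent tuple of its vectors -/
def tupIdx (N m j : ℕ) : Type := {p : latticeSet N (m + 1) j × (Fin m → Fin (m + 1) → ℤ) //
  LinearIndependent ℝ (fun l i => (p.2 l i : ℝ)) ∧ ∀ l, p.2 l ∈ p.1.1}

/-- rescaled tuple -/
def tupVal {N m j : ℕ} (p : tupIdx N m j) : Fin m → Fin (m + 1) → ℝ :=
  fun l i => (scl N (m + 1) j)⁻¹ * (p.1.2 l i : ℝ)

instance (N m j : ℕ) [NeZero N] : Countable (tupIdx N m j) := by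
  haveI : Finite (latticeSet N (m + 1) j) := latticeSet_finite N (m + 1) j
  unfold tupIdx
  infer_instance

open Filter Topology in
lemma count_ball {m j k : ℕ} (hm : 1 ≤ m) (hj : 1 ≤ j) (hk : 1 ≤ k) (hjk : j + k = m + 1) :
    ∃ C : ℝ, 0 < C ∧ ∀ ε ρ : ℝ, 0 < ε → 0 < ρ → ∀ᶠ N : ℕ in atTop,
      ∀ y : Fin m → Fin (m + 1) → ℝ, ‖y‖ ≤ ρ →
      ∑' p : tupIdx N m j, (Metric.closedBall y ε).indicator (fun _ => (1:ENNReal)) (tupVal p) ≤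
        ENNReal.ofReal (C * ε ^ (m * (m + 1)) * (latticeSet N (m + 1) j).ncard) := by
  refine ⟨12 * (4 ^ (m + 1) * (24 * m) ^ (m * (m + 1)) + 1), by positivity, fun ε ρ hε hρ => ?_⟩
  have hmR : (1:ℝ) ≤ m := by exact_mod_cast hm
  filter_upwards [ev_conditions hm hj hk hjk ε ((2 * ((m + 1) * (ρ + ε)) + 1) ^ (m * (m + 1))) (ε ^ (m * (m + 1)) * (4 * m * ε) ^ m) hε
    (by positivity), eventually_ge_atTop 1] with N hcond hN1 y hy
  haveI : NeZero N := ⟨by omega⟩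
  obtain ⟨c1, c2, c3, c4⟩ := hcond
  have hS0 : 0 < scl N (m + 1) j := scl_pos _ _ _
  have hb := count_bound hm hj hk hjk N (scl N (m + 1) j) ε ρ hε hρ (scl_pow _ _ _ (by omega)) c1 c2 c3 c4
    (fun l i => scl N (m + 1) j * y l i) (fun l i => by
      rw [abs_mul, abs_of_pos hS0]
      gcongr
      exact (norm_le_pi_norm (y l) i).trans ((norm_le_pi_norm y l).trans hy))
  refine le_trans ?_ (ENNReal.ofReal_le_ofReal hb)
  rw [ENNReal.ofReal_natCast]
  set P := {p : latticeSet N (m + 1) j × nearC (fun l i => scl N (m + 1) j * y l i) (ε * scl N (m + 1) j) // ∀ l, p.2.1 l ∈ p.1.1}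
  haveI : Finite (latticeSet N (m + 1) j) := latticeSet_finite N (m + 1) j
  haveI : Finite (nearC (fun l i => scl N (m + 1) j * y l i) (ε * scl N (m + 1) j)) := nearC_finite _ _
  haveI : Finite P := inferInstance
  have h1 : ∑' p : tupIdx N m j, (Metric.closedBall y ε).indicator (fun _ => (1:ENNReal)) (tupVal p) =
      ((tupVal ⁻¹' (Metric.closedBall y ε) : Set (tupIdx N m j)).encard : ENNReal) := by
    rw [← ENNReal.tsum_set_one, tsum_subtype (tupVal ⁻¹' (Metric.closedBall y ε) : Set (tupIdx N m j)) (fun _ => (1:ENNReal))]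
    rfl
  rw [h1]
  have hmem : ∀ p ∈ (tupVal ⁻¹' (Metric.closedBall y ε) : Set (tupIdx N m j)), p.1.2 ∈ nearC (fun l i => scl N (m + 1) j * y l i) (ε * scl N (m + 1) j) := by
    intro p hp
    refine ⟨p.2.1, fun l i => ?_⟩
    have h2 : ‖tupVal p l i - y l i‖ ≤ ε := by
      have h3 : ‖tupVal p - y‖ ≤ ε := by rw [← dist_eq_norm]; exact hp
      exact (norm_le_pi_norm ((tupVal p - y) l) i).trans ((norm_le_pi_norm (tupVal p - y) l).trans h3)
    unfold tupVal at h2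
    rw [Real.norm_eq_abs] at h2
    have : (p.1.2 l i : ℝ) - scl N (m + 1) j * y l i = ((scl N (m + 1) j)⁻¹ * (p.1.2 l i : ℝ) - y l i) * scl N (m + 1) j := by
      field_simp
    rw [this, abs_mul, abs_of_pos hS0]
    gcongr
  have h2 : (tupVal ⁻¹' (Metric.closedBall y ε) : Set (tupIdx N m j)).encard ≤ (Nat.card P : ℕ∞) := by
    let F : (tupVal ⁻¹' (Metric.closedBall y ε) : Set (tupIdx N m j)) → P := fun p =>
      ⟨(p.1.1.1, ⟨p.1.1.2, hmem p.1 p.2⟩), p.1.2.2⟩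
    have hF : Function.Injective F := by
      intro p q h
      have h1 : p.1.1.1 = q.1.1.1 := congrArg (fun s : P => s.1.1) h
      have h2 : p.1.1.2 = q.1.1.2 := congrArg (fun s : P => s.1.2.1) h
      exact Subtype.ext (Subtype.ext (Prod.ext h1 h2))
    haveI := Finite.of_injective F hF
    rw [← (Set.toFinite _).cast_ncard_eq]
    exact_mod_cast Nat.card_le_card_of_injective F hF
  exact_mod_cast h2


lemma volume_cball {m n : ℕ} (y : Fin m → Fin n → ℝ) (ε : ℝ) (hε : 0 < ε) :
    volume (Metric.closedBall y ε) = ENNReal.ofReal ((2 * ε) ^ (m * n)) := by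
  rw [closedBall_pi _ hε.le, volume_pi_pi]
  simp_rw [Real.volume_pi_closedBall _ hε.le]
  rw [Finset.prod_const, ← ENNReal.ofReal_pow (by positivity), ← pow_mul]
  simp [mul_comm]

open Filter Topology in
/-- Main counting estimate. -/
lemma main_count {m j k : ℕ} (hm : 1 ≤ m) (hj : 1 ≤ j) (hk : 1 ≤ k) (hjk : j + k = m + 1) :
    ∃ C : ℝ, 0 < C ∧ ∀ ψ : (Fin m → Fin (m + 1) → ℝ) → ℝ, Continuous ψ → HasCompactSupport ψ → (∀ x, 0 ≤ ψ x) →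
      ∀ δ : ℝ, 0 < δ → ∀ᶠ N : ℕ in atTop,
      ∑' p : tupIdx N m j, ENNReal.ofReal (ψ (tupVal p)) ≤
        ENNReal.ofReal ((C * ∫ x, ψ x) + δ) * (latticeSet N (m + 1) j).ncard := by
  obtain ⟨C, hC, hcount⟩ := count_ball hm hj hk hjk
  refine ⟨C, hC, fun ψ hψc hψs hψ0 δ hδ => ?_⟩
  obtain ⟨ρ0, hρ0⟩ := hψs.isCompact.isBounded.subset_closedBall 0
  set ρ : ℝ := |ρ0| + 1 with hρdef
  have hρ : 0 < ρ := by positivity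
  set V : ℝ := (2 * ρ) ^ (m * (m + 1)) with hV
  have hV0 : 0 < V := by positivity
  set η : ℝ := δ / (C * V) with hη
  have hη0 : 0 < η := by positivity
  obtain ⟨ε0, hε0, huc⟩ := Metric.uniformContinuous_iff.mp (hψs.uniformContinuous_of_continuous hψc) η hη0
  set ε : ℝ := min (ε0 / 2) 1 with hεdef
  have hε : 0 < ε := by positivity
  have hε1 : ε ≤ 1 := min_le_right _ _
  have hεε : ε < ε0 := lt_of_le_of_lt (min_le_left _ _) (by linarith)
  let Ψ : (Fin m → Fin (m + 1) → ℝ) → ENNReal := fun y => ENNReal.ofReal (ψ y) +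
    (Metric.closedBall 0 ρ).indicator (fun _ => ENNReal.ofReal η) y
  have hΨm : Measurable Ψ := by
    refine (hψc.measurable.ennreal_ofReal).add ?_
    exact measurable_const.indicator Metric.isClosed_closedBall.measurableSet
  have hzero : ∀ y, ψ y ≠ 0 → ‖y‖ ≤ |ρ0| := by
    intro y hy
    have := hρ0 (subset_tsupport _ hy)
    simp at this
    exact this.trans (le_abs_self _)
  have hΨ0 : ∀ y, ¬ ‖y‖ ≤ ρ → Ψ y = 0 := by
    intro y hy
    have h1 : ψ y = 0 := by
      by_contra h
      exact hy ((hzero y h).trans (by linarith))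
    simp only [Ψ, h1]
    rw [Set.indicator_of_notMem (by simpa using hy)]
    simp
  have hptw : ∀ x y, y ∈ Metric.closedBall x ε → ENNReal.ofReal (ψ x) ≤ Ψ y := by
    intro x y hxy
    by_cases hx : ψ x = 0
    · rw [hx]; simp
    have hxn := hzero x hx
    have hyn : ‖y‖ ≤ ρ := by
      have h1 : ‖y - x‖ ≤ ε := by rw [← dist_eq_norm]; exact hxy
      have h2 : y = (y - x) + x := by abel
      rw [h2]
      refine (norm_add_le _ _).trans ?_
      linarith
    simp only [Ψ]
    rw [Set.indicator_of_mem (by simpa using hyn), ← ENNReal.ofReal_add (hψ0 y) hη0.le]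
    apply ENNReal.ofReal_le_ofReal
    have h3 := huc (a := x) (b := y) (lt_of_le_of_lt (by rw [dist_comm]; exact hxy) hεε)
    rw [Real.dist_eq] at h3
    linarith [le_abs_self (ψ x - ψ y)]
  have hIntg : ∫⁻ y, Ψ y = ENNReal.ofReal ((∫ x, ψ x) + η * V) := by
    simp only [Ψ]
    rw [lintegral_add_left hψc.measurable.ennreal_ofReal, lintegral_indicator Metric.isClosed_closedBall.measurableSet,
      lintegral_const, Measure.restrict_apply MeasurableSet.univ, Set.univ_inter, volume_cball _ _ hρ,
      ← ENNReal.ofReal_mul hη0.le, ← ofReal_integral_eq_lintegral_ofReal (hψc.integrable_of_hasCompactSupport hψs)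
      (Eventually.of_forall hψ0), ← ENNReal.ofReal_add (integral_nonneg hψ0) (by positivity)]
  filter_upwards [hcount ε ρ hε hρ, eventually_ge_atTop 1] with N hN hN1
  haveI : NeZero N := ⟨by omega⟩
  set v : ENNReal := ENNReal.ofReal ((2 * ε) ^ (m * (m + 1))) with hv
  have hv0 : v ≠ 0 := by rw [hv]; simp; positivity
  have hvt : v ≠ ⊤ := ENNReal.ofReal_ne_top
  have key : v * ∑' p : tupIdx N m j, ENNReal.ofReal (ψ (tupVal p)) ≤
      v * (ENNReal.ofReal ((C * ∫ x, ψ x) + δ) * (latticeSet N (m + 1) j).ncard) := by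
    calc v * ∑' p : tupIdx N m j, ENNReal.ofReal (ψ (tupVal p))
        = ∑' p : tupIdx N m j, ∫⁻ y, (Metric.closedBall (tupVal p) ε).indicator (fun _ => ENNReal.ofReal (ψ (tupVal p))) y := by
          rw [← ENNReal.tsum_mul_left]
          refine tsum_congr fun p => ?_
          rw [lintegral_indicator Metric.isClosed_closedBall.measurableSet, lintegral_const,
            Measure.restrict_apply MeasurableSet.univ, Set.univ_inter, volume_cball _ _ hε, mul_comm]
      _ ≤ ∑' p : tupIdx N m j, ∫⁻ y, Ψ y * (Metric.closedBall y ε).indicator (fun _ => 1) (tupVal p) := by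
          refine ENNReal.tsum_le_tsum fun p => lintegral_mono fun y => ?_
          by_cases hy : y ∈ Metric.closedBall (tupVal p) ε
          · have hy' : tupVal p ∈ Metric.closedBall y ε := by rw [Metric.mem_closedBall, dist_comm]; exact hy
            rw [Set.indicator_of_mem hy, Set.indicator_of_mem hy', mul_one]
            exact hptw _ _ hy
          · rw [Set.indicator_of_notMem hy]; exact zero_le'
      _ = ∫⁻ y, ∑' p : tupIdx N m j, Ψ y * (Metric.closedBall y ε).indicator (fun _ => 1) (tupVal p) := by
          rw [lintegral_tsum]
          intro p
          refine (hΨm.mul ?_).aemeasurable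
          have : (fun y => (Metric.closedBall y ε).indicator (fun _ => (1:ENNReal)) (tupVal p)) =
              (Metric.closedBall (tupVal p) ε).indicator (fun _ => (1:ENNReal)) := by
            funext y
            classical
            rw [Set.indicator_apply, Set.indicator_apply, Metric.mem_closedBall, Metric.mem_closedBall, dist_comm]
          rw [this]
          exact measurable_const.indicator Metric.isClosed_closedBall.measurableSet
      _ ≤ ∫⁻ y, Ψ y * ENNReal.ofReal (C * ε ^ (m * (m + 1)) * (latticeSet N (m + 1) j).ncard) := by
          refine lintegral_mono fun y => ?_
          rw [ENNReal.tsum_mul_left]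
          by_cases hy : ‖y‖ ≤ ρ
          · exact mul_le_mul_right (hN y hy) _
          · rw [hΨ0 y hy]; simp
      _ = ENNReal.ofReal (((∫ x, ψ x) + η * V) * (C * ε ^ (m * (m + 1)) * (latticeSet N (m + 1) j).ncard)) := by
          rw [lintegral_mul_const _ hΨm, hIntg, ← ENNReal.ofReal_mul]
          have : 0 ≤ ∫ x, ψ x := integral_nonneg hψ0
          positivity
      _ ≤ _ := by
          have h0 : 0 ≤ ∫ x, ψ x := integral_nonneg hψ0
          rw [← ENNReal.ofReal_natCast, ← ENNReal.ofReal_mul (by positivity), hv, ← ENNReal.ofReal_mul (by positivity)]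
          apply ENNReal.ofReal_le_ofReal
          have h1 : ε ^ (m * (m + 1)) ≤ (2 * ε) ^ (m * (m + 1)) := by gcongr; linarith
          have h2 : ((∫ x, ψ x) + η * V) * C = C * (∫ x, ψ x) + δ := by
            rw [hη]; field_simp
          calc ((∫ x, ψ x) + η * V) * (C * ε ^ (m * (m + 1)) * (latticeSet N (m + 1) j).ncard)
              = ε ^ (m * (m + 1)) * ((((∫ x, ψ x) + η * V) * C) * (latticeSet N (m + 1) j).ncard) := by ring
            _ ≤ (2 * ε) ^ (m * (m + 1)) * ((((∫ x, ψ x) + η * V) * C) * (latticeSet N (m + 1) j).ncard) := by gcongr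
            _ = _ := by rw [h2]
  exact (ENNReal.mul_le_mul_iff_right hv0 hvt).mp key

end

section
/-! ### Topology on `SL_n(ℝ)` and on `X`. -/

/-- Abbreviation for `SL_n(ℝ)`. -/
abbrev GG (n : ℕ) := Matrix.SpecialLinearGroup (Fin n) ℝ

theorem GG_isClosedEmbedding (n : ℕ) :
    Topology.IsClosedEmbedding (fun g : GG n => (g : Matrix (Fin n) (Fin n) ℝ)) where
  eq_induced := rfl
  injective := fun _ _ h => Subtype.ext h
  isClosed_range := by
    have : Set.range (fun g : GG n => (g : Matrix (Fin n) (Fin n) ℝ)) =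
        Matrix.det ⁻¹' {1} := by
      ext A
      constructor
      · rintro ⟨g, rfl⟩
        exact g.2
      · intro h
        exact ⟨⟨A, h⟩, rfl⟩
    rw [this]
    exact isClosed_singleton.preimage continuous_id.matrix_det

theorem GG_continuous_val (n : ℕ) :
    Continuous (fun g : GG n => (g : Matrix (Fin n) (Fin n) ℝ)) :=
  (GG_isClosedEmbedding n).continuous

theorem GG_continuous_iff {n : ℕ} {α : Type*} [TopologicalSpace α] {f : α → GG n} :
    Continuous f ↔ Continuous (fun a => (f a : Matrix (Fin n) (Fin n) ℝ)) :=
  (GG_isClosedEmbedding n).isEmbedding.continuous_iff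

instance GG_topologicalGroup (n : ℕ) : IsTopologicalGroup (GG n) where
  continuous_inv := by
    rw [GG_continuous_iff]
    simpa [Matrix.SpecialLinearGroup.coe_inv] using (GG_continuous_val n).matrix_adjugate
  continuous_mul := by
    rw [GG_continuous_iff]
    exact
      ((GG_continuous_val n).comp continuous_fst).mul ((GG_continuous_val n).comp continuous_snd)

instance GG_t2 (n : ℕ) : T2Space (GG n) := (GG_isClosedEmbedding n).isEmbedding.t2Space

instance Mat_locallyCompact (n : ℕ) : LocallyCompactSpace (Matrix (Fin n) (Fin n) ℝ) :=
  inferInstanceAs (LocallyCompactSpace (Fin n → Fin n → ℝ))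

instance Mat_secondCountable (n : ℕ) : SecondCountableTopology (Matrix (Fin n) (Fin n) ℝ) :=
  inferInstanceAs (SecondCountableTopology (Fin n → Fin n → ℝ))

instance GG_locallyCompact (n : ℕ) : LocallyCompactSpace (GG n) :=
  (GG_isClosedEmbedding n).locallyCompactSpace

instance GG_secondCountable (n : ℕ) : SecondCountableTopology (GG n) :=
  (GG_isClosedEmbedding n).isEmbedding.secondCountableTopology

instance GG_measurableSpace (n : ℕ) : MeasurableSpace (GG n) := borel _

instance GG_borelSpace (n : ℕ) : BorelSpace (GG n) := ⟨rfl⟩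

/-- The projection `G → X`. -/
def toX (n : ℕ) (g : GG n) : XSpace n := Quotient.mk'' g

theorem toX_surjective (n : ℕ) : Function.Surjective (toX n) := Quotient.mk''_surjective

theorem toX_continuous (n : ℕ) : Continuous (toX n) := continuous_quot_mk

theorem toX_isQuotientMap (n : ℕ) : Topology.IsQuotientMap (toX n) := isQuotientMap_quot_mk

theorem toX_eq_iff {n : ℕ} {g g' : GG n} : toX n g = toX n g' ↔ ∃ γ ∈ Gamma n, γ * g = g' := by
  have h0 : toX n g = toX n g' ↔ g' * g⁻¹ ∈ Gamma n :=
    (Quotient.eq'' (s₁ := QuotientGroup.rightRel (Gamma n))).trans QuotientGroup.rightRel_apply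
  rw [h0]
  constructor
  · intro h
    exact ⟨_, h, by simp⟩
  · rintro ⟨γ, hγ, rfl⟩
    simpa using hγ

theorem toX_gamma_mul {n : ℕ} {γ : GG n} (hγ : γ ∈ Gamma n) (g : GG n) :
    toX n (γ * g) = toX n g := (toX_eq_iff.2 ⟨γ, hγ, rfl⟩).symm

@[simp] theorem rightTranslate_toX (n : ℕ) (g x : GG n) :
    rightTranslate n g (toX n x) = toX n (x * g) := rfl

theorem toX_isOpenMap (n : ℕ) : IsOpenMap (toX n) := by
  intro U hU
  rw [← (toX_isQuotientMap n).isOpen_preimage]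
  have : toX n ⁻¹' (toX n '' U) = ⋃ γ ∈ Gamma n, (fun g => γ * g) ⁻¹' U := by
    ext g
    simp only [Set.mem_preimage, Set.mem_image, Set.mem_iUnion, exists_prop]
    constructor
    · rintro ⟨u, hu, h⟩
      obtain ⟨γ, hγ, rfl⟩ := toX_eq_iff.1 h.symm
      exact ⟨γ, hγ, hu⟩
    · rintro ⟨γ, hγ, h⟩
      exact ⟨_, h, toX_gamma_mul hγ g⟩
  rw [this]
  exact isOpen_biUnion fun γ _ => hU.preimage (continuous_const_mul γ)

instance XSpace_secondCountable (n : ℕ) : SecondCountableTopology (XSpace n) :=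
  (toX_isQuotientMap n).secondCountableTopology (toX_isOpenMap n)

theorem rightTranslate_continuous (n : ℕ) (g : GG n) : Continuous (rightTranslate n g) := by
  rw [(toX_isQuotientMap n).continuous_iff]
  exact (toX_continuous n).comp (continuous_mul_const g)

theorem rightTranslate_continuous2 (n : ℕ) :
    Continuous (fun p : GG n × XSpace n => rightTranslate n p.1 p.2) := by
  have h : IsOpenQuotientMap (Prod.map (id : GG n → GG n) (toX n)) :=
    IsOpenQuotientMap.id.prodMap ⟨toX_surjective n, toX_continuous n, toX_isOpenMap n⟩
  rw [h.isQuotientMap.continuous_iff]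
  exact (toX_continuous n).comp (continuous_snd.mul continuous_fst)

theorem rightTranslate_mul (n : ℕ) (g g' : GG n) (x : XSpace n) :
    rightTranslate n g' (rightTranslate n g x) = rightTranslate n (g * g') x := by
  obtain ⟨y, rfl⟩ := toX_surjective n x
  simp [mul_assoc]

@[simp] theorem rightTranslate_one (n : ℕ) (x : XSpace n) : rightTranslate n 1 x = x := by
  obtain ⟨y, rfl⟩ := toX_surjective n x
  simp

theorem Gamma_mem_iff {n : ℕ} {g : GG n} :
    g ∈ Gamma n ↔ ∃ A : Matrix.SpecialLinearGroup (Fin n) ℤ,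
      ∀ i l, (g : Matrix (Fin n) (Fin n) ℝ) i l = ((A : Matrix (Fin n) (Fin n) ℤ) i l : ℝ) := by
  unfold Gamma
  rw [MonoidHom.mem_range]
  constructor
  · rintro ⟨A, rfl⟩
    exact ⟨A, fun i l => by simp⟩
  · rintro ⟨A, h⟩
    refine ⟨A, ?_⟩
    ext i l
    simp [h]

instance Gamma_countable (n : ℕ) : Countable (Gamma n) := by
  have : Countable (Matrix.SpecialLinearGroup (Fin n) ℤ) := by
    have : Countable (Matrix (Fin n) (Fin n) ℤ) :=
      inferInstanceAs (Countable (Fin n → Fin n → ℤ))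
    exact Subtype.countable
  unfold Gamma
  exact (MonoidHom.rangeRestrict_surjective
    (Matrix.SpecialLinearGroup.map (n := Fin n) (Int.castRingHom ℝ))).countable

theorem Gamma_inter_compact_finite {n : ℕ} {K : Set (GG n)} (hK : IsCompact K) :
    ((Gamma n : Set (GG n)) ∩ K).Finite := by
  obtain ⟨B, hB⟩ : ∃ B : ℕ, ∀ g ∈ K, ∀ i l, |(g : Matrix (Fin n) (Fin n) ℝ) i l| ≤ B := by
    have h1 : ∀ i l, ∃ B : ℕ, ∀ g ∈ K, |(g : Matrix (Fin n) (Fin n) ℝ) i l| ≤ B := by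
      intro i l
      have hc : ContinuousOn (fun g : GG n => (g : Matrix (Fin n) (Fin n) ℝ) i l) K :=
        ((GG_continuous_val n).matrix_elem i l).continuousOn
      obtain ⟨C, hC⟩ := hK.exists_bound_of_continuousOn hc
      obtain ⟨B, hB⟩ := exists_nat_ge C
      exact ⟨B, fun g hg => (hC g hg).trans hB⟩
    choose B hB using h1
    refine ⟨∑ i, ∑ l, B i l, fun g hg i l => (hB i l g hg).trans ?_⟩
    have h2 : B i l ≤ ∑ i, ∑ l, B i l :=
      (Finset.single_le_sum (f := fun l => B i l) (fun _ _ => Nat.zero_le _)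
        (Finset.mem_univ l)).trans
      (Finset.single_le_sum (f := fun i => ∑ l, B i l) (fun _ _ => Nat.zero_le _)
        (Finset.mem_univ i))
    exact_mod_cast h2
  have hfin : (Set.Icc (fun _ _ => -(B:ℤ)) (fun _ _ => (B:ℤ)) : Set (Fin n → Fin n → ℤ)).Finite :=
    Set.finite_Icc _ _
  have hfin2 := hfin.image (fun A : Fin n → Fin n → ℤ =>
    (Matrix.of fun i l => ((A i l : ℤ) : ℝ) : Matrix (Fin n) (Fin n) ℝ))
  refine Set.Finite.of_finite_image (f := fun g : GG n => (g : Matrix (Fin n) (Fin n) ℝ))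
    (hfin2.subset ?_) (GG_isClosedEmbedding n).injective.injOn
  rintro _ ⟨g, ⟨hg, hgK⟩, rfl⟩
  obtain ⟨A, hA⟩ := Gamma_mem_iff.1 hg
  refine ⟨A.1, ?_, ?_⟩
  · constructor
    · intro i l
      have := hB g hgK i l
      rw [hA, abs_le] at this
      exact_mod_cast this.1
    · intro i l
      have := hB g hgK i l
      rw [hA, abs_le] at this
      exact_mod_cast this.2
  · ext i l
    simp [hA]

theorem Gamma_transl_finite {n : ℕ} {K K' : Set (GG n)} (hK : IsCompact K) (hK' : IsCompact K') :
    {γ : Gamma n | ∃ g ∈ K', (γ : GG n) * g ∈ K}.Finite := by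
  have h := Gamma_inter_compact_finite (hK.mul hK'.inv)
  refine Set.Finite.of_finite_image (f := Subtype.val) (h.subset ?_) Subtype.val_injective.injOn
  rintro _ ⟨γ, ⟨g, hg, hgK⟩, rfl⟩
  exact ⟨γ.2, Set.mem_mul.2 ⟨_, hgK, g⁻¹, by simpa using hg, by simp⟩⟩

end

section
/-! ### Test functions on `X` and the unfolding operator. -/

open Topology Filter in
/-- Test functions on `X`. -/
structure TF {n : ℕ} {E : Type*} [TopologicalSpace E] [Zero E] (f : XSpace n → E) : Prop where
  cont : Continuous f
  supp : ∃ K : Set (GG n), IsCompact K ∧ ∀ x, x ∉ toX n '' K → f x = 0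

theorem TF.bounded {n : ℕ} {E : Type*} [SeminormedAddCommGroup E] {f : XSpace n → E} (hf : TF f) :
    ∃ B : ℝ, 0 ≤ B ∧ ∀ x, ‖f x‖ ≤ B := by
  obtain ⟨K, hK, hs⟩ := hf.supp
  obtain ⟨B, hB⟩ := (hK.image (toX_continuous n)).exists_bound_of_continuousOn hf.cont.continuousOn
  refine ⟨max B 0, le_max_right _ _, fun x => ?_⟩
  by_cases hx : x ∈ toX n '' K
  · exact (hB x hx).trans (le_max_left _ _)
  · rw [hs x hx]
    simp

theorem TF.comp {n : ℕ} {E F : Type*} [TopologicalSpace E] [Zero E] [TopologicalSpace F] [Zero F]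
    {f : XSpace n → E} (hf : TF f) {u : E → F} (hu : Continuous u) (h0 : u 0 = 0) :
    TF (fun x => u (f x)) where
  cont := hu.comp hf.cont
  supp := by
    obtain ⟨K, hK, hs⟩ := hf.supp
    exact ⟨K, hK, fun x hx => by rw [hs x hx, h0]⟩

theorem TF.translate {n : ℕ} {E : Type*} [TopologicalSpace E] [Zero E]
    {f : XSpace n → E} (hf : TF f) (g : GG n) :
    TF (fun x => f (rightTranslate n g x)) where
  cont := hf.cont.comp (rightTranslate_continuous n g)
  supp := by
    obtain ⟨K, hK, hs⟩ := hf.supp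
    refine ⟨(fun k => k * g⁻¹) '' K, hK.image (continuous_mul_const _), fun x hx => hs _ ?_⟩
    rintro ⟨k, hk, h⟩
    apply hx
    refine ⟨k * g⁻¹, ⟨k, hk, rfl⟩, ?_⟩
    rw [← rightTranslate_toX, h, rightTranslate_mul]
    simp

theorem TF.add {n : ℕ} {E : Type*} [TopologicalSpace E] [AddZeroClass E] [ContinuousAdd E]
    {f f' : XSpace n → E} (hf : TF f) (hf' : TF f') : TF (fun x => f x + f' x) where
  cont := hf.cont.add hf'.cont
  supp := by
    obtain ⟨K, hK, hs⟩ := hf.supp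
    obtain ⟨K', hK', hs'⟩ := hf'.supp
    refine ⟨K ∪ K', hK.union hK', fun x hx => ?_⟩
    rw [Set.image_union, Set.mem_union, not_or] at hx
    rw [hs x hx.1, hs' x hx.2, add_zero]

open Topology Filter Pointwise in
theorem TF.ruc {n : ℕ} {E : Type*} [SeminormedAddCommGroup E] {f : XSpace n → E} (hf : TF f)
    {ε : ℝ} (hε : 0 < ε) :
    ∀ᶠ g in 𝓝 (1 : GG n), ∀ x, ‖f (rightTranslate n g x) - f x‖ < ε := by
  obtain ⟨K, hK, hs⟩ := hf.supp
  obtain ⟨V, hV, hV1⟩ := exists_compact_mem_nhds (1 : GG n)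
  have hK1 : IsCompact (K ∪ K * V⁻¹) := hK.union (hK.mul hV.inv)
  have h1 : ∀ᶠ g in 𝓝 (1 : GG n), ∀ y ∈ K ∪ K * V⁻¹,
      ‖f (toX n (y * g)) - f (toX n y)‖ < ε := by
    refine hK1.eventually_forall_of_forall_eventually ?_
    intro y _
    have hc : Continuous (fun z : GG n × GG n =>
        ‖f (toX n (z.2 * z.1)) - f (toX n z.2)‖) :=
      ((hf.cont.comp ((toX_continuous n).comp (continuous_snd.mul continuous_fst))).sub
        (hf.cont.comp ((toX_continuous n).comp continuous_snd))).norm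
    refine hc.continuousAt.eventually_lt continuousAt_const ?_
    simpa using hε
  filter_upwards [h1, hV1] with g hg hgV x
  obtain ⟨y, rfl⟩ := toX_surjective n x
  by_cases hy : toX n y ∈ toX n '' K
  · obtain ⟨k, hk, hky⟩ := hy
    rw [← hky]
    exact hg k (Or.inl hk)
  by_cases hy2 : rightTranslate n g (toX n y) ∈ toX n '' K
  · obtain ⟨k, hk, hky⟩ := hy2
    have : toX n y = toX n (k * g⁻¹) := by
      rw [← rightTranslate_toX, hky, rightTranslate_mul]
      simp
    rw [this]
    exact hg _ (Or.inr (Set.mul_mem_mul hk (by simpa using hgV)))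
  · rw [hs _ hy, hs _ hy2]
    simpa using hε

/-- The unfolding operator. -/
def PP {n : ℕ} {E : Type*} [AddCommMonoid E] (φ : GG n → E) (x : XSpace n) : E :=
  ∑ᶠ γ : Gamma n, φ (γ * (toX_surjective n x).choose)

theorem PP_toX {n : ℕ} {E : Type*} [AddCommMonoid E] (φ : GG n → E) (g : GG n) :
    PP φ (toX n g) = ∑ᶠ γ : Gamma n, φ (γ * g) := by
  have key : ∀ g' : GG n, toX n g' = toX n g →
      ∑ᶠ γ : Gamma n, φ (γ * g') = ∑ᶠ γ : Gamma n, φ (γ * g) := by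
    intro g' hg'
    obtain ⟨δ, hδ, h⟩ := toX_eq_iff.1 hg'
    subst h
    refine finsum_eq_of_bijective (fun γ : Gamma n => γ * (⟨δ, hδ⟩ : Gamma n)⁻¹)
      (Group.mulRight_bijective _) ?_
    intro γ
    congr 1
    simp only [Subgroup.coe_mul, InvMemClass.coe_inv]
    group
  exact key _ (toX_surjective n (toX n g)).choose_spec

theorem PP_fin {n : ℕ} {E : Type*} [Zero E] {φ : GG n → E}
    (hs : HasCompactSupport φ) (g : GG n) :
    {γ : Gamma n | φ (γ * g) ≠ 0}.Finite := by
  refine (Gamma_transl_finite hs.isCompact (isCompact_singleton (x := g))).subset ?_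
  intro γ hγ
  exact ⟨g, rfl, subset_tsupport _ hγ⟩

open Topology in
theorem PP_TF {n : ℕ} {E : Type*} [AddCommMonoid E] [TopologicalSpace E] [ContinuousAdd E]
    {φ : GG n → E} (hc : Continuous φ)
    (hs : HasCompactSupport φ) : TF (PP φ) where
  cont := by
    rw [(toX_isQuotientMap n).continuous_iff]
    have : PP φ ∘ toX n = fun g => ∑ᶠ γ : Gamma n, φ (γ * g) := by
      ext g
      exact PP_toX φ g
    rw [this]
    refine continuous_finsum (fun γ => hc.comp (continuous_const_mul _)) ?_
    intro g
    obtain ⟨V, hV, hVg⟩ := exists_compact_mem_nhds g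
    refine ⟨V, hVg, (Gamma_transl_finite hs.isCompact hV).subset ?_⟩
    rintro γ ⟨y, hy, hyV⟩
    exact ⟨y, hyV, subset_tsupport _ hy⟩
  supp := by
    refine ⟨tsupport φ, hs.isCompact, fun x hx => ?_⟩
    obtain ⟨g, rfl⟩ := toX_surjective n x
    rw [PP_toX]
    refine finsum_eq_zero_of_forall_eq_zero fun γ => ?_
    by_contra h
    exact hx ⟨_, subset_tsupport _ h, toX_gamma_mul γ.2 g⟩

theorem PP_translate {n : ℕ} {E : Type*} [AddCommMonoid E] (φ : GG n → E) (g : GG n)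
    (x : XSpace n) : PP φ (rightTranslate n g x) = PP (fun y => φ (y * g)) x := by
  obtain ⟨y, rfl⟩ := toX_surjective n x
  rw [rightTranslate_toX, PP_toX, PP_toX]
  simp [mul_assoc]

theorem PP_nonneg {n : ℕ} {φ : GG n → ℝ} (h0 : ∀ g, 0 ≤ φ g) (x : XSpace n) : 0 ≤ PP φ x := by
  unfold PP
  exact finsum_nonneg fun γ => h0 _

theorem PP_ofReal {n : ℕ} {φ : GG n → ℝ} (h0 : ∀ g, 0 ≤ φ g) (hs : HasCompactSupport φ)
    (g : GG n) :
    ENNReal.ofReal (PP φ (toX n g)) = ∑' γ : Gamma n, ENNReal.ofReal (φ (γ * g)) := by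
  have hf := PP_fin hs g
  rw [PP_toX, finsum_eq_sum_of_support_subset (s := hf.toFinset) _ (by
    intro γ hγ
    simpa using hγ), ENNReal.ofReal_sum_of_nonneg fun _ _ => h0 _]
  rw [tsum_eq_sum]
  intro γ hγ
  have : φ (γ * g) = 0 := by simpa using hγ
  simp [this]

theorem PP_add {n : ℕ} {φ φ' : GG n → ℝ} (hs : HasCompactSupport φ)
    (hs' : HasCompactSupport φ') (x : XSpace n) : PP (φ + φ') x = PP φ x + PP φ' x := by
  obtain ⟨g, rfl⟩ := toX_surjective n x
  rw [PP_toX, PP_toX, PP_toX, ← finsum_add_distrib (PP_fin hs g) (PP_fin hs' g)]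
  rfl

theorem PP_smul {n : ℕ} (c : ℝ) (φ : GG n → ℝ) (hs : HasCompactSupport φ) (x : XSpace n) :
    PP (c • φ) x = c * PP φ x := by
  obtain ⟨g, rfl⟩ := toX_surjective n x
  rw [PP_toX, PP_toX, ← smul_eq_mul, smul_finsum' _ (PP_fin hs g)]
  rfl

theorem PP_mul_pullback {n : ℕ} (φ : GG n → ℝ) (hs : HasCompactSupport φ) (f : XSpace n → ℝ)
    (x : XSpace n) : PP (fun g => f (toX n g) * φ g) x = f x * PP φ x := by
  obtain ⟨g, rfl⟩ := toX_surjective n x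
  rw [PP_toX, PP_toX, ← smul_eq_mul (f _), smul_finsum' _ (PP_fin hs g)]
  refine finsum_congr fun γ => ?_
  rw [toX_gamma_mul γ.2, smul_eq_mul]

theorem TF.exists_rep {n : ℕ} {f : XSpace n → ℝ} (hf : TF f) (h0 : ∀ x, 0 ≤ f x) :
    ∃ φ : GG n → ℝ, Continuous φ ∧ HasCompactSupport φ ∧ (∀ g, 0 ≤ φ g) ∧ PP φ = f := by
  obtain ⟨K, hK, hs⟩ := hf.supp
  obtain ⟨w, hw1, -, hwc, hw01⟩ := exists_continuous_one_zero_of_isCompact hK isClosed_empty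
    (Set.disjoint_empty K)
  have hPw := (PP_TF w.continuous hwc)
  have hw0 : ∀ g, 0 ≤ w g := fun g => (hw01 g).1
  have hcont : Continuous (fun x : XSpace n => f x / max (PP w x) 1) :=
    hf.cont.div (hPw.cont.max continuous_const) fun x => by positivity
  refine ⟨fun g => (f (toX n g) / max (PP w (toX n g)) 1) * w g, ?_, ?_, ?_, ?_⟩
  · exact (hcont.comp (toX_continuous n)).mul w.continuous
  · exact hwc.mul_left
  · intro g
    exact mul_nonneg (div_nonneg (h0 _) (by positivity)) (hw0 g)
  · ext x
    rw [PP_mul_pullback w hwc (fun x => f x / max (PP w x) 1)]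
    by_cases hx : x ∈ toX n '' K
    · obtain ⟨k, hk, rfl⟩ := hx
      have h1 : 1 ≤ PP w (toX n k) := by
        rw [PP_toX]
        have := single_le_finsum (f := fun γ : Gamma n => w (γ * k)) 1 (PP_fin hwc k)
          (fun γ => hw0 _)
        refine le_trans ?_ this
        simp [hw1 hk]
      rw [max_eq_left h1]
      field_simp
    · simp [hs x hx]

theorem TF.integrable {n : ℕ} {E : Type*} [NormedAddCommGroup E] [SecondCountableTopology E]
    {f : XSpace n → E} (hf : TF f)
    (μ : Measure (XSpace n)) [IsFiniteMeasure μ] : Integrable f μ := by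
  obtain ⟨B, hB, h⟩ := hf.bounded
  borelize E
  exact Integrable.of_bound hf.cont.aestronglyMeasurable B (Filter.Eventually.of_forall h)

theorem integral_translate {n : ℕ} {μ : Measure (XSpace n)}
    (hinv : ∀ g, Measure.map (rightTranslate n g) μ = μ) (g : GG n)
    {E : Type*} [NormedAddCommGroup E] [NormedSpace ℝ E] [SecondCountableTopology E]
    {f : XSpace n → E} (hf : Continuous f) :
    ∫ x, f (rightTranslate n g x) ∂μ = ∫ x, f x ∂μ := by
  borelize E
  conv_rhs => rw [← hinv g]
  rw [integral_map (rightTranslate_continuous n g).measurable.aemeasurable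
    hf.aestronglyMeasurable]

end

section
/-! ### Generation of `SL_n(ℝ)` by transvections; unimodularity. -/

section gen
variable {n : ℕ}

/-- Transvections. -/
abbrev tv {i l : Fin n} (h : i ≠ l) (a : ℝ) : GG n := Matrix.SpecialLinearGroup.transvection h a

theorem single_mul_zero {a b c d : Fin n} (h : b ≠ c) (x y : ℝ) :
    single a b x * single c d y = 0 := by
  simp [h]

theorem single_eq_smul (a b : Fin n) (x : ℝ) : single a b x = x • single a b (1 : ℝ) := by
  simp

theorem tv_diag {i l : Fin n} (h : i ≠ l) (c : ℝ) (hc : c ≠ 0) :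
    Matrix.SpecialLinearGroup.diag2n h c hc =
      tv h c * tv h.symm (-c⁻¹) * tv h c * (tv h (-1) * tv h.symm 1 * tv h (-1)) := by
  apply Subtype.ext
  have e1 : (Matrix.SpecialLinearGroup.diag2n h c hc).1 =
      1 + single i i (c - 1) + single l l (c⁻¹ - 1) := by
    rw [Matrix.SpecialLinearGroup.diag2n_coe]
    ext a b
    simp only [diagonal_apply, Matrix.add_apply, Matrix.one_apply, single_apply]
    by_cases hab : a = b
    · subst hab
      by_cases ha : a = i
      · subst ha
        simp [h.symm]
      · by_cases hl : a = l
        · subst hl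
          simp [h, ha]
        · simp [ha, hl, Ne.symm ha, Ne.symm hl]
    · have h1 : ¬ (i = a ∧ i = b) := by rintro ⟨rfl, rfl⟩; exact hab rfl
      have h2 : ¬ (l = a ∧ l = b) := by rintro ⟨rfl, rfl⟩; exact hab rfl
      simp [hab, h1, h2]
  rw [e1]
  simp only [Matrix.SpecialLinearGroup.coe_mul, Matrix.SpecialLinearGroup.transvection_coe]
  simp only [add_mul, mul_add, one_mul, mul_one, single_mul_single_same,
    single_mul_zero h, single_mul_zero h.symm, add_zero, zero_add, zero_mul, mul_zero]
  have a1 := single_eq_smul i i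
  have a2 := single_eq_smul i l
  have a3 := single_eq_smul l i
  have a4 := single_eq_smul l l
  generalize single i i (1 : ℝ) = E1 at *
  generalize single i l (1 : ℝ) = E2 at *
  generalize single l i (1 : ℝ) = E3 at *
  generalize single l l (1 : ℝ) = E4 at *
  simp only [a1, a2, a3, a4]
  match_scalars <;>
  (field_simp; try ring)

theorem GG_generation (hn : 2 ≤ n) (P : GG n → Prop)
    (ht : ∀ (i l : Fin n) (h : i ≠ l) (a : ℝ), P (tv h a))
    (hmul : ∀ A B, P A → P B → P (A * B)) (g : GG n) : P g := by
  have : Nontrivial (Fin n) := Fin.nontrivial_iff_two_le.2 hn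
  refine Matrix.SpecialLinearGroup.diagonal_transvection_induction' P g ?_ ht hmul
  intro i l h c hc
  rw [tv_diag h c hc]
  refine hmul _ _ (hmul _ _ (hmul _ _ ?_ ?_) ?_) (hmul _ _ (hmul _ _ ?_ ?_) ?_) <;> exact ht _ _ _ _

theorem tv_conj_weyl {i l : Fin n} (h : i ≠ l) (x : ℝ) :
    tv h x = (tv h 1 * tv h.symm (-1) * tv h 1) * tv h.symm (-x) *
      (tv h (-1) * tv h.symm 1 * tv h (-1)) := by
  apply Subtype.ext
  simp only [Matrix.SpecialLinearGroup.coe_mul, Matrix.SpecialLinearGroup.transvection_coe]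
  simp only [add_mul, mul_add, one_mul, mul_one, single_mul_single_same,
    single_mul_zero h, single_mul_zero h.symm, add_zero, zero_add, zero_mul, mul_zero]
  have a1 := single_eq_smul i i
  have a2 := single_eq_smul i l
  have a3 := single_eq_smul l i
  have a4 := single_eq_smul l l
  generalize single i i (1 : ℝ) = E1 at *
  generalize single i l (1 : ℝ) = E2 at *
  generalize single l i (1 : ℝ) = E3 at *
  generalize single l l (1 : ℝ) = E4 at *
  simp only [a1, a2, a3, a4]
  match_scalars <;>
  ring

theorem tv_commutator {i l k : Fin n} (hil : i ≠ l) (hlk : l ≠ k) (hik : i ≠ k) (x y : ℝ) :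
    tv hik (x * y) = tv hil x * tv hlk y * tv hil (-x) * tv hlk (-y) := by
  apply Subtype.ext
  simp only [Matrix.SpecialLinearGroup.coe_mul, Matrix.SpecialLinearGroup.transvection_coe]
  simp only [add_mul, mul_add, one_mul, mul_one, single_mul_single_same,
    single_mul_zero hil.symm, single_mul_zero hlk.symm,
    single_mul_zero hik.symm, add_zero, zero_add, zero_mul, mul_zero]
  have a2 := single_eq_smul i l
  have a3 := single_eq_smul i k
  have a4 := single_eq_smul l k
  generalize single i l (1 : ℝ) = E2 at *
  generalize single i k (1 : ℝ) = E3 at *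
  generalize single l k (1 : ℝ) = E4 at *
  simp only [a2, a3, a4]
  match_scalars <;> ring

theorem tv_conj_diag {i l : Fin n} (h : i ≠ l) (c : ℝ) (hc : c ≠ 0) (x : ℝ) :
    Matrix.SpecialLinearGroup.diag2n h c hc * tv h x =
      tv h (c ^ 2 * x) * Matrix.SpecialLinearGroup.diag2n h c hc := by
  apply Subtype.ext
  ext a b
  simp only [Matrix.SpecialLinearGroup.coe_mul, Matrix.SpecialLinearGroup.transvection_coe,
    Matrix.SpecialLinearGroup.diag2n_coe, Matrix.mul_add, Matrix.add_mul, Matrix.mul_one,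
    Matrix.one_mul, Matrix.add_apply, diagonal_mul, mul_diagonal, single_apply]
  by_cases h1 : i = a ∧ l = b
  · obtain ⟨rfl, rfl⟩ := h1
    simp [h.symm, Matrix.one_apply, h]
    field_simp
  · by_cases hab : a = b
    · subst hab
      simp [h1]
    · simp [h1, Matrix.one_apply, hab]

theorem tv_mem_Gamma {i l : Fin n} (h : i ≠ l) (z : ℤ) : tv h (z : ℝ) ∈ Gamma n := by
  refine Gamma_mem_iff.2 ⟨Matrix.SpecialLinearGroup.transvection h z, fun a b => ?_⟩
  simp only [Matrix.SpecialLinearGroup.transvection_coe, Matrix.add_apply, Matrix.one_apply,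
    single_apply]
  push_cast
  split_ifs <;> simp

open Measure in
theorem GG_modular (hn : 2 ≤ n) (g : GG n) : modularCharacterFun g = 1 := by
  refine GG_generation hn (fun g => modularCharacterFun g = 1) ?_ ?_ g
  · intro i l h a
    have h2 : (Real.sqrt 2) ≠ 0 := by positivity
    have e := congrArg modularCharacterFun (tv_conj_diag h (Real.sqrt 2) h2 a)
    rw [modularCharacterFun_map_mul, modularCharacterFun_map_mul, mul_comm] at e
    have e2 := mul_right_cancel₀ (modularCharacterFun_pos _).ne' e
    rw [Real.sq_sqrt (by norm_num), two_mul,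
      show tv h (a + a) = tv h a * tv h a from Matrix.SpecialLinearGroup.transvection_add h a a,
      modularCharacterFun_map_mul] at e2
    have h3 := (modularCharacterFun_pos (tv h a)).ne'
    exact (mul_left_cancel₀ h3 (by rw [mul_one]; exact e2)).symm
  · intro A B hA hB
    rw [modularCharacterFun_map_mul, hA, hB, one_mul]

open Measure in
theorem GG_haar_right (hn : 2 ≤ n) : IsMulRightInvariant (haar : Measure (GG n)) where
  map_mul_right_eq_self g := by
    rw [map_right_mul_eq_modularCharacterFun_smul, GG_modular hn, one_smul]

open Measure in
theorem GG_right_eq_smul_haar (hn : 2 ≤ n) (m : Measure (GG n)) [IsFiniteMeasureOnCompacts m]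
    [IsMulRightInvariant m] : ∃ c : NNReal, m = c • haar := by
  have := GG_haar_right hn
  have hfin : IsFiniteMeasureOnCompacts m.inv := by
    refine ⟨fun K hK => ?_⟩
    rw [Measure.inv_apply]
    exact hK.inv.measure_lt_top
  have hfin2 : IsFiniteMeasureOnCompacts (haar : Measure (GG n)).inv := by
    refine ⟨fun K hK => ?_⟩
    rw [Measure.inv_apply]
    exact hK.inv.measure_lt_top
  have h1 := isMulLeftInvariant_eq_smul m.inv (haar : Measure (GG n))
  have h2 := isMulLeftInvariant_eq_smul (haar : Measure (GG n)).inv (haar : Measure (GG n))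
  refine ⟨haarScalarFactor m.inv haar * haarScalarFactor (haar : Measure (GG n)).inv haar, ?_⟩
  rw [mul_smul, ← h2]
  have h3 : m = m.inv.inv := by
    unfold Measure.inv
    rw [Measure.map_map measurable_inv measurable_inv]
    simp
  conv_lhs => rw [h3, h1]
  unfold Measure.inv
  rw [Measure.map_smul]

end gen

end

section
/-! ### The unfolded measure is a multiple of Haar measure. -/

open CompactlySupported in
/-- The functional `φ ↦ ∫ PP φ dμ`. -/
def PPfun {n : ℕ} (μ : Measure (XSpace n)) [IsFiniteMeasure μ] : C_c(GG n, ℝ) →ₚ[ℝ] ℝ :=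
  PositiveLinearMap.mk₀
    { toFun := fun φ => ∫ x, PP φ x ∂μ
      map_add' := fun φ φ' => by
        refine Eq.trans ?_ (integral_add ((PP_TF φ.continuous φ.hasCompactSupport).integrable μ)
          ((PP_TF φ'.continuous φ'.hasCompactSupport).integrable μ))
        refine integral_congr_ae (Filter.Eventually.of_forall fun x => ?_)
        exact PP_add φ.hasCompactSupport φ'.hasCompactSupport x
      map_smul' := fun c φ => by
        rw [RingHom.id_apply, smul_eq_mul, ← integral_const_mul]
        refine integral_congr_ae (Filter.Eventually.of_forall fun x => ?_)
        exact PP_smul c φ φ.hasCompactSupport x }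
    (fun φ hφ => by
      have : 0 ≤ ∫ x, PP φ x ∂μ := integral_nonneg fun x => PP_nonneg (fun g => hφ g) x
      exact this)

open CompactlySupported Measure in
theorem PP_integral {n : ℕ} (hn : 2 ≤ n) (μ : Measure (XSpace n)) [IsProbabilityMeasure μ]
    (hinv : ∀ g, Measure.map (rightTranslate n g) μ = μ) :
    ∃ c : NNReal, c ≠ 0 ∧ ∀ φ : GG n → ℝ, Continuous φ → HasCompactSupport φ →
      ∫ x, PP φ x ∂μ = c * ∫ g, φ g ∂(haar : Measure (GG n)) := by
  set m := RealRMK.rieszMeasure (PPfun μ) with hm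
  have hIntg : ∀ φ : C_c(GG n, ℝ), ∫ g, φ g ∂m = ∫ x, PP φ x ∂μ := fun φ =>
    RealRMK.integral_rieszMeasure (PPfun μ) φ
  have hmr : IsMulRightInvariant m := by
    refine ⟨fun g => ?_⟩
    have hreg : (map (fun x => x * g) m).Regular := by
      exact Regular.map (μ := m) (Homeomorph.mulRight g)
    refine Measure.ext_of_integral_eq_on_compactlySupported fun φ => ?_
    refine (integral_map (measurable_mul_const g).aemeasurable
      φ.continuous.aestronglyMeasurable).trans ?_
    let φ' : C_c(GG n, ℝ) := ⟨⟨fun y => φ (y * g), φ.continuous.comp (continuous_mul_const g)⟩,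
      φ.hasCompactSupport.comp_homeomorph (Homeomorph.mulRight g)⟩
    have e1 := hIntg φ'
    have e2 := hIntg φ
    have e3 : ∫ x, PP φ' x ∂μ = ∫ x, PP φ x ∂μ := by
      refine Eq.trans ?_ (integral_translate hinv g
        (PP_TF φ.continuous φ.hasCompactSupport).cont)
      refine integral_congr_ae (Filter.Eventually.of_forall fun x => ?_)
      exact (PP_translate φ g x).symm
    exact e1.trans (e3.trans e2.symm)
  obtain ⟨c, hc⟩ := GG_right_eq_smul_haar hn m
  have hmain : ∀ φ : GG n → ℝ, Continuous φ → HasCompactSupport φ →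
      ∫ x, PP φ x ∂μ = c * ∫ g, φ g ∂(haar : Measure (GG n)) := by
    intro φ h1 h2
    have := hIntg ⟨⟨φ, h1⟩, h2⟩
    refine this.symm.trans ?_
    rw [hc]
    exact integral_smul_nnreal_measure _ _
  refine ⟨c, ?_, hmain⟩
  rintro rfl
  -- if `c = 0` then `μ = 0`
  have hz : ∀ K : Set (GG n), IsCompact K → μ (toX n '' K) = 0 := by
    intro K hK
    obtain ⟨w, hw1, -, hwc, hw01⟩ := exists_continuous_one_zero_of_isCompact hK isClosed_empty
      (Set.disjoint_empty K)
    have h0 := hmain w w.continuous hwc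
    rw [NNReal.coe_zero, zero_mul] at h0
    have hTF := PP_TF w.continuous hwc
    have h1 : PP w =ᵐ[μ] 0 := by
      refine (integral_eq_zero_iff_of_nonneg (fun x => PP_nonneg (fun g => (hw01 g).1) x)
        (hTF.integrable μ)).1 h0
    refine measure_mono_null ?_ h1
    rintro _ ⟨k, hk, rfl⟩ h
    have h' : PP w (toX n k) = 0 := h
    have := single_le_finsum (f := fun γ : Gamma n => w (γ * k)) 1 (PP_fin hwc k)
      (fun γ => (hw01 _).1)
    rw [← PP_toX, h'] at this
    simp [hw1 hk] at this
    linarith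
  have hU : (Set.univ : Set (XSpace n)) = ⋃ i, toX n '' compactCovering (GG n) i := by
    rw [← Set.image_iUnion, iUnion_compactCovering, Set.image_univ,
      (toX_surjective n).range_eq]
  have : μ Set.univ = 0 := by
    rw [hU]
    exact measure_iUnion_null fun i => hz _ (isCompact_compactCovering _ i)
  simp at this

/-- Left invariance of `φ ↦ ∫ PP φ dμ`. -/
theorem PP_integral_left {n : ℕ} (hn : 2 ≤ n) (μ : Measure (XSpace n)) [IsProbabilityMeasure μ]
    (hinv : ∀ g, Measure.map (rightTranslate n g) μ = μ)
    {φ : GG n → ℝ} (hc : Continuous φ) (hs : HasCompactSupport φ) (g : GG n) :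
    ∫ x, PP (fun y => φ (g * y)) x ∂μ = ∫ x, PP φ x ∂μ := by
  obtain ⟨c, -, h⟩ := PP_integral hn μ hinv
  rw [h (fun y => φ (g * y)) (hc.comp (continuous_const_mul g)) (hs.comp_homeomorph (Homeomorph.mulLeft g)),
    h φ hc hs, integral_mul_left_eq_self φ g]

end

section
/-! ### Coordinates on `SL_{m+1}(ℝ)` adapted to the subgroup `H`. -/

section coord
variable {m : ℕ}

/-- The matrix with first column `c` and remaining columns `C`. -/
def mkM {R : Type*} (c : Fin (m+1) → R) (C : Fin m → Fin (m+1) → R) :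
    Matrix (Fin (m+1)) (Fin (m+1)) R := fun i l => (Fin.cons c C : Fin (m+1) → Fin (m+1) → R) l i

@[simp] theorem mkM_zero {R : Type*} (c : Fin (m+1) → R) (C : Fin m → Fin (m+1) → R) (i) :
    mkM c C i 0 = c i := rfl

@[simp] theorem mkM_succ {R : Type*} (c : Fin (m+1) → R) (C : Fin m → Fin (m+1) → R) (i) (l : Fin m) :
    mkM c C i l.succ = C l i := rfl

theorem mkM_ext {R : Type*} {A B : Matrix (Fin (m+1)) (Fin (m+1)) R}
    (h0 : ∀ i, A i 0 = B i 0) (h1 : ∀ i (l : Fin m), A i l.succ = B i l.succ) : A = B := by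
  ext i l
  refine Fin.cases (h0 i) (h1 i) l

/-- Cofactors along the first column. -/
def cofC (C : Fin m → Fin (m+1) → ℝ) (i : Fin (m+1)) : ℝ := (mkM (Pi.single i 1) C).det

theorem det_mkM (c : Fin (m+1) → ℝ) (C : Fin m → Fin (m+1) → ℝ) :
    (mkM c C).det = ∑ i, c i * cofC C i := by
  have h : ∀ c : Fin (m+1) → ℝ, (mkM c C).det = Matrix.cramer (mkM 0 C) c 0 := by
    intro c
    rw [Matrix.cramer_apply]
    congr 1
    refine mkM_ext (fun i => ?_) (fun i l => ?_)
    · simp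
    · rw [Matrix.updateCol_ne (Fin.succ_ne_zero l)]
      rfl
  rw [h c]
  have hc : c = ∑ i, c i • (Pi.single i 1 : Fin (m+1) → ℝ) := by
    ext k
    simp [Finset.sum_apply, Pi.single_apply]
  conv_lhs => rw [hc, map_sum]
  simp only [map_smul, Finset.sum_apply, Pi.smul_apply, smul_eq_mul]
  refine Finset.sum_congr rfl fun i _ => ?_
  rw [← h]
  rfl

theorem det_mkM_unit (c : Fin (m+1) → ℝ) :
    (mkM c (fun l => Pi.single l.succ 1)).det = c 0 := by
  rw [Matrix.det_succ_row_zero, Fin.sum_univ_succ]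
  have h1 : ∀ l : Fin m, mkM c (fun l => Pi.single l.succ 1) 0 l.succ = 0 := by
    intro l
    simp [Pi.single_apply, (Fin.succ_ne_zero l).symm]
  have h2 : (mkM c (fun l => Pi.single l.succ (1:ℝ))).submatrix Fin.succ Fin.succ = 1 := by
    ext a b
    simp [Matrix.one_apply, Pi.single_apply]
  simp [h1, h2]

/-- The unipotent subgroup `H`. -/
def hh (y : Fin m → ℝ) : GG (m+1) :=
  ⟨mkM (Fin.cons 1 y) (fun l => Pi.single l.succ 1), by rw [det_mkM_unit]; rfl⟩

theorem hh_coe (y : Fin m → ℝ) : (hh y : Matrix (Fin (m+1)) (Fin (m+1)) ℝ) =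
    mkM (Fin.cons 1 y) (fun l => Pi.single l.succ 1) := rfl

/-- The last `m` columns. -/
def colsR (g : GG (m+1)) : Fin m → Fin (m+1) → ℝ := fun l i => g i l.succ

theorem mul_hh_coe (A : Matrix (Fin (m+1)) (Fin (m+1)) ℝ) (y : Fin m → ℝ) :
    A * (hh y : Matrix (Fin (m+1)) (Fin (m+1)) ℝ) =
      mkM (fun i => A i 0 + ∑ l : Fin m, A i l.succ * y l) (fun l i => A i l.succ) := by
  rw [hh_coe]
  refine mkM_ext (fun i => ?_) (fun i l => ?_)
  · rw [Matrix.mul_apply, Fin.sum_univ_succ]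
    simp
  · rw [Matrix.mul_apply]
    simp [Pi.single_apply]

theorem hh_add (y y' : Fin m → ℝ) : hh (y + y') = hh y * hh y' := by
  apply Subtype.ext
  rw [Matrix.SpecialLinearGroup.coe_mul, mul_hh_coe, hh_coe, hh_coe]
  refine mkM_ext (fun i => ?_) (fun i l => ?_)
  · refine Fin.cases ?_ (fun i => ?_) i
    · simp [Pi.single_apply, (Fin.succ_ne_zero _).symm]
    · simp [Pi.single_apply]
  · simp

theorem hh_zero : hh (0 : Fin m → ℝ) = 1 := by
  have h := hh_add (0 : Fin m → ℝ) 0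
  rw [add_zero] at h
  simpa using h

theorem colsR_mul_hh (g : GG (m+1)) (y : Fin m → ℝ) : colsR (g * hh y) = colsR g := by
  ext l i
  unfold colsR
  rw [Matrix.SpecialLinearGroup.coe_mul, mul_hh_coe]
  rfl

theorem colsR_mul (g g' : GG (m+1)) : colsR (g * g') = fun l => g.1 *ᵥ (colsR g' l) := by
  ext l i
  simp [colsR, Matrix.mul_apply, Matrix.mulVec, dotProduct]

theorem eq_mul_hh {g g' : GG (m+1)} (h : colsR g = colsR g') :
    g' = g * hh (fun l => (g⁻¹ * g' : GG (m+1)) l.succ 0) := by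
  have key : ∀ u : GG (m+1), (∀ (l : Fin m) i, u i l.succ = (Pi.single l.succ 1 : Fin (m+1) → ℝ) i) →
      u = hh (fun l => u l.succ 0) := by
    intro u hu
    have e : (u : Matrix (Fin (m+1)) (Fin (m+1)) ℝ) =
        mkM (fun i => u i 0) (fun l => Pi.single l.succ 1) :=
      mkM_ext (fun i => rfl) (fun i l => hu l i)
    have hd : u 0 0 = 1 := by
      have := u.2
      rw [e, det_mkM_unit] at this
      exact this
    apply Subtype.ext
    rw [hh_coe]
    refine mkM_ext (fun i => ?_) (fun i l => hu l i)
    refine Fin.cases ?_ (fun i => ?_) i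
    · simpa using hd
    · simp
  have h2 := key (g⁻¹ * g') (by
    intro l i
    have e : colsR (g⁻¹ * g') = colsR (g⁻¹ * g) := by rw [colsR_mul, colsR_mul, h]
    have e2 := congrFun (congrFun e l) i
    rw [inv_mul_cancel] at e2
    unfold colsR at e2
    rw [e2]
    simp [Matrix.one_apply, Pi.single_apply])
  rw [← h2]
  simp

/-- Squared norm of the cofactor vector. -/
def nsq (C : Fin m → Fin (m+1) → ℝ) : ℝ := ∑ i, cofC C i * cofC C i

/-- Canonical first column. -/
def c0 (C : Fin m → Fin (m+1) → ℝ) : Fin (m+1) → ℝ := fun i => cofC C i / nsq C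

theorem det_c0 {C : Fin m → Fin (m+1) → ℝ} (h : nsq C ≠ 0) : (mkM (c0 C) C).det = 1 := by
  rw [det_mkM]
  unfold c0
  rw [Finset.sum_congr rfl (fun i _ => div_mul_eq_mul_div _ _ _), ← Finset.sum_div]
  exact div_self h

open Classical in
/-- A section of `G → G/H`. -/
def sec (C : Fin m → Fin (m+1) → ℝ) : GG (m+1) :=
  if h : nsq C ≠ 0 then (⟨mkM (c0 C) C, det_c0 h⟩ : GG (m+1)) else (1 : GG (m+1))

theorem sec_coe {C : Fin m → Fin (m+1) → ℝ} (h : nsq C ≠ 0) :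
    (sec C : Matrix (Fin (m+1)) (Fin (m+1)) ℝ) = mkM (c0 C) C := by
  have e : sec C = (⟨mkM (c0 C) C, det_c0 h⟩ : GG (m+1)) := dif_pos h
  rw [e]

theorem colsR_sec {C : Fin m → Fin (m+1) → ℝ} (h : nsq C ≠ 0) : colsR (sec C) = C := by
  unfold colsR
  rw [sec_coe h]
  rfl

theorem nsq_ne_of_det {c : Fin (m+1) → ℝ} {C : Fin m → Fin (m+1) → ℝ} (h : (mkM c C).det ≠ 0) :
    nsq C ≠ 0 := by
  intro h0
  apply h
  rw [det_mkM]
  unfold nsq at h0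
  rw [Finset.sum_eq_zero_iff_of_nonneg (fun i _ => mul_self_nonneg _)] at h0
  refine Finset.sum_eq_zero fun i hi => ?_
  rw [mul_self_eq_zero.1 (h0 i hi), mul_zero]

theorem nsq_colsR (g : GG (m+1)) : nsq (colsR g) ≠ 0 := by
  refine nsq_ne_of_det (c := fun i => g i 0) ?_
  have : mkM (fun i => g i 0) (colsR g) = g.1 := mkM_ext (fun i => rfl) (fun i l => rfl)
  rw [this, g.2]
  exact one_ne_zero

/-- The `H`-coordinate. -/
def yc (g : GG (m+1)) : Fin m → ℝ := fun l => ((sec (colsR g))⁻¹ * g : GG (m+1)) l.succ 0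

theorem eq_sec_mul_hh (g : GG (m+1)) : g = sec (colsR g) * hh (yc g) :=
  eq_mul_hh (colsR_sec (nsq_colsR g))

theorem yc_sec_mul {C : Fin m → Fin (m+1) → ℝ} (h : nsq C ≠ 0) (y : Fin m → ℝ) :
    yc (sec C * hh y) = y := by
  ext l
  unfold yc
  rw [colsR_mul_hh, colsR_sec h, inv_mul_cancel_left, hh_coe]
  simp

theorem mkM_continuous {α : Type*} [TopologicalSpace α] {c : α → Fin (m+1) → ℝ}
    {C : α → Fin m → Fin (m+1) → ℝ} (hc : Continuous c) (hC : Continuous C) :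
    Continuous (fun a => mkM (c a) (C a)) := by
  refine continuous_matrix fun i l => ?_
  refine Fin.cases ?_ (fun l => ?_) l
  · exact (continuous_apply i).comp hc
  · exact (continuous_apply i).comp ((continuous_apply l).comp hC)

theorem cofC_continuous (i : Fin (m+1)) : Continuous (fun C : Fin m → Fin (m+1) → ℝ => cofC C i) :=
  (mkM_continuous continuous_const continuous_id).matrix_det

theorem nsq_continuous : Continuous (fun C : Fin m → Fin (m+1) → ℝ => nsq C) :=
  continuous_finsetSum _ fun i _ => (cofC_continuous i).mul (cofC_continuous i)

theorem hh_continuous : Continuous (fun y : Fin m → ℝ => hh y) := by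
  rw [GG_continuous_iff]
  refine mkM_continuous ?_ continuous_const
  refine continuous_pi fun i => ?_
  refine Fin.cases ?_ (fun l => ?_) i
  · simpa using continuous_const
  · simpa using continuous_apply l

theorem colsR_continuous : Continuous (fun g : GG (m+1) => colsR g) :=
  continuous_pi fun l => continuous_pi fun i => (GG_continuous_val (m+1)).matrix_elem i l.succ

theorem sec_comp_continuous {α : Type*} [TopologicalSpace α] {C : α → Fin m → Fin (m+1) → ℝ}
    (hC : Continuous C) (h : ∀ a, nsq (C a) ≠ 0) : Continuous (fun a => sec (C a)) := by
  rw [GG_continuous_iff]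
  have e : (fun a => (sec (C a) : Matrix (Fin (m+1)) (Fin (m+1)) ℝ)) =
      fun a => mkM (c0 (C a)) (C a) := by
    ext1 a
    rw [sec_coe (h a)]
  rw [e]
  refine mkM_continuous ?_ hC
  exact continuous_pi fun i => ((cofC_continuous i).comp hC).div (nsq_continuous.comp hC) h

theorem yc_continuous : Continuous (fun g : GG (m+1) => yc g) := by
  refine continuous_pi fun l => ?_
  exact (GG_continuous_iff.1
    (((sec_comp_continuous colsR_continuous nsq_colsR).inv).mul continuous_id)).matrix_elem l.succ 0

theorem isOpen_nsq : IsOpen {C : Fin m → Fin (m+1) → ℝ | nsq C ≠ 0} :=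
  isOpen_ne_fun nsq_continuous continuous_const

theorem sec_continuousOn : ContinuousOn (fun C : Fin m → Fin (m+1) → ℝ => sec C) {C | nsq C ≠ 0} := by
  rw [continuousOn_iff_continuous_restrict]
  exact sec_comp_continuous (C := fun a : {C : Fin m → Fin (m+1) → ℝ | nsq C ≠ 0} => a.1)
    continuous_subtype_val (fun a => a.2)

theorem sec_measurable : Measurable (fun C : Fin m → Fin (m+1) → ℝ => sec C) := by
  classical
  have h1 : ∀ C : Fin m → Fin (m+1) → ℝ, nsq C = 0 → sec C = 1 := by
    intro C h
    exact dif_neg (by simpa using h)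
  refine measurable_of_restrict_of_restrict_compl isOpen_nsq.measurableSet ?_ ?_
  · exact (continuousOn_iff_continuous_restrict.1 sec_continuousOn).measurable
  · have : Set.domRestrict ({C : Fin m → Fin (m+1) → ℝ | nsq C ≠ 0}ᶜ) (fun C => sec C) = fun _ => 1 := by
      ext1 a
      have := a.2
      simp only [Set.mem_compl_iff, Set.mem_setOf_eq, not_not] at this
      exact h1 _ this
    rw [this]
    exact measurable_const

end coord

end

section
/-! ### The measure in coordinates. -/

section coordmeas
variable {m : ℕ}

/-- The coordinate chart. -/
def chart (p : (Fin m → Fin (m+1) → ℝ) × (Fin m → ℝ)) : GG (m+1) := sec p.1 * hh p.2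

theorem chart_measurable : Measurable (chart (m := m)) :=
  (sec_measurable.comp measurable_fst).mul (hh_continuous.measurable.comp measurable_snd)

/-- The open set of independent columns. -/
def OmC (m : ℕ) : Set (Fin m → Fin (m+1) → ℝ) := {C | nsq C ≠ 0}

theorem OmC_meas : MeasurableSet (OmC m) := isOpen_nsq.measurableSet

/-- Product measure in coordinates. -/
def prM (m : ℕ) : Measure ((Fin m → Fin (m+1) → ℝ) × (Fin m → ℝ)) :=
  ((volume : Measure (Fin m → Fin (m+1) → ℝ)).restrict (OmC m)).prod volume

/-- Push-forward to the group. -/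
def JJ (m : ℕ) : Measure (GG (m+1)) := (prM m).map chart

theorem prM_ae : ∀ᵐ p ∂(prM m), nsq p.1 ≠ 0 := by
  have : ∀ᵐ C ∂((volume : Measure (Fin m → Fin (m+1) → ℝ)).restrict (OmC m)), nsq C ≠ 0 :=
    ae_restrict_mem OmC_meas
  exact Measure.quasiMeasurePreserving_fst.ae this

theorem mulCols_mp (g : GG (m+1)) : MeasurePreserving
    (fun (C : Fin m → Fin (m+1) → ℝ) l => g.1 *ᵥ C l) volume volume := by
  refine volume_preserving_pi (f := fun _ v => g.1 *ᵥ v) fun l => ?_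
  have h := Real.map_matrix_volume_pi_eq_smul_volume_pi (M := g.1) (by rw [g.2]; exact one_ne_zero)
  rw [g.2] at h
  refine ⟨(Continuous.matrix_mulVec continuous_const continuous_id).measurable, ?_⟩
  have e : (fun v => g.1 *ᵥ v) = (Matrix.toLin' g.1 : (Fin (m+1) → ℝ) → Fin (m+1) → ℝ) := by
    ext1 v; rw [Matrix.toLin'_apply]
  rw [e, h]
  simp

theorem nsq_mulCols (g : GG (m+1)) {C : Fin m → Fin (m+1) → ℝ} (h : nsq C ≠ 0) :
    nsq (fun l => g.1 *ᵥ C l) ≠ 0 := by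
  have := nsq_colsR (g * sec C)
  rwa [colsR_mul, colsR_sec h] at this

theorem nsq_mulCols_iff (g : GG (m+1)) (C : Fin m → Fin (m+1) → ℝ) :
    nsq (fun l => g.1 *ᵥ C l) ≠ 0 ↔ nsq C ≠ 0 := by
  refine ⟨fun h => ?_, nsq_mulCols g⟩
  have h2 := nsq_mulCols g⁻¹ h
  have e : (fun l => (g⁻¹).1 *ᵥ g.1 *ᵥ C l) = C := by
    ext1 l
    rw [Matrix.mulVec_mulVec, ← Matrix.SpecialLinearGroup.coe_mul, inv_mul_cancel]
    simp
  rwa [e] at h2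

theorem mulCols_mp' (g : GG (m+1)) : MeasurePreserving
    (fun (C : Fin m → Fin (m+1) → ℝ) l => g.1 *ᵥ C l) (volume.restrict (OmC m))
      (volume.restrict (OmC m)) := by
  have h := (mulCols_mp g).restrict_preimage (OmC_meas (m := m))
  have e : (fun (C : Fin m → Fin (m+1) → ℝ) l => g.1 *ᵥ C l) ⁻¹' OmC m = OmC m := by
    ext C
    exact nsq_mulCols_iff g C
  rwa [e] at h

theorem skew_mp (g : GG (m+1)) : MeasurePreserving
    (fun p : (Fin m → Fin (m+1) → ℝ) × (Fin m → ℝ) =>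
      ((fun l => g.1 *ᵥ p.1 l), yc (g * sec p.1) + p.2)) (prM m) (prM m) := by
  refine (mulCols_mp' g).skew_product (g := fun C y => yc (g * sec C) + y) ?_ ?_
  · refine Measurable.add ?_ measurable_snd
    exact yc_continuous.measurable.comp ((sec_measurable.const_mul g).comp measurable_fst)
  · exact Filter.Eventually.of_forall fun C => map_add_left_eq_self _ _

instance JJ_leftInv : (JJ m).IsMulLeftInvariant := by
  refine ⟨fun g => ?_⟩
  unfold JJ
  rw [Measure.map_map (measurable_const_mul g) chart_measurable]
  conv_rhs => rw [← (skew_mp g).map_eq, Measure.map_map chart_measurable (skew_mp g).measurable]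
  refine Measure.map_congr ?_
  filter_upwards [prM_ae] with p hp
  show g * (sec p.1 * hh p.2) = sec (fun l => g.1 *ᵥ p.1 l) * hh (yc (g * sec p.1) + p.2)
  rw [hh_add, ← mul_assoc, ← mul_assoc]
  congr 1
  have := eq_sec_mul_hh (g * sec p.1)
  rwa [colsR_mul, colsR_sec hp] at this

theorem chart_mem {K : Set (GG (m+1))} {p : (Fin m → Fin (m+1) → ℝ) × (Fin m → ℝ)} (hp : nsq p.1 ≠ 0)
    (h : chart p ∈ K) : p ∈ (fun g => (colsR g, yc g)) '' K := by
  refine ⟨_, h, ?_⟩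
  unfold chart
  simp only [colsR_mul_hh, colsR_sec hp, yc_sec_mul hp]

theorem coords_continuous : Continuous (fun g : GG (m+1) => (colsR g, yc g)) :=
  colsR_continuous.prodMk yc_continuous

instance JJ_fin : IsFiniteMeasureOnCompacts (JJ m) := by
  refine ⟨fun K hK => ?_⟩
  unfold JJ
  rw [Measure.map_apply chart_measurable hK.measurableSet]
  have h1 : (prM m) (chart ⁻¹' K) ≤ (prM m) ((fun g => (colsR g, yc g)) '' K) := by
    refine measure_mono_ae ?_
    filter_upwards [prM_ae] with p hp h
    exact chart_mem hp h
  refine h1.trans_lt ?_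
  have hle : prM m ≤ volume := by
    unfold prM
    rw [Measure.volume_eq_prod]
    exact Measure.prod_mono Measure.restrict_le_self le_rfl
  exact (hle _).trans_lt (hK.image coords_continuous).measure_lt_top

open Classical in
/-- A function in coordinates, extended by zero. -/
def phit (φ : GG (m+1) → ℝ) (C : Fin m → Fin (m+1) → ℝ) (y : Fin m → ℝ) : ℝ :=
  if nsq C ≠ 0 then φ (sec C * hh y) else 0

/-- Integral over the fibres. -/
def psiF (φ : GG (m+1) → ℝ) (C : Fin m → Fin (m+1) → ℝ) : ℝ := ∫ y, phit φ C y

theorem phit_zero_off {φ : GG (m+1) → ℝ} {p : (Fin m → Fin (m+1) → ℝ) × (Fin m → ℝ)}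
    (hp : p ∉ (fun g => (colsR g, yc g)) '' tsupport φ) : phit φ p.1 p.2 = 0 := by
  by_cases h : nsq p.1 ≠ 0
  · rw [phit, if_pos h]
    by_contra hne
    exact hp (chart_mem h (subset_tsupport _ hne))
  · rw [phit, if_neg h]

theorem phit_continuous {φ : GG (m+1) → ℝ} (hc : Continuous φ) (hs : HasCompactSupport φ) :
    Continuous (Function.uncurry (phit φ)) := by
  have hK : IsCompact ((fun g : GG (m+1) => (colsR g, yc g)) '' tsupport φ) :=
    IsCompact.image hs coords_continuous
  refine continuous_of_cover_nhds (ι := Bool)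
    (s := fun b => if b then {p | nsq p.1 ≠ 0} else ((fun g => (colsR g, yc g)) '' tsupport φ)ᶜ)
    (fun p => ?_) (fun b => ?_)
  · by_cases h : nsq p.1 ≠ 0
    · refine ⟨true, ?_⟩
      exact (isOpen_nsq.preimage continuous_fst).mem_nhds h
    · refine ⟨false, ?_⟩
      refine hK.isClosed.isOpen_compl.mem_nhds ?_
      rintro ⟨g, _, rfl⟩
      exact h (nsq_colsR g)
  · cases b
    · refine continuousOn_const.congr (f := fun _ => (0:ℝ)) fun p hp => ?_
      exact phit_zero_off hp
    · have : ContinuousOn (fun p : (Fin m → Fin (m+1) → ℝ) × (Fin m → ℝ) => φ (sec p.1 * hh p.2))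
          {p | nsq p.1 ≠ 0} := by
        refine hc.comp_continuousOn (ContinuousOn.mul ?_ ?_)
        · exact sec_continuousOn.comp continuousOn_fst (fun p hp => hp)
        · exact (hh_continuous.comp continuous_snd).continuousOn
      refine ContinuousOn.congr this fun p hp => ?_
      exact if_pos hp

theorem phit_supp {φ : GG (m+1) → ℝ} (hs : HasCompactSupport φ) :
    HasCompactSupport (Function.uncurry (phit φ)) :=
  HasCompactSupport.intro (IsCompact.image hs coords_continuous) fun p hp => phit_zero_off hp

theorem psiF_continuous {φ : GG (m+1) → ℝ} (hc : Continuous φ) (hs : HasCompactSupport φ) :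
    Continuous (psiF φ) := by
  have hK : IsCompact (yc '' tsupport φ) := IsCompact.image hs yc_continuous
  have h := continuous_parametric_integral_of_continuous (μ := volume) (phit_continuous hc hs) hK
  refine h.congr fun C => ?_
  refine setIntegral_eq_integral_of_forall_compl_eq_zero fun y hy => ?_
  refine phit_zero_off (p := (C, y)) ?_
  rintro ⟨g, hg, e⟩
  exact hy ⟨g, hg, congrArg Prod.snd e⟩

theorem psiF_supp {φ : GG (m+1) → ℝ} (hs : HasCompactSupport φ) : HasCompactSupport (psiF φ) := by
  refine HasCompactSupport.intro (IsCompact.image hs colsR_continuous) fun C hC => ?_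
  unfold psiF
  refine integral_eq_zero_of_ae (Filter.Eventually.of_forall fun y => ?_)
  refine phit_zero_off (p := (C, y)) ?_
  rintro ⟨g, hg, e⟩
  exact hC ⟨g, hg, congrArg Prod.fst e⟩

theorem phit_nonneg {φ : GG (m+1) → ℝ} (h0 : ∀ g, 0 ≤ φ g) (C y) : 0 ≤ phit φ C y := by
  unfold phit
  split_ifs
  · exact h0 _
  · exact le_rfl

theorem psiF_nonneg {φ : GG (m+1) → ℝ} (h0 : ∀ g, 0 ≤ φ g) (C) : 0 ≤ psiF φ C :=
  integral_nonneg fun y => phit_nonneg h0 C y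

theorem psiF_ofReal {φ : GG (m+1) → ℝ} (hc : Continuous φ) (hs : HasCompactSupport φ)
    (h0 : ∀ g, 0 ≤ φ g) {C : Fin m → Fin (m+1) → ℝ} (h : nsq C ≠ 0) :
    ENNReal.ofReal (psiF φ C) = ∫⁻ y, ENNReal.ofReal (φ (sec C * hh y)) := by
  have hcy : Continuous (phit φ C) := (phit_continuous hc hs).comp (Continuous.prodMk_right C)
  have hsy : HasCompactSupport (phit φ C) := by
    refine HasCompactSupport.intro (IsCompact.image hs yc_continuous) fun y hy => ?_
    refine phit_zero_off (p := (C, y)) ?_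
    rintro ⟨g, hg, e⟩
    exact hy ⟨g, hg, congrArg Prod.snd e⟩
  unfold psiF
  rw [ofReal_integral_eq_lintegral_ofReal (hcy.integrable_of_hasCompactSupport hsy)
    (Filter.Eventually.of_forall fun y => phit_nonneg h0 C y)]
  refine lintegral_congr fun y => ?_
  rw [phit, if_pos h]

theorem psiF_integral {φ : GG (m+1) → ℝ} (hc : Continuous φ) (hs : HasCompactSupport φ) :
    ∫ C, psiF φ C = ∫ g, φ g ∂(JJ m) := by
  unfold JJ
  rw [integral_map chart_measurable.aemeasurable hc.aestronglyMeasurable]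
  have e : ∫ p, φ (chart p) ∂(prM m) = ∫ p, Function.uncurry (phit φ) p ∂(prM m) := by
    refine integral_congr_ae ?_
    filter_upwards [prM_ae] with p hp
    show _ = phit φ p.1 p.2
    rw [phit, if_pos hp]
    rfl
  rw [e]
  have hIntg : Integrable (Function.uncurry (phit φ)) (prM m) := by
    have hv : Integrable (Function.uncurry (phit φ)) volume :=
      (phit_continuous hc hs).integrable_of_hasCompactSupport (phit_supp hs)
    refine hv.mono_measure ?_
    unfold prM
    rw [Measure.volume_eq_prod]
    exact Measure.prod_mono Measure.restrict_le_self le_rfl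
  unfold prM at hIntg ⊢
  rw [integral_prod _ hIntg]
  symm
  refine setIntegral_eq_integral_of_forall_compl_eq_zero fun C hC => ?_
  refine integral_eq_zero_of_ae (Filter.Eventually.of_forall fun y => ?_)
  show phit φ C y = 0
  rw [phit, if_neg]
  exact hC

theorem psiF_main (hm : 1 ≤ m) (μ : Measure (XSpace (m+1))) [IsProbabilityMeasure μ]
    (hinv : ∀ g, Measure.map (rightTranslate (m+1) g) μ = μ) :
    ∃ c : ℝ, 0 ≤ c ∧ ∀ φ : GG (m+1) → ℝ, Continuous φ → HasCompactSupport φ →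
      ∫ C, psiF φ C = c * ∫ x, PP φ x ∂μ := by
  obtain ⟨c, hc0, hc⟩ := PP_integral (by omega) μ hinv
  have h := Measure.isMulLeftInvariant_eq_smul (JJ m) (Measure.haar : Measure (GG (m+1)))
  refine ⟨(JJ m).haarScalarFactor Measure.haar / c, by positivity, fun φ hφ hs => ?_⟩
  rw [psiF_integral hφ hs, hc φ hφ hs]
  conv_lhs => rw [h]
  rw [integral_smul_nnreal_measure]
  have : (c : ℝ) ≠ 0 := by exact_mod_cast hc0
  rw [NNReal.smul_def, smul_eq_mul]
  field_simp

end coordmeas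

end

section
/-! ### Integer matrices and lattices. -/

section intmat
variable {n : ℕ}

/-- The row lattice of an integer matrix. -/
def rowL (M : Matrix (Fin n) (Fin n) ℤ) : AddSubgroup (Fin n → ℤ) :=
  (Matrix.vecMulLinear M).toAddMonoidHom.range

theorem mem_rowL {M : Matrix (Fin n) (Fin n) ℤ} {v : Fin n → ℤ} : v ∈ rowL M ↔ ∃ w, w ᵥ* M = v :=
  Iff.rfl

theorem row_mem_rowL (M : Matrix (Fin n) (Fin n) ℤ) (i : Fin n) : M i ∈ rowL M :=
  mem_rowL.2 ⟨Pi.single i 1, by ext k; simp⟩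

theorem rowL_le {M : Matrix (Fin n) (Fin n) ℤ} {L : AddSubgroup (Fin n → ℤ)} (h : ∀ i, M i ∈ L) :
    rowL M ≤ L := by
  intro v hv
  obtain ⟨w, rfl⟩ := mem_rowL.1 hv
  have : w ᵥ* M = ∑ i, w i • M i := by
    ext k
    simp [Matrix.vecMul, dotProduct, Finset.sum_apply]
  rw [this]
  exact AddSubgroup.sum_mem _ fun i _ => AddSubgroup.zsmul_mem _ (h i) _

theorem exists_mul_of_rowL_le {M M' : Matrix (Fin n) (Fin n) ℤ} (h : rowL M' ≤ rowL M) :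
    ∃ A : Matrix (Fin n) (Fin n) ℤ, A * M = M' := by
  have h1 : ∀ i, ∃ w, w ᵥ* M = M' i := fun i => mem_rowL.1 (h (row_mem_rowL M' i))
  choose A hA using h1
  refine ⟨Matrix.of A, ?_⟩
  ext i k
  rw [← hA i]
  rfl

theorem rowL_mul_le (A M : Matrix (Fin n) (Fin n) ℤ) : rowL (A * M) ≤ rowL M := by
  intro v hv
  obtain ⟨w, rfl⟩ := mem_rowL.1 hv
  exact mem_rowL.2 ⟨w ᵥ* A, by rw [Matrix.vecMul_vecMul]⟩

theorem rowL_SL_mul (A : SpecialLinearGroup (Fin n) ℤ) (M : Matrix (Fin n) (Fin n) ℤ) :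
    rowL (A.1 * M) = rowL M := by
  refine le_antisymm (rowL_mul_le _ _) ?_
  have h := rowL_mul_le (A⁻¹).1 (A.1 * M)
  rwa [← mul_assoc, ← Matrix.SpecialLinearGroup.coe_mul, inv_mul_cancel,
    Matrix.SpecialLinearGroup.coe_one, one_mul] at h

theorem exists_SL_of_rowL_eq {M M' : Matrix (Fin n) (Fin n) ℤ} (h : rowL M' = rowL M)
    (hd : M.det ≠ 0) (hd' : M'.det = M.det) : ∃ A : SpecialLinearGroup (Fin n) ℤ, A.1 * M = M' := by
  obtain ⟨A, hA⟩ := exists_mul_of_rowL_le h.le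
  refine ⟨⟨A, ?_⟩, hA⟩
  have := congrArg Matrix.det hA
  rw [Matrix.det_mul, hd'] at this
  exact mul_right_cancel₀ hd (by rw [this, one_mul])

theorem vecMul_inj {M : Matrix (Fin n) (Fin n) ℤ} (hd : M.det ≠ 0) :
    Function.Injective (Matrix.vecMulLinear M) := by
  rw [injective_iff_map_eq_zero]
  intro v hv
  exact Matrix.eq_zero_of_vecMul_eq_zero hd hv

theorem rowL_index {M : Matrix (Fin n) (Fin n) ℤ} (hd : M.det ≠ 0) :
    (rowL M).index = M.det.natAbs := by
  let e : (Fin n → ℤ) ≃ₗ[ℤ] (rowL M) :=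
    (AddMonoidHom.ofInjective (f := (Matrix.vecMulLinear M).toAddMonoidHom) (vecMul_inj hd)).toIntLinearEquiv
  rw [AddSubgroup.index_eq_natAbs_det (Pi.basisFun ℤ (Fin n)) (rowL M) ((Pi.basisFun ℤ (Fin n)).map e)]
  congr 1
  rw [Pi.basisFun_det_apply]
  congr 1
  ext i k
  show (Matrix.vecMulLinear M (Pi.basisFun ℤ (Fin n) i)) k = M i k
  simp

theorem latticeSet_index {N j : ℕ} {L : AddSubgroup (Fin n → ℤ)} (hL : L ∈ latticeSet N n j) :
    L.index = N ^ j := by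
  obtain ⟨e⟩ := hL
  rw [AddSubgroup.index, Nat.card_congr e.toEquiv]
  simp [Nat.card_pi]

/-- The set of integer matrices whose rows span a lattice of the given type. -/
def MM (N n j : ℕ) : Set (Matrix (Fin n) (Fin n) ℤ) :=
  {M | M.det = (N:ℤ) ^ j ∧ rowL M ∈ latticeSet N n j}

theorem exists_MM {m N j : ℕ} [NeZero N] {L : AddSubgroup (Fin (m+1) → ℤ)}
    (hL : L ∈ latticeSet N (m+1) j) : ∃ M ∈ MM N (m+1) j, rowL M = L := by
  have hidx := latticeSet_index hL
  have hN : N ^ j ≠ 0 := pow_ne_zero _ (NeZero.ne N)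
  haveI : L.FiniteIndex := ⟨by rw [hidx]; exact hN⟩
  have hr : Module.finrank ℤ L = m + 1 := by
    rw [AddSubgroup.finrank_eq_of_finiteIndex]; simp
  haveI : Module.Free ℤ L := inferInstanceAs (Module.Free ℤ L.toIntSubmodule)
  haveI : Module.Finite ℤ L := inferInstanceAs (Module.Finite ℤ L.toIntSubmodule)
  let b : Module.Basis (Fin (m+1)) ℤ L := Module.finBasisOfFinrankEq ℤ L hr
  let M : Matrix (Fin (m+1)) (Fin (m+1)) ℤ := fun i => (b i : Fin (m+1) → ℤ)
  have hM : rowL M = L := by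
    refine le_antisymm (rowL_le fun i => (b i).2) fun v hv => ?_
    refine mem_rowL.2 ⟨fun i => b.repr ⟨v, hv⟩ i, ?_⟩
    have h := congrArg (Subtype.val) (b.sum_repr ⟨v, hv⟩)
    refine Eq.trans ?_ h
    generalize b.repr ⟨v, hv⟩ = c
    ext k
    simp [Matrix.vecMul, dotProduct, Finset.sum_apply, M]
  have hdet : M.det.natAbs = N ^ j := by
    rw [← hidx, AddSubgroup.index_eq_natAbs_det (Pi.basisFun ℤ (Fin (m+1))) L b,
      Pi.basisFun_det_apply]
    rfl
  rcases Int.natAbs_eq M.det with h | h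
  · refine ⟨M, ⟨?_, hM ▸ hL⟩, hM⟩
    rw [h, hdet]; push_cast; rfl
  · let M' := M.updateRow 0 (- M 0)
    have hM' : rowL M' = L := by
      rw [← hM]
      have h1 : ∀ i, M' i = if i = 0 then - M 0 else M i := by
        intro i
        by_cases hi : i = 0
        · subst hi; simp [M']
        · simp [M', hi]
      refine le_antisymm (rowL_le fun i => ?_) (rowL_le fun i => ?_)
      · rw [h1]
        split_ifs
        · exact neg_mem (row_mem_rowL M 0)
        · exact row_mem_rowL M i
      · have h2 := row_mem_rowL M' i
        rw [h1] at h2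
        split_ifs at h2 with hi
        · rw [hi]; simpa using neg_mem h2
        · exact h2
    refine ⟨M', ⟨?_, hM' ▸ hL⟩, hM'⟩
    have : M'.det = - M.det := by
      have e := Matrix.det_updateRow_smul M 0 (-1) (M 0)
      rw [Matrix.updateRow_eq_self] at e
      simpa [M'] using e
    rw [this, h, hdet]; push_cast; ring

theorem MM_transpose {N j : ℕ} [NeZero N] {M : Matrix (Fin n) (Fin n) ℤ} (hM : M ∈ MM N n j) :
    Mᵀ ∈ MM N n j := by
  obtain ⟨hd, hL⟩ := hM
  have hN : (N:ℤ) ≠ 0 := by exact_mod_cast NeZero.ne N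
  have hdet0 : M.det ≠ 0 := by rw [hd]; exact pow_ne_zero _ hN
  refine ⟨by rw [Matrix.det_transpose, hd], ?_⟩
  obtain ⟨S, hS, hSL⟩ := (mem_latticeSet_iff _).1 hL
  -- adjugate-like matrix
  obtain ⟨A, hA⟩ : ∃ A : Matrix (Fin n) (Fin n) ℤ, A * M = (N:ℤ) • 1 := by
    refine exists_mul_of_rowL_le (rowL_le fun i => ?_)
    rw [hSL, show redN N n (((N:ℤ) • (1 : Matrix (Fin n) (Fin n) ℤ)) i) = 0 from ?_, map_zero]
    rw [redN_eq_zero_iff]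
    exact ⟨(1 : Matrix (Fin n) (Fin n) ℤ) i, rfl⟩
  -- right inverse of S
  have hq : ∀ t : Fin j, ∃ q : Fin n → ℤ, S (redN N n q) = Pi.single t 1 := by
    intro t
    obtain ⟨w, hw⟩ := hS (Pi.single t 1)
    obtain ⟨q, rfl⟩ := redN_surjective N n w
    exact ⟨q, hw⟩
  choose Q hQ using hq
  -- lift of S
  let P : Fin n → Fin j → ℤ := fun i t => (S (Pi.single i 1) t).val
  have hP : ∀ (v : Fin n → ℤ) t, S (redN N n v) t = ((∑ i, v i * P i t : ℤ) : ZMod N) := by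
    intro v t
    have : redN N n v = ∑ i, (v i : ZMod N) • (Pi.single i 1 : Fin n → ZMod N) := by
      ext k
      simp [Finset.sum_apply, Pi.single_apply]
    rw [this, map_sum]
    simp [Finset.sum_apply, P]
  have hT : ∀ i t, ∃ z : ℤ, ∑ k, M i k * P k t = N * z := by
    intro i t
    have h1 : S (redN N n (M i)) = 0 := (hSL _).1 (row_mem_rowL M i)
    have h2 := hP (M i) t
    rw [h1] at h2
    have h3 : ((∑ k, M i k * P k t : ℤ) : ZMod N) = 0 := h2.symm
    exact (ZMod.intCast_zmod_eq_zero_iff_dvd _ N).1 h3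
  choose T hT using hT
  have hMT : M * Matrix.of P = (N:ℤ) • Matrix.of T := by
    ext i t
    simpa [Matrix.mul_apply] using hT i t
  have hAT : A * Matrix.of T = Matrix.of P := by
    have h1 : A * (M * Matrix.of P) = (N:ℤ) • Matrix.of P := by
      rw [← Matrix.mul_assoc, hA, Matrix.smul_mul, Matrix.one_mul]
    rw [hMT, Matrix.mul_smul] at h1
    exact smul_right_injective _ hN h1
  -- the quotient map of the column lattice
  let S' : (Fin n → ℤ) →+ (Fin j → ZMod N) :=
    { toFun := fun v t => (((Matrix.of Q * A) *ᵥ v) t : ZMod N)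
      map_zero' := by ext t; simp
      map_add' := fun v w => by ext t; simp [Matrix.mulVec_add] }
  have hS'T : ∀ t, S' (fun i => T i t) = Pi.single t 1 := by
    intro t
    ext s
    show (((Matrix.of Q * A) *ᵥ (fun i => T i t)) s : ZMod N) = _
    have e1 : ((Matrix.of Q * A) *ᵥ (fun i => T i t)) s = ((Matrix.of Q * A) * Matrix.of T) s t := rfl
    rw [e1, Matrix.mul_assoc, hAT]
    have e2 := hP (Q s) t
    rw [hQ s] at e2
    have e3 : (Matrix.of Q * Matrix.of P) s t = ∑ i, Q s i * P i t := rfl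
    rw [e3, ← e2]
    simp only [Pi.single_apply, eq_comm]
  have hsurj : Function.Surjective S' := by
    intro c
    refine ⟨∑ t, ((c t).val : ℤ) • (fun i => T i t), ?_⟩
    rw [map_sum]
    simp only [map_zsmul, hS'T]
    ext s
    rw [Finset.sum_apply, Finset.sum_eq_single s]
    · simp [← Pi.single_zsmul]
    · intro b _ hb
      simp [Pi.single_apply, hb.symm]
    · simp
  have hker : rowL Mᵀ ≤ S'.ker := by
    intro v hv
    obtain ⟨w, rfl⟩ := mem_rowL.1 hv
    rw [Matrix.vecMul_transpose, AddMonoidHom.mem_ker]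
    ext t
    show (((Matrix.of Q * A) *ᵥ (M *ᵥ w)) t : ZMod N) = 0
    rw [Matrix.mulVec_mulVec, Matrix.mul_assoc, hA]
    rw [Matrix.mul_smul, Matrix.mul_one, Matrix.smul_mulVec]
    simp
  have hidx : S'.ker.index = N ^ j := by
    rw [AddSubgroup.index, Nat.card_congr (QuotientAddGroup.quotientKerEquivOfSurjective S' hsurj).toEquiv]
    simp [Nat.card_pi]
  have hidx2 : (rowL Mᵀ).index = N ^ j := by
    rw [rowL_index (by rwa [Matrix.det_transpose]), Matrix.det_transpose, hd]
    simp [Int.natAbs_pow]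
  have heq : rowL Mᵀ = S'.ker := by
    refine le_antisymm hker ?_
    have h1 := AddSubgroup.relIndex_mul_index hker
    rw [hidx, hidx2] at h1
    have hpos : N ^ j ≠ 0 := pow_ne_zero _ (NeZero.ne N)
    exact AddSubgroup.relIndex_eq_one.1 (mul_right_cancel₀ hpos (by rw [h1, one_mul]))
  rw [heq]
  exact ⟨QuotientAddGroup.quotientKerEquivOfSurjective S' hsurj⟩

theorem MM_SL_mul {N j : ℕ} {M : Matrix (Fin n) (Fin n) ℤ} (hM : M ∈ MM N n j)
    (A : SpecialLinearGroup (Fin n) ℤ) : A.1 * M ∈ MM N n j := by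
  refine ⟨by rw [Matrix.det_mul, A.2, one_mul]; exact hM.1, ?_⟩
  rw [rowL_SL_mul]
  exact hM.2

theorem MM_mul_SL {N j : ℕ} [NeZero N] {M : Matrix (Fin n) (Fin n) ℤ} (hM : M ∈ MM N n j)
    (A : SpecialLinearGroup (Fin n) ℤ) : M * A.1 ∈ MM N n j := by
  have h := MM_transpose (MM_SL_mul (MM_transpose hM) A.transpose)
  rw [Matrix.transpose_mul, Matrix.transpose_transpose] at h
  simpa using h

end intmat

end

section
/-! ### Hecke averages. -/

section hecke
variable {m : ℕ}

/-- The embedding of `SL_n(ℤ)`. -/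
abbrev ic (n : ℕ) : SpecialLinearGroup (Fin n) ℤ →* GG n :=
  SpecialLinearGroup.map (Int.castRingHom ℝ)

theorem ic_coe {n : ℕ} (A : SpecialLinearGroup (Fin n) ℤ) (i l : Fin n) : (ic n A) i l = (A.1 i l : ℝ) := rfl

theorem ic_mem {n : ℕ} (A : SpecialLinearGroup (Fin n) ℤ) : ic n A ∈ Gamma n := ⟨A, rfl⟩

theorem ic_injective (n : ℕ) : Function.Injective (ic n) := by
  intro A B h
  apply Subtype.ext
  ext i l
  have := congrArg (fun g : GG n => g i l) h
  simp only [ic_coe] at this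
  exact_mod_cast this

theorem Gamma_tsum {n : ℕ} (f : GG n → ENNReal) :
    ∑' γ : Gamma n, f γ = ∑' A : SpecialLinearGroup (Fin n) ℤ, f (ic n A) := by
  have e := (MonoidHom.ofInjective (ic_injective n)).toEquiv
  exact ((MonoidHom.ofInjective (ic_injective n)).toEquiv.tsum_eq (fun γ : Gamma n => f γ)).symm

open Classical in
/-- Normalisation of an integer matrix to determinant one. -/
def nrm (N j : ℕ) (M : Matrix (Fin (m+1)) (Fin (m+1)) ℤ) : GG (m+1) :=
  if h : ((scl N (m+1) j)⁻¹ • M.map (fun z : ℤ => (z:ℝ))).det = 1 then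
    (⟨(scl N (m+1) j)⁻¹ • M.map (fun z : ℤ => (z:ℝ)), h⟩ : GG (m+1)) else (1 : GG (m+1))

theorem nrm_coe {N j : ℕ} [NeZero N] {M : Matrix (Fin (m+1)) (Fin (m+1)) ℤ} (h : M.det = (N:ℤ)^j) :
    (nrm N j M : Matrix (Fin (m+1)) (Fin (m+1)) ℝ) = (scl N (m+1) j)⁻¹ • M.map (fun z : ℤ => (z:ℝ)) := by
  have hd : ((scl N (m+1) j)⁻¹ • M.map (fun z : ℤ => (z:ℝ))).det = 1 := by
    rw [Matrix.det_smul, Fintype.card_fin, inv_pow, scl_pow N (m+1) j (by omega)]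
    have : (M.map (fun z : ℤ => (z:ℝ))).det = ((M.det : ℤ) : ℝ) := by
      have := (Int.castRingHom ℝ).map_det M
      exact this.symm
    rw [this, h]
    have hN : (N:ℝ) ≠ 0 := by exact_mod_cast NeZero.ne N
    push_cast
    field_simp
  have e : nrm N j M = (⟨(scl N (m+1) j)⁻¹ • M.map (fun z : ℤ => (z:ℝ)), hd⟩ : GG (m+1)) := dif_pos hd
  rw [e]

theorem map_mul_cast {n : ℕ} (A B : Matrix (Fin n) (Fin n) ℤ) :
    (A * B).map (fun z : ℤ => (z:ℝ)) = A.map (fun z : ℤ => (z:ℝ)) * B.map (fun z : ℤ => (z:ℝ)) := by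
  ext i l
  simp [Matrix.mul_apply]

theorem nrm_mul_left {N j : ℕ} [NeZero N] {M : Matrix (Fin (m+1)) (Fin (m+1)) ℤ} (h : M.det = (N:ℤ)^j)
    (A : SpecialLinearGroup (Fin (m+1)) ℤ) : nrm N j (A.1 * M) = ic (m+1) A * nrm N j M := by
  apply Subtype.ext
  rw [Matrix.SpecialLinearGroup.coe_mul, nrm_coe h, nrm_coe (by rw [Matrix.det_mul, A.2, one_mul, h]),
    map_mul_cast, Matrix.mul_smul]
  rfl

theorem nrm_mul_right {N j : ℕ} [NeZero N] {M : Matrix (Fin (m+1)) (Fin (m+1)) ℤ} (h : M.det = (N:ℤ)^j)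
    (A : SpecialLinearGroup (Fin (m+1)) ℤ) : nrm N j (M * A.1) = nrm N j M * ic (m+1) A := by
  apply Subtype.ext
  rw [Matrix.SpecialLinearGroup.coe_mul, nrm_coe h, nrm_coe (by rw [Matrix.det_mul, A.2, mul_one, h]),
    map_mul_cast, Matrix.smul_mul]
  rfl

theorem nrm_injOn {N j : ℕ} [NeZero N] {M M' : Matrix (Fin (m+1)) (Fin (m+1)) ℤ} (h : M.det = (N:ℤ)^j)
    (h' : M'.det = (N:ℤ)^j) (e : nrm N j M = nrm N j M') : M = M' := by
  have h1 := congrArg Subtype.val e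
  rw [nrm_coe h, nrm_coe h'] at h1
  have h2 := smul_right_injective _ (inv_ne_zero (scl_pos N (m+1) j).ne') h1
  ext i l
  have := congrFun (congrFun h2 i) l
  simpa using this

open Classical in
/-- A basis matrix of a lattice. -/
def bas (N m j : ℕ) (L : AddSubgroup (Fin (m+1) → ℤ)) : Matrix (Fin (m+1)) (Fin (m+1)) ℤ :=
  if h : ∃ M ∈ MM N (m+1) j, rowL M = L then h.choose else 1

theorem bas_spec {N j : ℕ} [NeZero N] {L : AddSubgroup (Fin (m+1) → ℤ)}
    (hL : L ∈ latticeSet N (m+1) j) : bas N m j L ∈ MM N (m+1) j ∧ rowL (bas N m j L) = L := by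
  have h : ∃ M ∈ MM N (m+1) j, rowL M = L := exists_MM hL
  have e : bas N m j L = h.choose := dif_pos h
  rw [e]
  exact h.choose_spec

/-- The point of `X` attached to a lattice. -/
def pt (N m j : ℕ) (L : AddSubgroup (Fin (m+1) → ℤ)) : XSpace (m+1) := toX (m+1) (nrm N j (bas N m j L))

theorem MM_det_ne {N n j : ℕ} [NeZero N] {M : Matrix (Fin n) (Fin n) ℤ} (h : M ∈ MM N n j) : M.det ≠ 0 := by
  rw [h.1]
  exact pow_ne_zero _ (by exact_mod_cast NeZero.ne N)

theorem pt_rowL {N j : ℕ} [NeZero N] {M : Matrix (Fin (m+1)) (Fin (m+1)) ℤ} (h : M ∈ MM N (m+1) j) :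
    pt N m j (rowL M) = toX (m+1) (nrm N j M) := by
  obtain ⟨h1, h2⟩ := bas_spec h.2
  obtain ⟨A, hA⟩ := exists_SL_of_rowL_eq h2.symm (MM_det_ne h1) (h.1.trans h1.1.symm)
  have e : nrm N j M = ic (m+1) A * nrm N j (bas N m j (rowL M)) := by
    rw [← nrm_mul_left h1.1, hA]
  unfold pt
  rw [e, toX_gamma_mul (ic_mem A)]

open Classical in
/-- The finite set of lattices. -/
def latF (N m j : ℕ) : Finset (AddSubgroup (Fin (m+1) → ℤ)) :=
  if h : (latticeSet N (m+1) j).Finite then h.toFinset else ∅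

theorem mem_latF {N j : ℕ} [NeZero N] {L : AddSubgroup (Fin (m+1) → ℤ)} :
    L ∈ latF N m j ↔ L ∈ latticeSet N (m+1) j := by
  rw [latF, dif_pos (latticeSet_finite N (m+1) j)]
  simp

theorem latF_card {N j : ℕ} [NeZero N] : (latF N m j).card = (latticeSet N (m+1) j).ncard := by
  rw [latF, dif_pos (latticeSet_finite N (m+1) j), Set.ncard_eq_toFinset_card _ (latticeSet_finite N (m+1) j)]

theorem latF_card_pos {N j : ℕ} [NeZero N] (hj : j ≤ m + 1) : 0 < (latF N m j).card := by
  rw [Finset.card_pos]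
  let S : (Fin (m+1) → ZMod N) →ₗ[ZMod N] (Fin j → ZMod N) :=
    LinearMap.funLeft (ZMod N) (ZMod N) (Fin.castLE hj)
  have hS : Function.Surjective S :=
    LinearMap.funLeft_surjective_of_injective _ _ _ (Fin.castLE_injective hj)
  refine ⟨(S.toAddMonoidHom.comp (redN N (m+1))).ker, ?_⟩
  rw [mem_latF, mem_latticeSet_iff]
  exact ⟨S, hS, fun v => Iff.rfl⟩

/-- The Hecke average. -/
def avg {E : Type*} [AddCommGroup E] [Module ℝ E] (N m j : ℕ) (f : XSpace (m+1) → E) : E :=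
  ((latF N m j).card : ℝ)⁻¹ • ∑ L ∈ latF N m j, f (pt N m j L)

theorem avg_gamma {E : Type*} [AddCommGroup E] [Module ℝ E] {N j : ℕ} [NeZero N]
    (f : XSpace (m+1) → E) {γ : GG (m+1)} (hγ : γ ∈ Gamma (m+1)) :
    avg N m j (fun x => f (rightTranslate (m+1) γ x)) = avg N m j f := by
  obtain ⟨A, rfl⟩ := hγ
  unfold avg
  congr 1
  have key : ∀ (A : SpecialLinearGroup (Fin (m+1)) ℤ) (M : Matrix (Fin (m+1)) (Fin (m+1)) ℤ),
      M ∈ MM N (m+1) j → rowL (bas N m j (rowL M) * A.1) = rowL (M * A.1) := by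
    intro A M hM
    obtain ⟨h1, h2⟩ := bas_spec hM.2
    obtain ⟨B, hB⟩ := exists_SL_of_rowL_eq h2.symm (MM_det_ne h1) (hM.1.trans h1.1.symm)
    have e : M * A.1 = B.1 * (bas N m j (rowL M) * A.1) := by
      rw [← mul_assoc, hB]
    rw [e, rowL_SL_mul]
  have key2 : ∀ (A : SpecialLinearGroup (Fin (m+1)) ℤ) L, L ∈ latF N m j →
      rowL (bas N m j (rowL (bas N m j L * A.1)) * (A⁻¹).1) = L := by
    intro A L hL
    obtain ⟨h1, h2⟩ := bas_spec (mem_latF.1 hL)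
    rw [key _ _ (MM_mul_SL h1 A), mul_assoc, ← Matrix.SpecialLinearGroup.coe_mul, mul_inv_cancel,
      Matrix.SpecialLinearGroup.coe_one, mul_one, h2]
  refine Finset.sum_nbij' (fun L => rowL (bas N m j L * A.1)) (fun L => rowL (bas N m j L * (A⁻¹).1))
    ?_ ?_ ?_ ?_ ?_
  · intro L hL
    exact mem_latF.2 (MM_mul_SL (bas_spec (mem_latF.1 hL)).1 A).2
  · intro L hL
    exact mem_latF.2 (MM_mul_SL (bas_spec (mem_latF.1 hL)).1 A⁻¹).2
  · intro L hL
    exact key2 A L hL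
  · intro L hL
    have := key2 A⁻¹ L hL
    rwa [inv_inv] at this
  · intro L hL
    have h := (bas_spec (mem_latF.1 hL)).1
    simp only
    rw [pt_rowL (MM_mul_SL h A), nrm_mul_right h.1]
    unfold pt
    rw [rightTranslate_toX]

theorem MM_tsum {N j : ℕ} [NeZero N] (h : Matrix (Fin (m+1)) (Fin (m+1)) ℤ → ENNReal) :
    ∑' M : MM N (m+1) j, h M = ∑ L ∈ latF N m j, ∑' A : SpecialLinearGroup (Fin (m+1)) ℤ,
      h (A.1 * bas N m j L) := by
  rw [← Finset.tsum_subtype (latF N m j) (fun L => ∑' A : SpecialLinearGroup (Fin (m+1)) ℤ,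
      h (A.1 * bas N m j L))]
  rw [← ENNReal.tsum_prod (f := fun (L : latF N m j) (A : SpecialLinearGroup (Fin (m+1)) ℤ) =>
    h (A.1 * bas N m j L))]
  let F : (latF N m j) × SpecialLinearGroup (Fin (m+1)) ℤ → MM N (m+1) j := fun p =>
    ⟨p.2.1 * bas N m j p.1, MM_SL_mul (bas_spec (mem_latF.1 p.1.2)).1 p.2⟩
  have hF : Function.Bijective F := by
    constructor
    · rintro ⟨L, A⟩ ⟨L', A'⟩ e
      have e1 : A.1 * bas N m j L = A'.1 * bas N m j L' := congrArg Subtype.val e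
      obtain ⟨h1, h2⟩ := bas_spec (mem_latF.1 L.2)
      obtain ⟨h1', h2'⟩ := bas_spec (mem_latF.1 L'.2)
      have hL : L = L' := by
        apply Subtype.ext
        have := congrArg rowL e1
        rwa [rowL_SL_mul, rowL_SL_mul, h2, h2'] at this
      subst hL
      have hA : A = A' := by
        apply ic_injective (m+1)
        have e2 := congrArg (nrm N j) e1
        rw [nrm_mul_left h1.1, nrm_mul_left h1.1] at e2
        exact mul_right_cancel e2
      rw [hA]
    · rintro ⟨M, hM⟩
      obtain ⟨h1, h2⟩ := bas_spec hM.2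
      obtain ⟨A, hA⟩ := exists_SL_of_rowL_eq h2.symm (MM_det_ne h1) (hM.1.trans h1.1.symm)
      exact ⟨(⟨rowL M, mem_latF.2 hM.2⟩, A), Subtype.ext hA⟩
  exact ((Equiv.ofBijective F hF).tsum_eq (fun M : MM N (m+1) j => h M)).symm

/-- Transposition on `SL_n(ℤ)`. -/
def trEquiv (n : ℕ) : SpecialLinearGroup (Fin n) ℤ ≃ SpecialLinearGroup (Fin n) ℤ where
  toFun A := A.transpose
  invFun A := A.transpose
  left_inv A := by apply Subtype.ext; simp
  right_inv A := by apply Subtype.ext; simp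

theorem MM_tsum' {N j : ℕ} [NeZero N] (h : Matrix (Fin (m+1)) (Fin (m+1)) ℤ → ENNReal) :
    ∑' M : MM N (m+1) j, h M = ∑ L ∈ latF N m j, ∑' A : SpecialLinearGroup (Fin (m+1)) ℤ,
      h ((bas N m j L)ᵀ * A.1) := by
  let T : MM N (m+1) j ≃ MM N (m+1) j :=
    { toFun := fun M => ⟨M.1ᵀ, MM_transpose M.2⟩
      invFun := fun M => ⟨M.1ᵀ, MM_transpose M.2⟩
      left_inv := fun M => by simp
      right_inv := fun M => by simp }
  rw [← T.tsum_eq]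
  refine (MM_tsum (fun M => h Mᵀ)).trans ?_
  refine Finset.sum_congr rfl fun L _ => ?_
  rw [← (trEquiv (m+1)).tsum_eq]
  refine tsum_congr fun A => ?_
  rw [Matrix.transpose_mul]
  congr 2

theorem unfold_avg {N j : ℕ} [NeZero N] {φ : GG (m+1) → ℝ} (h0 : ∀ g, 0 ≤ φ g)
    (hs : HasCompactSupport φ) (g : GG (m+1)) :
    ∑ L ∈ latF N m j, ENNReal.ofReal (PP φ (rightTranslate (m+1) g (pt N m j L))) =
      ∑' M : MM N (m+1) j, ENNReal.ofReal (φ (nrm N j M.1 * g)) := by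
  rw [MM_tsum (fun M => ENNReal.ofReal (φ (nrm N j M * g)))]
  refine Finset.sum_congr rfl fun L hL => ?_
  unfold pt
  rw [rightTranslate_toX, PP_ofReal h0 hs, Gamma_tsum (fun γ => ENNReal.ofReal (φ (γ * _)))]
  refine tsum_congr fun A => ?_
  rw [nrm_mul_left (bas_spec (mem_latF.1 hL)).1.1, mul_assoc]

/-- The average as a function on `X`. -/
def Th (N m j : ℕ) (φ : GG (m+1) → ℝ) (x : XSpace (m+1)) : ℝ :=
  ((latF N m j).card : ℝ)⁻¹ • ∑ L ∈ latF N m j, PP (fun y => φ (nrm N j (bas N m j L)ᵀ * y)) x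

theorem supp_left {n : ℕ} {φ : GG n → ℝ} (hs : HasCompactSupport φ) (g : GG n) :
    HasCompactSupport (fun y => φ (g * y)) :=
  hs.comp_homeomorph (Homeomorph.mulLeft g)

theorem Th_toX {N j : ℕ} [NeZero N] {φ : GG (m+1) → ℝ} (h0 : ∀ g, 0 ≤ φ g)
    (hs : HasCompactSupport φ) (g : GG (m+1)) :
    Th N m j φ (toX (m+1) g) = avg N m j (fun x => PP φ (rightTranslate (m+1) g x)) := by
  unfold Th avg
  congr 1
  have e : ENNReal.ofReal (∑ L ∈ latF N m j, PP (fun y => φ (nrm N j (bas N m j L)ᵀ * y)) (toX (m+1) g)) =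
      ENNReal.ofReal (∑ L ∈ latF N m j, PP φ (rightTranslate (m+1) g (pt N m j L))) := by
    rw [ENNReal.ofReal_sum_of_nonneg (fun L _ => PP_nonneg (fun y => h0 _) _),
      ENNReal.ofReal_sum_of_nonneg (fun L _ => PP_nonneg h0 _), unfold_avg h0 hs,
      MM_tsum' (fun M => ENNReal.ofReal (φ (nrm N j M * g)))]
    refine Finset.sum_congr rfl fun L hL => ?_
    rw [PP_ofReal (fun y => h0 _) (supp_left hs _),
      Gamma_tsum (fun γ => ENNReal.ofReal (φ (_ * (γ * g))))]
    refine tsum_congr fun A => ?_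
    rw [nrm_mul_right (MM_transpose (bas_spec (mem_latF.1 hL)).1).1, mul_assoc]
  exact (ENNReal.ofReal_eq_ofReal_iff (Finset.sum_nonneg fun L _ => PP_nonneg (fun y => h0 _) _)
    (Finset.sum_nonneg fun L _ => PP_nonneg h0 _)).1 e

theorem Th_integral {N j : ℕ} [NeZero N] (hm : 1 ≤ m) (hj : j ≤ m + 1) (μ : Measure (XSpace (m+1)))
    [IsProbabilityMeasure μ] (hinv : ∀ g, Measure.map (rightTranslate (m+1) g) μ = μ)
    {φ : GG (m+1) → ℝ} (hc : Continuous φ) (hs : HasCompactSupport φ) :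
    ∫ x, Th N m j φ x ∂μ = ∫ x, PP φ x ∂μ := by
  unfold Th
  rw [integral_smul, integral_finsetSum _ (fun L _ => (PP_TF
    (φ := fun y => φ (nrm N j (bas N m j L)ᵀ * y)) (hc.comp (continuous_const_mul _)) (supp_left hs _)).integrable μ)]
  rw [Finset.sum_congr rfl (fun L _ => PP_integral_left (by omega) μ hinv hc hs _), Finset.sum_const,
    nsmul_eq_mul, smul_eq_mul, ← mul_assoc, inv_mul_cancel₀, one_mul]
  exact_mod_cast (latF_card_pos hj).ne'

end hecke

end

section
/-! ### The bound for averages over the cube. -/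

section cubebound
variable {m : ℕ}

/-- The half-open unit cube (0,1]^m. -/
def cube (m : ℕ) : Set (Fin m → ℝ) := Set.pi Set.univ (fun _ => Set.Ioc (0:ℝ) 1)

theorem cube_meas : MeasurableSet (cube m) :=
  MeasurableSet.univ_pi (fun _ => measurableSet_Ioc)

theorem mem_cube {t : Fin m → ℝ} : t ∈ cube m ↔ ∀ l, 0 < t l ∧ t l ≤ 1 := by
  simp [cube, Set.mem_pi]

theorem cube_vol : volume (cube m) = 1 := by
  unfold cube
  rw [volume_pi_pi]
  simp

theorem MM_countable (N n j : ℕ) : Countable (MM N n j) := by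
  have : Countable (Matrix (Fin n) (Fin n) ℤ) := inferInstanceAs (Countable (Fin n → Fin n → ℤ))
  infer_instance

/-- Recording the last columns of a matrix. -/
def toTup {N j : ℕ} [NeZero N] (M : MM N (m+1) j) : tupIdx N m j :=
  ⟨(⟨rowL M.1ᵀ, (MM_transpose M.2).2⟩, fun l i => M.1 i l.succ), by
    constructor
    · have hd : (M.1ᵀ.map (fun z : ℤ => (z:ℝ))).det ≠ 0 := by
        have h1 : (M.1ᵀ.map (fun z : ℤ => (z:ℝ))).det = ((M.1ᵀ.det : ℤ) : ℝ) :=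
          ((Int.castRingHom ℝ).map_det M.1ᵀ).symm
        rw [h1, Matrix.det_transpose]
        exact_mod_cast MM_det_ne M.2
      have h2 : LinearIndependent ℝ (M.1ᵀ.map (fun z : ℤ => (z:ℝ))).row :=
        Matrix.linearIndependent_rows_of_det_ne_zero hd
      exact h2.comp Fin.succ (Fin.succ_injective m)
    · intro l
      exact row_mem_rowL M.1ᵀ l.succ⟩

theorem tupVal_toTup {N j : ℕ} [NeZero N] (M : MM N (m+1) j) :
    tupVal (toTup M) = colsR (nrm N j M.1) := by
  ext l i
  unfold colsR
  rw [nrm_coe M.2.1]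
  rfl

theorem toTup_fiber {N j : ℕ} [NeZero N] {M M' : MM N (m+1) j} (h : toTup M = toTup M') :
    ∀ l, ∃ z : ℤ, yc (nrm N j M'.1) l - yc (nrm N j M.1) l = z := by
  have h1 : rowL M'.1ᵀ = rowL M.1ᵀ :=
    (congrArg (fun p : tupIdx N m j => (p.1.1.1 : AddSubgroup (Fin (m+1) → ℤ))) h).symm
  obtain ⟨A, hA⟩ := exists_SL_of_rowL_eq h1 (MM_det_ne (MM_transpose M.2))
    ((MM_transpose M'.2).1.trans (MM_transpose M.2).1.symm)
  have h2 : M'.1 = M.1 * (A.transpose).1 := by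
    have := congrArg Matrix.transpose hA
    rw [Matrix.transpose_mul, Matrix.transpose_transpose, Matrix.transpose_transpose] at this
    exact this.symm
  have h3 : nrm N j M'.1 = nrm N j M.1 * ic (m+1) A.transpose := by
    rw [h2, nrm_mul_right M.2.1]
  have hC : colsR (nrm N j M'.1) = colsR (nrm N j M.1) := by
    rw [← tupVal_toTup, ← tupVal_toTup, h]
  have h4 : hh (yc (nrm N j M'.1) - yc (nrm N j M.1)) = ic (m+1) A.transpose := by
    have e1 := eq_sec_mul_hh (nrm N j M.1)
    have e2 := eq_sec_mul_hh (nrm N j M'.1)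
    rw [hC] at e2
    rw [e2] at h3
    conv_rhs at h3 => rw [e1]
    rw [mul_assoc] at h3
    have h5 := mul_left_cancel h3
    have h6 : hh (yc (nrm N j M.1) + (yc (nrm N j M'.1) - yc (nrm N j M.1))) = hh (yc (nrm N j M'.1)) := by
      congr 1
      abel
    rw [hh_add, h5] at h6
    exact mul_left_cancel h6
  intro l
  refine ⟨A.transpose.1 l.succ 0, ?_⟩
  have h7 := congrArg (fun g : GG (m+1) => g l.succ 0) h4
  simp only [ic_coe] at h7
  rw [← h7, hh_coe]
  simp

theorem fiber_bound {N j : ℕ} [NeZero N] {φ : GG (m+1) → ℝ} (hc : Continuous φ) (h0 : ∀ g, 0 ≤ φ g)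
    (hs : HasCompactSupport φ) (p : tupIdx N m j) :
    ∑' M : {M : MM N (m+1) j // toTup M = p},
      ∫⁻ t in cube m, ENNReal.ofReal (φ (nrm N j M.1.1 * hh t)) ≤ ENNReal.ofReal (psiF φ (tupVal p)) := by
  have := MM_countable N (m+1) j
  rcases isEmpty_or_nonempty {M : MM N (m+1) j // toTup M = p} with hE | ⟨⟨M0, hM0⟩⟩
  · simp
  have hC : ∀ M : {M : MM N (m+1) j // toTup M = p}, colsR (nrm N j M.1.1) = tupVal p := by
    intro M
    rw [← tupVal_toTup, M.2]
  have hn : nsq (tupVal p) ≠ 0 := by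
    rw [← hC ⟨M0, hM0⟩]
    exact nsq_colsR _
  rw [psiF_ofReal hc hs h0 hn]
  let y : {M : MM N (m+1) j // toTup M = p} → (Fin m → ℝ) := fun M => yc (nrm N j M.1.1)
  have hsec : ∀ M : {M : MM N (m+1) j // toTup M = p}, nrm N j M.1.1 = sec (tupVal p) * hh (y M) := by
    intro M
    rw [← hC M]
    exact eq_sec_mul_hh _
  let G : (Fin m → ℝ) → ENNReal := fun z => ENNReal.ofReal (φ (sec (tupVal p) * hh z))
  let S : {M : MM N (m+1) j // toTup M = p} → Set (Fin m → ℝ) := fun M => (fun t => y M + t) '' cube m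
  have hS : ∀ M, MeasurableSet (S M) := fun M =>
    (MeasurableEquiv.addLeft (y M)).measurableEmbedding.measurableSet_image.2 cube_meas
  have e1 : ∀ M : {M : MM N (m+1) j // toTup M = p},
      ∫⁻ t in cube m, ENNReal.ofReal (φ (nrm N j M.1.1 * hh t)) = ∫⁻ z in S M, G z := by
    intro M
    have hmp : MeasurePreserving (fun t : Fin m → ℝ => y M + t) volume volume :=
      measurePreserving_add_left volume (y M)
    rw [← hmp.setLIntegral_comp_emb (MeasurableEquiv.addLeft (y M)).measurableEmbedding]
    refine lintegral_congr fun t => ?_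
    simp only [G]
    rw [hh_add, ← mul_assoc, ← hsec M]
  have hdisj : Pairwise (Function.onFun Disjoint S) := by
    intro M M' hne
    rw [Function.onFun, Set.disjoint_left]
    rintro z ⟨t, ht, rfl⟩ ⟨t', ht', e⟩
    apply hne
    have hy : y M = y M' := by
      ext l
      obtain ⟨k, hk⟩ := toTup_fiber (M.2.trans M'.2.symm) l
      have e2 := congrFun e l
      simp only [Pi.add_apply] at e2
      have t1 := mem_cube.1 ht l
      have t2 := mem_cube.1 ht' l
      have e3 : (k:ℝ) = t l - t' l := by
        rw [← hk]
        simp only [y] at e2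
        linarith
      have k1 : k < 1 := by
        have : (k:ℝ) < 1 := by rw [e3]; linarith
        exact_mod_cast this
      have k2 : -1 < k := by
        have : (-1:ℝ) < k := by rw [e3]; linarith
        exact_mod_cast this
      have k0 : k = 0 := by omega
      rw [k0] at hk
      simp only [y]
      push_cast at hk
      linarith
    apply Subtype.ext
    apply Subtype.ext
    refine nrm_injOn M.1.2.1 M'.1.2.1 ?_
    rw [hsec M, hsec M', hy]
  rw [tsum_congr e1, ← lintegral_iUnion hS hdisj]
  exact setLIntegral_le_lintegral _ _

theorem cube_lintegral {N j : ℕ} [NeZero N] {φ : GG (m+1) → ℝ} (hc : Continuous φ) (h0 : ∀ g, 0 ≤ φ g)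
    (hs : HasCompactSupport φ) :
    ∫⁻ t in cube m, ∑ L ∈ latF N m j, ENNReal.ofReal (PP φ (rightTranslate (m+1) (hh t) (pt N m j L))) ≤
      ∑' p : tupIdx N m j, ENNReal.ofReal (psiF φ (tupVal p)) := by
  have := MM_countable N (m+1) j
  rw [lintegral_congr (fun t => unfold_avg h0 hs (hh t)), lintegral_tsum]
  · rw [← (Equiv.sigmaFiberEquiv (toTup (N := N) (m := m) (j := j))).tsum_eq, ENNReal.tsum_sigma']
    exact ENNReal.tsum_le_tsum fun p => fiber_bound hc h0 hs p
  · intro M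
    have : Continuous (fun t : Fin m → ℝ => ENNReal.ofReal (φ (nrm N j M.1 * hh t))) :=
      ENNReal.continuous_ofReal.comp (hc.comp (continuous_const.mul hh_continuous))
    exact this.aemeasurable

theorem avg_cont {E : Type*} [NormedAddCommGroup E] [NormedSpace ℝ E] {N j : ℕ} {f : XSpace (m+1) → E}
    (hf : Continuous f) :
    Continuous (fun g : GG (m+1) => avg N m j (fun x => f (rightTranslate (m+1) g x))) := by
  unfold avg
  refine Continuous.const_smul (continuous_finsetSum _ fun L _ => ?_) _
  refine hf.comp ?_
  unfold pt
  simp only [rightTranslate_toX]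
  exact (toX_continuous _).comp (continuous_const_mul _)

theorem cube_main (hm : 1 ≤ m) {j : ℕ} (hj : 1 ≤ j) (hjm : j ≤ m) (μ : Measure (XSpace (m+1)))
    [IsProbabilityMeasure μ] (hinv : ∀ g, Measure.map (rightTranslate (m+1) g) μ = μ) :
    ∃ C : ℝ, 0 ≤ C ∧ ∀ f : XSpace (m+1) → ℝ, TF f → (∀ x, 0 ≤ f x) → ∀ δ > 0,
      ∀ᶠ N : ℕ in Filter.atTop,
        ∫ t in cube m, avg N m j (fun x => f (rightTranslate (m+1) (hh t) x)) ≤ C * ∫ x, f x ∂μ + δ := by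
  obtain ⟨C, hC0, hC⟩ := main_count hm hj (show 1 ≤ m + 1 - j by omega) (by omega)
  obtain ⟨c, hc0, hc⟩ := psiF_main hm μ hinv
  refine ⟨C * c, by positivity, fun f hf f0 δ hδ => ?_⟩
  obtain ⟨φ, hφ, hs, h0, rfl⟩ := TF.exists_rep hf f0
  have h1 := hC (psiF φ) (psiF_continuous hφ hs) (psiF_supp hs) (psiF_nonneg h0) δ hδ
  filter_upwards [h1, Filter.eventually_ge_atTop 1] with N hN hN1
  have : NeZero N := ⟨by omega⟩
  have hd := latF_card_pos (N := N) (j := j) (m := m) (by omega)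
  have h2 := (cube_lintegral (N := N) (j := j) hφ h0 hs).trans hN
  rw [← latF_card] at h2
  have hcont : Continuous (fun t : Fin m → ℝ => avg N m j (fun x => PP φ (rightTranslate (m+1) (hh t) x))) :=
    (avg_cont hf.cont).comp hh_continuous
  rw [hc φ hφ hs] at h2
  have hI : 0 ≤ ∫ x, PP φ x ∂μ := integral_nonneg f0
  have hR : 0 ≤ C * c * ∫ x, PP φ x ∂μ + δ := by positivity
  rw [integral_eq_lintegral_of_nonneg_ae (Filter.Eventually.of_forall fun t => ?_)
    hcont.aestronglyMeasurable]
  · refine ENNReal.toReal_le_of_le_ofReal hR ?_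
    unfold avg
    have e : ∀ t : Fin m → ℝ, ENNReal.ofReal (((latF N m j).card : ℝ)⁻¹ •
        ∑ L ∈ latF N m j, PP φ (rightTranslate (m+1) (hh t) (pt N m j L))) =
        ENNReal.ofReal (((latF N m j).card : ℝ)⁻¹) *
        ∑ L ∈ latF N m j, ENNReal.ofReal (PP φ (rightTranslate (m+1) (hh t) (pt N m j L))) := by
      intro t
      rw [smul_eq_mul, ENNReal.ofReal_mul (by positivity), ENNReal.ofReal_sum_of_nonneg (fun L _ => f0 _)]
    rw [lintegral_congr e, lintegral_const_mul' _ _ ENNReal.ofReal_ne_top]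
    refine (mul_le_mul_right h2 _).trans (le_of_eq ?_)
    rw [← ENNReal.ofReal_natCast, ← ENNReal.ofReal_mul (by positivity), ← ENNReal.ofReal_mul (by positivity)]
    congr 1
    have : ((latF N m j).card : ℝ) ≠ 0 := by exact_mod_cast hd.ne'
    field_simp
  · unfold avg
    exact smul_nonneg (by positivity) (Finset.sum_nonneg fun L _ => f0 _)

end cubebound

end

section
/-! ### Interchanging limits and integrals. -/

open Filter Topology in
theorem interchange {Y E : Type*} [TopologicalSpace Y] [SecondCountableTopology Y] [MeasurableSpace Y]
    [BorelSpace Y] [NormedAddCommGroup E] [NormedSpace ℝ E] (P : Measure Y) [IsFiniteMeasure P]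
    (l : Filter ℕ) [l.NeBot] (T : ℕ → Y → E) (T' : Y → E) (B : ℝ) (hB : ∀ N y, ‖T N y‖ ≤ B)
    (heq : ∀ ε > 0, ∀ y, ∃ U ∈ 𝓝 y, ∀ N, ∀ z ∈ U, ‖T N z - T N y‖ ≤ ε)
    (hlim : ∀ y, Tendsto (fun N => T N y) l (𝓝 (T' y))) :
    Continuous T' ∧ Tendsto (fun N => ∫ y, T N y ∂P) l (𝓝 (∫ y, T' y ∂P)) := by
  have hB' : ∀ y, ‖T' y‖ ≤ B := fun y => le_of_tendsto (hlim y).norm (Eventually.of_forall fun N => hB N y)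
  have heq' : ∀ ε > 0, ∀ y, ∃ U ∈ 𝓝 y, ∀ z ∈ U, (∀ N, ‖T N z - T N y‖ ≤ ε) ∧ ‖T' z - T' y‖ ≤ ε := by
    intro ε hε y
    obtain ⟨U, hU, h⟩ := heq ε hε y
    exact ⟨U, hU, fun z hz => ⟨fun N => h N z hz,
      le_of_tendsto ((hlim z).sub (hlim y)).norm (Eventually.of_forall fun N => h N z hz)⟩⟩
  have hcont : ∀ S : Y → E, (∀ ε > 0, ∀ y, ∃ U ∈ 𝓝 y, ∀ z ∈ U, ‖S z - S y‖ ≤ ε) → Continuous S := by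
    intro S hS
    rw [continuous_iff_continuousAt]
    intro y
    rw [ContinuousAt, Metric.tendsto_nhds]
    intro ε hε
    obtain ⟨U, hU, h⟩ := hS (ε/2) (by positivity) y
    filter_upwards [hU] with z hz
    rw [dist_eq_norm]
    linarith [h z hz]
  have hc' : Continuous T' := hcont T' fun ε hε y => by
    obtain ⟨U, hU, h⟩ := heq' ε hε y
    exact ⟨U, hU, fun z hz => (h z hz).2⟩
  have hcN : ∀ N, Continuous (T N) := fun N => hcont (T N) fun ε hε y => by
    obtain ⟨U, hU, h⟩ := heq ε hε y
    exact ⟨U, hU, fun z hz => h N z hz⟩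
  refine ⟨hc', ?_⟩
  rcases isEmpty_or_nonempty Y with hY | hY
  · simp [integral_of_isEmpty]
  have hB0 : 0 ≤ B := (norm_nonneg _).trans (hB' (Classical.arbitrary Y))
  have hIntg : ∀ S : Y → E, Continuous S → (∀ y, ‖S y‖ ≤ B) → Integrable S P := fun S hS h =>
    Integrable.of_bound hS.aestronglyMeasurable B (Eventually.of_forall h)
  rw [Metric.tendsto_nhds]
  intro δ hδ
  let K : ℝ := 3 * P.real Set.univ + 2 * B + 1
  have hK : 0 < K := by positivity
  let ε : ℝ := δ / (2 * K)
  have hε : 0 < ε := by positivity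
  choose U hU hUe using heq' ε hε
  obtain ⟨s, hs, hcov⟩ := TopologicalSpace.countable_cover_nhds (fun y => interior_mem_nhds.2 (hU y))
  have hne : s.Nonempty := by
    by_contra h
    rw [Set.not_nonempty_iff_eq_empty] at h
    rw [h] at hcov
    simp only [Set.mem_empty_iff_false, Set.iUnion_of_empty, Set.iUnion_empty] at hcov
    exact Set.empty_ne_univ hcov
  obtain ⟨u, hu⟩ := hs.exists_eq_range hne
  let A : ℕ → Set Y := fun k => ⋃ i ∈ Finset.range (k+1), interior (U (u i))
  have hAo : ∀ k, MeasurableSet (A k) := fun k =>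
    (isOpen_biUnion fun i _ => isOpen_interior).measurableSet
  have hAm : Antitone (fun k => (A k)ᶜ) := by
    intro a b hab
    refine Set.compl_subset_compl.2 (Set.biUnion_subset_biUnion_left ?_)
    intro i hi
    simp only [Finset.coe_range, Set.mem_Iio, Finset.mem_range] at hi ⊢
    have hi' : i < a + 1 := by simpa using hi
    have : i < b + 1 := by omega
    simpa using this
  have hAi : ⋂ k, (A k)ᶜ = ∅ := by
    rw [← Set.compl_iUnion, Set.compl_empty_iff, Set.eq_univ_iff_forall]
    intro y
    have hy : y ∈ ⋃ x ∈ s, interior (U x) := by rw [hcov]; trivial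
    rw [hu] at hy
    simp only [Set.mem_range, Set.iUnion_exists, Set.iUnion_iUnion_eq', Set.mem_iUnion] at hy
    obtain ⟨i, hi⟩ := hy
    exact Set.mem_iUnion.2 ⟨i, Set.mem_biUnion (Finset.mem_coe.2 (Finset.self_mem_range_succ i)) hi⟩
  have hAt : Tendsto (fun k => P (A k)ᶜ) atTop (𝓝 0) := by
    have := tendsto_measure_iInter_atTop (μ := P) (fun k => (hAo k).compl.nullMeasurableSet) hAm
      ⟨0, measure_ne_top _ _⟩
    rwa [hAi, measure_empty] at this
  obtain ⟨k, hk⟩ := ((ENNReal.tendsto_nhds_zero.1 hAt) (ENNReal.ofReal ε) (by positivity)).exists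
  have hk' : P.real (A k)ᶜ ≤ ε := ENNReal.toReal_le_of_le_ofReal hε.le hk
  have hev : ∀ᶠ N in l, ∀ i ∈ Finset.range (k+1), ‖T N (u i) - T' (u i)‖ ≤ ε := by
    rw [Filter.eventually_all_finset]
    intro i _
    filter_upwards [Metric.tendsto_nhds.1 (hlim (u i)) ε hε] with N hN
    rw [← dist_eq_norm]
    exact hN.le
  filter_upwards [hev] with N hN
  rw [dist_eq_norm, ← integral_sub (hIntg _ (hcN N) (hB N)) (hIntg _ hc' hB')]
  have hbd : ∀ z, ‖T N z - T' z‖ ≤ 3 * ε + (A k)ᶜ.indicator (fun _ => 2 * B) z := by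
    intro z
    by_cases hz : z ∈ A k
    · rw [Set.indicator_of_notMem (by simpa using hz), add_zero]
      obtain ⟨i, hi, hzi⟩ := Set.mem_iUnion₂.1 hz
      obtain ⟨h1, h2⟩ := hUe (u i) z (interior_subset hzi)
      have h3 := hN i hi
      have h1 := h1 N
      have e : T N z - T' z = (T N z - T N (u i)) + (T N (u i) - T' (u i)) - (T' z - T' (u i)) := by abel
      rw [e]
      refine (norm_sub_le _ _).trans ?_
      linarith [norm_add_le (T N z - T N (u i)) (T N (u i) - T' (u i))]
    · rw [Set.indicator_of_mem hz]
      linarith [norm_sub_le (T N z) (T' z), hB N z, hB' z]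
  have hI : Integrable (fun z => 3 * ε + (A k)ᶜ.indicator (fun _ => 2 * B) z) P :=
    (integrable_const _).add ((integrable_const _).indicator (hAo k).compl)
  refine (norm_integral_le_of_norm_le hI (Eventually.of_forall hbd)).trans_lt ?_
  rw [integral_add (integrable_const _) ((integrable_const _).indicator (hAo k).compl), integral_const,
    integral_indicator (hAo k).compl, setIntegral_const, smul_eq_mul, smul_eq_mul]
  have e2 : ε * K = δ / 2 := by simp only [ε]; field_simp
  have : P.real Set.univ * (3 * ε) + P.real (A k)ᶜ * (2 * B) ≤ ε * K := by
    simp only [K]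
    nlinarith [mul_le_mul_of_nonneg_right hk' (show 0 ≤ 2 * B by positivity)]
  linarith

end

section
/-! ### An abstract Mautner-type lemma in Hilbert space. -/

open Filter Topology in
theorem mautner_abs {H : Type*} [NormedAddCommGroup H] [InnerProductSpace ℂ H] [CompleteSpace H]
    {V : Type*} [AddCommGroup V] [Module ℂ V] (ι : V →ₗ[ℂ] H) (f : V →ₗ[ℂ] ℂ) (C : ℝ)
    (hC : ∀ v, ‖f v‖ ≤ C * ‖ι v‖) {G : Type*} [Group G] (R : G → H →ₗᵢ[ℂ] H)
    (hRm : ∀ g g' w, R (g * g') w = R g (R g' w)) (hR1 : ∀ w, R 1 w = w)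
    (ρ : G → V → V) (hρ : ∀ g v, ι (ρ g v) = R g (ι v)) (a h h' : ℕ → G)
    (hah : ∀ n, h n * a n = a n * h' n) (c c' : ℕ → ℂ) (hc : ∀ n, ‖c n‖ = 1) (hc' : ∀ n, ‖c' n‖ = 1)
    (hne : ∀ n, c n ≠ c' n) (hf : ∀ n v, f (ρ (h n) v) = c n * f v)
    (hf' : ∀ n v, f (ρ (h' n) v) = c' n * f v)
    (hcont : ∀ v, Tendsto (fun n => R (a n) (ι v)) atTop (𝓝 (ι v))) : ∀ v, f v = 0 := by
  let K : Submodule ℂ H := (LinearMap.range ι).topologicalClosure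
  have hKm : ∀ v, ι v ∈ K := fun v => Submodule.le_topologicalClosure _ (LinearMap.mem_range_self ι v)
  have : CompleteSpace K := (Submodule.isClosed_topologicalClosure _).completeSpace_coe
  have hcl : ∀ S : Set H, IsClosed S → (∀ v, ι v ∈ S) → ∀ w ∈ K, w ∈ S := by
    intro S hS h w hw
    have hw' : w ∈ closure (LinearMap.range ι : Set H) := by
      rw [← Submodule.topologicalClosure_coe]; exact hw
    refine closure_minimal ?_ hS hw'
    rintro _ ⟨v, rfl⟩
    exact h v
  let e : V →ₗ[ℂ] K := ι.codRestrict K hKm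
  have he : DenseRange e := by
    intro w
    rw [Metric.mem_closure_iff]
    intro ε hε
    have hw' : (w : H) ∈ closure (LinearMap.range ι : Set H) := by
      rw [← Submodule.topologicalClosure_coe]; exact w.2
    obtain ⟨_, ⟨v, rfl⟩, hv⟩ := Metric.mem_closure_iff.1 hw' ε hε
    exact ⟨e v, ⟨v, rfl⟩, hv⟩
  let F0 : K := (InnerProductSpace.toDual ℂ K).symm (f.extendOfNorm e)
  let F : H := F0
  have hFK : F ∈ K := F0.2
  have hF : ∀ v, inner ℂ F (ι v) = f v := by
    intro v
    have h1 : inner ℂ F0 (e v) = f.extendOfNorm e (e v) := InnerProductSpace.toDual_symm_apply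
    rw [LinearMap.extendOfNorm_eq he ⟨C, hC⟩] at h1
    rw [← h1]
    rfl
  have horth : ∀ x ∈ K, (∀ v, inner ℂ x (ι v) = 0) → x = 0 := by
    intro x hx h0
    have := hcl {w | inner ℂ x w = 0} (isClosed_eq (by fun_prop) continuous_const) h0 x hx
    exact inner_self_eq_zero.1 this
  have hRK : ∀ g, ∀ w ∈ K, R g w ∈ K := by
    intro g
    refine hcl {w | R g w ∈ K} ((Submodule.isClosed_topologicalClosure _).preimage (R g).continuous) ?_
    intro v
    show R g (ι v) ∈ K
    rw [← hρ]
    exact hKm _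
  have heig : ∀ (g : G) (z : ℂ), ‖z‖ = 1 → (∀ v, f (ρ g v) = z * f v) → R g F = z • F := by
    intro g z hz hfz
    have hz2 : (starRingEnd ℂ) z * z = 1 := by
      rw [Complex.conj_mul', hz]; norm_num
    rw [← sub_eq_zero]
    refine horth _ (Submodule.sub_mem _ (hRK g F hFK) (Submodule.smul_mem _ _ hFK)) fun v => ?_
    rw [inner_sub_left, inner_smul_left]
    have h1 : inner ℂ (R g F) (ι v) = f (ρ g⁻¹ v) := by
      have : ι v = R g (R g⁻¹ (ι v)) := by rw [← hRm, mul_inv_cancel, hR1]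
      rw [this, LinearIsometry.inner_map_map, ← hρ, hF]
    have h2 : inner ℂ F (ι v) = z * f (ρ g⁻¹ v) := by
      have : ι v = ι (ρ g (ρ g⁻¹ v)) := by rw [hρ, hρ, ← hRm, mul_inv_cancel, hR1]
      rw [this, hF, hfz]
    rw [h1, h2, ← mul_assoc, hz2, one_mul, sub_self]
  have hzero : ∀ n, inner ℂ F (R (a n) F) = 0 := by
    intro n
    have h1 : inner ℂ (R (h n) F) (R (h n) (R (a n) F)) = inner ℂ F (R (a n) F) :=
      LinearIsometry.inner_map_map _ _ _
    rw [← hRm, hah, hRm, heig _ _ (hc n) (hf n), heig _ _ (hc' n) (hf' n), map_smul, inner_smul_left,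
      inner_smul_right] at h1
    by_contra h0
    have h2 : (starRingEnd ℂ) (c n) * c' n = 1 := by
      have h3 : ((starRingEnd ℂ) (c n) * c' n) * inner ℂ F (R (a n) F) = 1 * inner ℂ F (R (a n) F) := by
        rw [one_mul, mul_assoc]; exact h1
      exact mul_right_cancel₀ h0 h3
    apply hne n
    have h3 : c n * (starRingEnd ℂ) (c n) = 1 := by
      rw [Complex.mul_conj', hc n]; norm_num
    calc c n = c n * ((starRingEnd ℂ) (c n) * c' n) := by rw [h2, mul_one]
      _ = c' n := by rw [← mul_assoc, h3, one_mul]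
  have hlim : Tendsto (fun n => R (a n) F) atTop (𝓝 F) := by
    rw [Metric.tendsto_nhds]
    intro ε hε
    have hw' : F ∈ closure (LinearMap.range ι : Set H) := by
      rw [← Submodule.topologicalClosure_coe]; exact hFK
    obtain ⟨_, ⟨v, rfl⟩, hv⟩ := Metric.mem_closure_iff.1 hw' (ε/3) (by positivity)
    filter_upwards [Metric.tendsto_nhds.1 (hcont v) (ε/3) (by positivity)] with n hn
    have h1 : dist (R (a n) F) (R (a n) (ι v)) = dist F (ι v) := (R (a n)).isometry.dist_eq _ _
    have h2 := dist_triangle4 (R (a n) F) (R (a n) (ι v)) (ι v) F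
    rw [h1, dist_comm (ι v) F] at h2
    linarith
  have hF0 : F = 0 := by
    have h1 : Tendsto (fun n => inner ℂ F (R (a n) F)) atTop (𝓝 (inner ℂ F F)) :=
      Tendsto.inner tendsto_const_nhds hlim
    simp only [hzero] at h1
    exact inner_self_eq_zero.1 (tendsto_nhds_unique h1 tendsto_const_nhds)
  intro v
  rw [← hF, hF0, inner_zero_left]

end

section
/-! ### Descending to the torus. -/

section torus
variable {m : ℕ}

/-- Haar probability measure on the torus. -/
def TM (m : ℕ) : Measure (UnitAddTorus (Fin m)) := Measure.pi (fun _ => AddCircle.haarAddCircle)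

instance (m : ℕ) : IsProbabilityMeasure (TM m) := by unfold TM; infer_instance

instance (m : ℕ) : (TM m).IsAddLeftInvariant := by unfold TM; infer_instance

instance (m : ℕ) : (TM m).IsAddRightInvariant := by unfold TM; infer_instance

/-- The covering map. -/
def pr (t : Fin m → ℝ) : UnitAddTorus (Fin m) := fun l => (t l : UnitAddCircle)

theorem pr_add (t s : Fin m → ℝ) : pr (t + s) = pr t + pr s := by
  ext l
  simp [pr]

theorem pr_open : IsOpenQuotientMap (pr (m := m)) :=
  IsOpenQuotientMap.piMap (fun _ : Fin m => QuotientAddGroup.isOpenQuotientMap_mk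
    (N := AddSubgroup.zmultiples (1:ℝ)))

theorem TM_integral {E : Type*} [NormedAddCommGroup E] [NormedSpace ℝ E]
    (f : UnitAddTorus (Fin m) → E) : ∫ t, f t ∂(TM m) = ∫ t in cube m, f (pr t) := by
  have h := UnitAddTorus.integral_preimage (d := Fin m) f 0
  refine Eq.trans h ?_
  have e : {x : Fin m → ℝ | ∀ i, x i ∈ Set.Ioc ((0 : Fin m → ℝ) i) ((0 : Fin m → ℝ) i + 1)} = cube m := by
    ext x
    simp [cube, Set.mem_pi]
  rw [e]
  rfl

theorem hh_int_mem (z : Fin m → ℤ) : hh (fun l => (z l : ℝ)) ∈ Gamma (m+1) := by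
  have hM : (mkM (Fin.cons 1 z) (fun l => Pi.single l.succ 1) : Matrix (Fin (m+1)) (Fin (m+1)) ℤ).map
      (fun z : ℤ => (z:ℝ)) = (hh (fun l => (z l : ℝ))).1 := by
    rw [hh_coe]
    refine mkM_ext (fun i => ?_) (fun i l => ?_)
    · refine Fin.cases ?_ (fun i => ?_) i
      · simp
      · simp
    · simp [Pi.single_apply]
  have hd : (mkM (Fin.cons 1 z) (fun l => Pi.single l.succ 1) : Matrix (Fin (m+1)) (Fin (m+1)) ℤ).det = 1 := by
    have h1 := (Int.castRingHom ℝ).map_det (mkM (Fin.cons 1 z) (fun l => Pi.single l.succ 1) :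
      Matrix (Fin (m+1)) (Fin (m+1)) ℤ)
    have h2 : ((Int.castRingHom ℝ).mapMatrix (mkM (Fin.cons 1 z) (fun l => Pi.single l.succ 1) :
      Matrix (Fin (m+1)) (Fin (m+1)) ℤ)).det = 1 := (congrArg Matrix.det hM).trans (hh (fun l => (z l : ℝ))).2
    rw [h2, eq_intCast] at h1
    exact_mod_cast h1
  exact Gamma_mem_iff.2 ⟨⟨_, hd⟩, fun i l => (congrFun (congrFun hM i) l).symm⟩

/-- The shifted Hecke average. -/
def av {E : Type*} [AddCommGroup E] [Module ℝ E] (m j N : ℕ) (f : XSpace (m+1) → E) : E :=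
  avg (N+1) m j f

/-- The average as a function on the torus. -/
def aT {E : Type*} [AddCommGroup E] [Module ℝ E] (m j N : ℕ) (f : XSpace (m+1) → E)
    (τ : UnitAddTorus (Fin m)) : E :=
  av m j N (fun x => f (rightTranslate (m+1) (hh (Function.surjInv pr_open.surjective τ)) x))

theorem aT_pr {E : Type*} [AddCommGroup E] [Module ℝ E] {j N : ℕ} (f : XSpace (m+1) → E)
    (t : Fin m → ℝ) : aT m j N f (pr t) = av m j N (fun x => f (rightTranslate (m+1) (hh t) x)) := by
  have h := Function.surjInv_eq pr_open.surjective (pr t)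
  set s := Function.surjInv pr_open.surjective (pr t) with hs
  have h1 : ∀ l, ∃ z : ℤ, s l = (z:ℝ) + t l := by
    intro l
    have h2 : ((s l : ℝ) : UnitAddCircle) = ((t l : ℝ) : UnitAddCircle) := congrFun h l
    obtain ⟨z, hz⟩ := (QuotientAddGroup.eq_iff_sub_mem.1 h2)
    refine ⟨z, ?_⟩
    simp only [zsmul_eq_mul, mul_one] at hz
    linarith
  choose z hz using h1
  have h3 : hh s = hh (fun l => (z l : ℝ)) * hh t := by
    rw [← hh_add]
    congr 1
    funext l
    exact hz l
  unfold aT av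
  rw [← hs, h3]
  have e := avg_gamma (N := N+1) (j := j) (fun x => f (rightTranslate (m+1) (hh t) x)) (hh_int_mem z)
  simp only [rightTranslate_mul] at e
  exact e

theorem avg_norm_le {E : Type*} [NormedAddCommGroup E] [NormedSpace ℝ E] {N j : ℕ}
    (f : XSpace (m+1) → E) : ‖avg N m j f‖ ≤ avg N m j (fun x => ‖f x‖) := by
  unfold avg
  rw [norm_smul, smul_eq_mul, norm_inv, Real.norm_natCast]
  exact mul_le_mul_of_nonneg_left (norm_sum_le _ _) (by positivity)

theorem avg_bound {N j : ℕ} {f : XSpace (m+1) → ℝ} {B : ℝ} (hB : 0 ≤ B) (h : ∀ x, f x ≤ B) :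
    avg N m j f ≤ B := by
  unfold avg
  rw [smul_eq_mul]
  rcases Nat.eq_zero_or_pos (latF N m j).card with h0 | h0
  · rw [h0]; simpa using hB
  · rw [inv_mul_le_iff₀ (by exact_mod_cast h0)]
    refine (Finset.sum_le_card_nsmul _ _ B fun L _ => h _).trans ?_
    rw [nsmul_eq_mul]

theorem av_bound {E : Type*} [NormedAddCommGroup E] [NormedSpace ℝ E] {N j : ℕ}
    {f : XSpace (m+1) → E} {B : ℝ} (hB : 0 ≤ B) (h : ∀ x, ‖f x‖ ≤ B) : ‖av m j N f‖ ≤ B :=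
  (avg_norm_le f).trans (avg_bound hB h)

theorem av_add {E : Type*} [AddCommGroup E] [Module ℝ E] {N j : ℕ} (f f' : XSpace (m+1) → E) :
    av m j N (fun x => f x + f' x) = av m j N f + av m j N f' := by
  unfold av avg
  rw [Finset.sum_add_distrib, smul_add]

theorem av_sub {E : Type*} [AddCommGroup E] [Module ℝ E] {N j : ℕ} (f f' : XSpace (m+1) → E) :
    av m j N (fun x => f x - f' x) = av m j N f - av m j N f' := by
  unfold av avg
  rw [Finset.sum_sub_distrib, smul_sub]

theorem av_mul {N j : ℕ} (c : ℂ) (f : XSpace (m+1) → ℂ) :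
    av m j N (fun x => c * f x) = c * av m j N f := by
  unfold av avg
  rw [← Finset.mul_sum, mul_smul_comm]

theorem av_ofReal {N j : ℕ} (f : XSpace (m+1) → ℝ) :
    av m j N (fun x => (f x : ℂ)) = ((av m j N f : ℝ) : ℂ) := by
  unfold av avg
  simp

theorem aT_bound {E : Type*} [NormedAddCommGroup E] [NormedSpace ℝ E] {N j : ℕ}
    {f : XSpace (m+1) → E} {B : ℝ} (hB : 0 ≤ B) (h : ∀ x, ‖f x‖ ≤ B) (τ) : ‖aT m j N f τ‖ ≤ B :=
  av_bound hB (fun _ => h _)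

theorem aT_cont {E : Type*} [NormedAddCommGroup E] [NormedSpace ℝ E] {N j : ℕ}
    {f : XSpace (m+1) → E} (hf : Continuous f) : Continuous (aT m j N f) := by
  rw [pr_open.isQuotientMap.continuous_iff]
  have : aT m j N f ∘ pr = fun t => av m j N (fun x => f (rightTranslate (m+1) (hh t) x)) :=
    funext fun t => aT_pr f t
  rw [this]
  exact (avg_cont hf).comp hh_continuous

theorem aT_translate {E : Type*} [AddCommGroup E] [Module ℝ E] {j N : ℕ} (f : XSpace (m+1) → E)
    (s : Fin m → ℝ) (τ : UnitAddTorus (Fin m)) :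
    aT m j N (fun x => f (rightTranslate (m+1) (hh s) x)) τ = aT m j N f (τ + pr s) := by
  obtain ⟨t, rfl⟩ := pr_open.surjective τ
  rw [← pr_add, aT_pr, aT_pr]
  simp only [rightTranslate_mul, hh_add]

open Topology in
theorem av_equi {E : Type*} [NormedAddCommGroup E] [NormedSpace ℝ E] {j : ℕ}
    {f : XSpace (m+1) → E} (hf : TF f) {ε : ℝ} (hε : 0 < ε) : ∀ᶠ u in 𝓝 (1 : GG (m+1)), ∀ N (g : GG (m+1)),
      ‖av m j N (fun x => f (rightTranslate (m+1) (g * u) x)) -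
        av m j N (fun x => f (rightTranslate (m+1) g x))‖ ≤ ε := by
  filter_upwards [hf.ruc hε] with u hu N g
  rw [← av_sub]
  refine av_bound hε.le fun x => ?_
  rw [← rightTranslate_mul]
  exact (hu _).le

open Topology in
theorem aT_equi {E : Type*} [NormedAddCommGroup E] [NormedSpace ℝ E] {j : ℕ}
    {f : XSpace (m+1) → E} (hf : TF f) {ε : ℝ} (hε : 0 < ε) (τ : UnitAddTorus (Fin m)) :
    ∃ U ∈ 𝓝 τ, ∀ N, ∀ σ ∈ U, ‖aT m j N f σ - aT m j N f τ‖ ≤ ε := by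
  obtain ⟨t, rfl⟩ := pr_open.surjective τ
  have h1 : Filter.Tendsto (fun s : Fin m → ℝ => hh (s - t)) (𝓝 t) (𝓝 1) := by
    have : Continuous (fun s : Fin m → ℝ => hh (s - t)) := hh_continuous.comp (continuous_id.sub continuous_const)
    have h2 := this.tendsto t
    rwa [sub_self, hh_zero] at h2
  have h2 := h1.eventually (av_equi (j := j) hf hε)
  refine ⟨pr '' {s | ∀ N (g : GG (m+1)), ‖av m j N (fun x => f (rightTranslate (m+1) (g * hh (s - t)) x)) -
        av m j N (fun x => f (rightTranslate (m+1) g x))‖ ≤ ε}, pr_open.isOpenMap.image_mem_nhds h2, ?_⟩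
  rintro N _ ⟨s, hs, rfl⟩
  have h3 := hs N (hh t)
  rw [← hh_add, add_sub_cancel] at h3
  rwa [aT_pr, aT_pr]

theorem mFourier_add_pt (k : Fin m → ℤ) (τ σ : UnitAddTorus (Fin m)) :
    UnitAddTorus.mFourier k (τ + σ) = UnitAddTorus.mFourier k τ * UnitAddTorus.mFourier k σ := by
  simp only [UnitAddTorus.mFourier, ContinuousMap.coe_mk, ← Finset.prod_mul_distrib]
  refine Finset.prod_congr rfl fun l _ => ?_
  rw [Pi.add_apply, fourier_apply, fourier_apply, fourier_apply, smul_add, AddCircle.toCircle_add]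
  simp

theorem mFourier_norm_pt (k : Fin m → ℤ) (τ : UnitAddTorus (Fin m)) : ‖UnitAddTorus.mFourier k τ‖ = 1 := by
  simp only [UnitAddTorus.mFourier, fourier_apply, ContinuousMap.coe_mk, norm_prod, Circle.norm_coe,
    Finset.prod_const_one]

theorem mFourier_half (k : Fin m → ℤ) (l : Fin m) (hk : k l ≠ 0) :
    UnitAddTorus.mFourier k (pr (Pi.single l (1 / (2 * (k l : ℝ))))) = -1 := by
  have hk' : (k l : ℝ) ≠ 0 := by exact_mod_cast hk
  simp only [UnitAddTorus.mFourier, ContinuousMap.coe_mk]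
  rw [Finset.prod_eq_single l]
  · unfold pr
    rw [Pi.single_eq_same, fourier_coe_apply]
    rw [← Complex.exp_pi_mul_I]
    congr 1
    push_cast
    have : (k l : ℂ) ≠ 0 := by exact_mod_cast hk
    field_simp
  · intro b _ hb
    unfold pr
    rw [Pi.single_eq_of_ne hb]
    simp
  · simp

end torus

end

section
/-! ### Fourier coefficients of limits of Hecke averages. -/

section fourier
variable {m : ℕ}

open Filter Topology

theorem exists_ulim (U : Ultrafilter ℕ) (a : ℕ → ℂ) (B : ℝ) (h : ∀ N, ‖a N‖ ≤ B) :
    ∃ L, Tendsto a U (𝓝 L) := by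
  obtain ⟨L, -, hL⟩ := isCompact_iff_ultrafilter_le_nhds'.1 (isCompact_closedBall (0:ℂ) B) (U.map a)
    (by
      refine Filter.mem_map.2 (Filter.univ_mem' fun N => ?_)
      simpa using h N)
  exact ⟨L, hL⟩

/-- Ultrafilter limit. -/
def ulim (U : Ultrafilter ℕ) (a : ℕ → ℂ) : ℂ := limUnder (U : Filter ℕ) a

theorem ulim_tendsto (U : Ultrafilter ℕ) (a : ℕ → ℂ) (B : ℝ) (h : ∀ N, ‖a N‖ ≤ B) :
    Tendsto a U (𝓝 (ulim U a)) := tendsto_nhds_limUnder (exists_ulim U a B h)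

theorem TF.zero {n : ℕ} : TF (fun _ : XSpace n => (0:ℂ)) :=
  ⟨continuous_const, ∅, isCompact_empty, fun _ _ => rfl⟩

/-- The space of test functions. -/
def TV (m : ℕ) : Submodule ℂ (XSpace (m+1) → ℂ) where
  carrier := {f | TF f}
  add_mem' := fun ha hb => TF.add ha hb
  zero_mem' := TF.zero
  smul_mem' := fun c f hf => TF.comp hf (u := fun z => c * z) (by fun_prop) (by simp)

/-- Fourier coefficient of the average. -/
def co (m j : ℕ) (k : Fin m → ℤ) (N : ℕ) (f : XSpace (m+1) → ℂ) : ℂ :=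
  ∫ τ, UnitAddTorus.mFourier k τ * aT m j N f τ ∂(TM m)

theorem co_int {j N : ℕ} (k : Fin m → ℤ) {f : XSpace (m+1) → ℂ} (hf : Continuous f) :
    Integrable (fun τ => UnitAddTorus.mFourier k τ * aT m j N f τ) (TM m) := by
  have hc : Continuous (fun τ => UnitAddTorus.mFourier k τ * aT m j N f τ) :=
    (UnitAddTorus.mFourier k).continuous.mul (aT_cont hf)
  exact hc.integrable_of_hasCompactSupport (HasCompactSupport.of_compactSpace _)

theorem co_add {j N : ℕ} (k : Fin m → ℤ) {f f' : XSpace (m+1) → ℂ} (hf : Continuous f)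
    (hf' : Continuous f') : co m j k N (fun x => f x + f' x) = co m j k N f + co m j k N f' := by
  unfold co
  rw [← integral_add (co_int k hf) (co_int k hf')]
  refine integral_congr_ae (Eventually.of_forall fun τ => ?_)
  simp only []
  rw [← mul_add]
  congr 1
  exact av_add _ _

theorem co_mul {j N : ℕ} (k : Fin m → ℤ) (c : ℂ) (f : XSpace (m+1) → ℂ) :
    co m j k N (fun x => c * f x) = c * co m j k N f := by
  unfold co
  rw [← integral_const_mul]
  refine integral_congr_ae (Eventually.of_forall fun τ => ?_)
  simp only []
  rw [mul_left_comm]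
  congr 1
  exact av_mul _ _

theorem co_norm' {j N : ℕ} (k : Fin m → ℤ) {f : XSpace (m+1) → ℂ} (hf : Continuous f) :
    ‖co m j k N f‖ ≤ ∫ t in cube m, avg (N+1) m j (fun x => ‖f (rightTranslate (m+1) (hh t) x)‖) := by
  have h1 : ‖co m j k N f‖ ≤ ∫ τ, aT m j N (fun x => ‖f x‖) τ ∂(TM m) := by
    refine norm_integral_le_of_norm_le ?_ (Eventually.of_forall fun τ => ?_)
    · exact (aT_cont hf.norm).integrable_of_hasCompactSupport (HasCompactSupport.of_compactSpace _)
    · rw [norm_mul, mFourier_norm_pt, one_mul]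
      exact avg_norm_le (fun x => f (rightTranslate (m+1) (hh (Function.surjInv pr_open.surjective τ)) x))
  refine h1.trans (le_of_eq ?_)
  rw [TM_integral]
  refine integral_congr_ae (Eventually.of_forall fun t => ?_)
  simp only [aT_pr]
  rfl

theorem co_bound {j N : ℕ} (k : Fin m → ℤ) {f : XSpace (m+1) → ℂ} {B : ℝ} (hB : 0 ≤ B)
    (h : ∀ x, ‖f x‖ ≤ B) : ‖co m j k N f‖ ≤ B := by
  have := norm_integral_le_of_norm_le_const (μ := TM m) (C := B)
    (f := fun τ => UnitAddTorus.mFourier k τ * aT m j N f τ) (Eventually.of_forall fun τ => by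
      rw [norm_mul, mFourier_norm_pt, one_mul]
      exact aT_bound hB h τ)
  simpa [co] using this

theorem co_translate {j N : ℕ} (k : Fin m → ℤ) (f : XSpace (m+1) → ℂ) (s : Fin m → ℝ) :
    UnitAddTorus.mFourier k (pr s) * co m j k N (fun x => f (rightTranslate (m+1) (hh s) x)) =
      co m j k N f := by
  unfold co
  rw [← integral_const_mul]
  rw [← integral_add_right_eq_self (μ := TM m) (fun τ => UnitAddTorus.mFourier k τ * aT m j N f τ) (pr s)]
  refine integral_congr_ae (Eventually.of_forall fun τ => ?_)
  simp only []
  rw [mFourier_add_pt, aT_translate]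
  ring

/-- Limit Fourier functional. -/
def ell (U : Ultrafilter ℕ) (m j : ℕ) (k : Fin m → ℤ) : TV m →ₗ[ℂ] ℂ where
  toFun f := ulim U (fun N => co m j k N f.1)
  map_add' := by
    intro f f'
    obtain ⟨B, hB, h⟩ := TF.bounded f.2
    obtain ⟨B', hB', h'⟩ := TF.bounded f'.2
    have h1 := ulim_tendsto U (fun N => co m j k N f.1) B (fun N => co_bound k hB h)
    have h2 := ulim_tendsto U (fun N => co m j k N f'.1) B' (fun N => co_bound k hB' h')
    refine ((h1.add h2).congr fun N => ?_).limUnder_eq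
    exact (co_add k f.2.cont f'.2.cont).symm
  map_smul' := by
    intro c f
    obtain ⟨B, hB, h⟩ := TF.bounded f.2
    have h1 := ulim_tendsto U (fun N => co m j k N f.1) B (fun N => co_bound k hB h)
    refine ((h1.const_mul c).congr fun N => ?_).limUnder_eq
    exact (co_mul k c f.1).symm

theorem ell_tendsto (U : Ultrafilter ℕ) (j : ℕ) (k : Fin m → ℤ) (f : TV m) :
    Tendsto (fun N => co m j k N f.1) U (𝓝 (ell U m j k f)) := by
  obtain ⟨B, hB, h⟩ := TF.bounded f.2
  exact ulim_tendsto U (fun N => co m j k N f.1) B (fun N => co_bound k hB h)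

/-- Translation of test functions. -/
def rho (m : ℕ) (g : GG (m+1)) (f : TV m) : TV m :=
  ⟨fun x => f.1 (rightTranslate (m+1) g x), TF.translate f.2 g⟩

theorem ell_translate (U : Ultrafilter ℕ) (j : ℕ) (k : Fin m → ℤ) (f : TV m) (s : Fin m → ℝ) :
    ell U m j k (rho m (hh s) f) = (UnitAddTorus.mFourier k (pr s))⁻¹ * ell U m j k f := by
  have h0 : UnitAddTorus.mFourier k (pr s) ≠ 0 := by
    rw [← norm_ne_zero_iff, mFourier_norm_pt]
    exact one_ne_zero
  refine tendsto_nhds_unique (ell_tendsto U j k (rho m (hh s) f)) ?_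
  refine ((ell_tendsto U j k f).const_mul _).congr fun N => ?_
  rw [← co_translate k f.1 s, inv_mul_cancel_left₀ h0]
  rfl

theorem ell_bound (hm : 1 ≤ m) {j : ℕ} (hj : 1 ≤ j) (hjm : j ≤ m) (μ : Measure (XSpace (m+1)))
    [IsProbabilityMeasure μ] (hinv : ∀ g, Measure.map (rightTranslate (m+1) g) μ = μ) :
    ∃ C : ℝ, 0 ≤ C ∧ ∀ (U : Ultrafilter ℕ), (U : Filter ℕ) ≤ atTop → ∀ k (f : TV m),
      ‖ell U m j k f‖ ≤ C * ∫ x, ‖f.1 x‖ ∂μ := by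
  obtain ⟨C, hC0, hC⟩ := cube_main hm hj hjm μ hinv
  refine ⟨C, hC0, fun U hU k f => ?_⟩
  refine le_of_forall_pos_le_add fun δ hδ => ?_
  have h1 := hC (fun x => ‖f.1 x‖) (TF.comp f.2 continuous_norm norm_zero) (fun x => norm_nonneg _) δ hδ
  have h2 := hU ((tendsto_add_atTop_nat 1).eventually h1)
  refine le_of_tendsto (ell_tendsto U j k f).norm ?_
  filter_upwards [h2] with N hN
  exact (co_norm' k f.2.cont).trans hN

theorem TV_memLp (μ : Measure (XSpace (m+1))) [IsProbabilityMeasure μ] (f : TV m) (p) :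
    MemLp f.1 p μ := by
  obtain ⟨B, hB, h⟩ := TF.bounded f.2
  exact MemLp.of_bound (TF.integrable f.2 μ).aestronglyMeasurable B (Eventually.of_forall h)

/-- The map to `L²`. -/
def iot (μ : Measure (XSpace (m+1))) [IsProbabilityMeasure μ] : TV m →ₗ[ℂ] Lp ℂ 2 μ where
  toFun f := (TV_memLp μ f 2).toLp f.1
  map_add' f f' := rfl
  map_smul' c f := rfl

theorem L1_le_L2 (μ : Measure (XSpace (m+1))) [IsProbabilityMeasure μ] (f : TV m) :
    ∫ x, ‖f.1 x‖ ∂μ ≤ ‖iot μ f‖ := by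
  have h1 : ‖iot μ f‖ = (eLpNorm f.1 2 μ).toReal := Lp.norm_toLp _ (TV_memLp μ f 2)
  rw [h1, integral_norm_eq_lintegral_enorm (TF.integrable f.2 μ).aestronglyMeasurable,
    ← eLpNorm_one_eq_lintegral_enorm]
  refine ENNReal.toReal_mono (TV_memLp μ f 2).eLpNorm_ne_top ?_
  exact eLpNorm_le_eLpNorm_of_exponent_le (by norm_num) (TV_memLp μ f 2).aestronglyMeasurable

theorem rT_mp {μ : Measure (XSpace (m+1))}
    (hinv : ∀ g, Measure.map (rightTranslate (m+1) g) μ = μ) (g : GG (m+1)) :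
    MeasurePreserving (rightTranslate (m+1) g) μ μ :=
  ⟨(rightTranslate_continuous (m+1) g).measurable, hinv g⟩

theorem hh_single (l : Fin m) (x : ℝ) : hh (Pi.single l x) = tv (Fin.succ_ne_zero l) x := by
  apply Subtype.ext
  rw [hh_coe]
  have h2 : (tv (Fin.succ_ne_zero l) x).1 = 1 + Matrix.single l.succ 0 x :=
    Matrix.SpecialLinearGroup.transvection_coe _ _
  rw [h2]
  refine mkM_ext (fun i => ?_) (fun i b => ?_)
  · refine Fin.cases ?_ (fun i => ?_) i
    · simp [Matrix.single_apply]
    · simp [Matrix.single_apply, Pi.single_apply, Matrix.one_apply, eq_comm]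
  · simp [Matrix.single_apply, Pi.single_apply, Matrix.one_apply, eq_comm, Fin.succ_ne_zero]

end fourier

end

section
/-! ### Vanishing of the nontrivial Fourier coefficients. -/

section fourierzero
variable {m : ℕ}

open Filter Topology

theorem iot_norm_le (μ : Measure (XSpace (m+1))) [IsProbabilityMeasure μ] (f : TV m) {B : ℝ}
    (hB : 0 ≤ B) (h : ∀ x, ‖f.1 x‖ ≤ B) : ‖iot μ f‖ ≤ B := by
  have h1 := Lp.norm_le_of_ae_bound (p := 2) (f := iot μ f) hB (by
    filter_upwards [(TV_memLp μ f 2).coeFn_toLp] with x hx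
    have : (iot μ f : XSpace (m+1) → ℂ) x = f.1 x := hx
    rw [this]
    exact h x)
  simpa [measureUnivNNReal] using h1

/-- The regular representation. -/
def RR {μ : Measure (XSpace (m+1))} (hinv : ∀ g, Measure.map (rightTranslate (m+1) g) μ = μ)
    (g : GG (m+1)) : Lp ℂ 2 μ →ₗᵢ[ℂ] Lp ℂ 2 μ :=
  Lp.compMeasurePreservingₗᵢ ℂ (rightTranslate (m+1) g) (rT_mp hinv g)

theorem Lp_comp_congr {μ : Measure (XSpace (m+1))} (w : Lp ℂ 2 μ) {u v : XSpace (m+1) → XSpace (m+1)}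
    (hu : MeasurePreserving u μ μ) (hv : MeasurePreserving v μ μ) (h : u = v) :
    Lp.compMeasurePreserving u hu w = Lp.compMeasurePreserving v hv w := by
  subst h
  rfl

theorem RR_mul {μ : Measure (XSpace (m+1))} (hinv : ∀ g, Measure.map (rightTranslate (m+1) g) μ = μ)
    (g g' : GG (m+1)) (w : Lp ℂ 2 μ) : RR hinv (g * g') w = RR hinv g (RR hinv g' w) := by
  have h := Lp.compMeasurePreserving_comp_apply w (rT_mp hinv g') (rT_mp hinv g)
  refine Eq.trans ?_ h
  exact Lp_comp_congr w _ _ (funext fun x => (rightTranslate_mul (m+1) g g' x).symm)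

theorem RR_one {μ : Measure (XSpace (m+1))} (hinv : ∀ g, Measure.map (rightTranslate (m+1) g) μ = μ)
    (w : Lp ℂ 2 μ) : RR hinv 1 w = w := by
  refine Eq.trans ?_ (Lp.compMeasurePreserving_id_apply w)
  exact Lp_comp_congr w _ _ (funext fun x => rightTranslate_one (m+1) x)

theorem RR_iot {μ : Measure (XSpace (m+1))} [IsProbabilityMeasure μ]
    (hinv : ∀ g, Measure.map (rightTranslate (m+1) g) μ = μ) (g : GG (m+1)) (f : TV m) :
    iot μ (rho m g f) = RR hinv g (iot μ f) := rfl

theorem RR_cont {μ : Measure (XSpace (m+1))} [IsProbabilityMeasure μ]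
    (hinv : ∀ g, Measure.map (rightTranslate (m+1) g) μ = μ) (a : ℕ → GG (m+1))
    (ha : Tendsto a atTop (𝓝 1)) (f : TV m) :
    Tendsto (fun n => RR hinv (a n) (iot μ f)) atTop (𝓝 (iot μ f)) := by
  rw [tendsto_iff_norm_sub_tendsto_zero, Metric.tendsto_atTop']
  intro ε hε
  have h1 := ha.eventually (TF.ruc f.2 (half_pos hε))
  obtain ⟨n0, h0⟩ := eventually_atTop.1 h1
  refine ⟨n0, fun n hn => ?_⟩
  rw [← RR_iot, ← map_sub, dist_zero_right, norm_norm]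
  refine lt_of_le_of_lt (iot_norm_le μ _ (half_pos hε).le fun x => ?_) (half_lt_self hε)
  exact (h0 n hn.le x).le

theorem diag2n_tendsto {n : ℕ} {i l : Fin n} (h : i ≠ l) (c : ℕ → ℝ) (hc : ∀ N, c N ≠ 0)
    (hl : Tendsto c atTop (𝓝 1)) :
    Tendsto (fun N => Matrix.SpecialLinearGroup.diag2n h (c N) (hc N)) atTop (𝓝 (1 : GG n)) := by
  have hi : IsInducing (fun g : GG n => (g : Matrix (Fin n) (Fin n) ℝ)) := ⟨rfl⟩
  rw [hi.tendsto_nhds_iff]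
  refine tendsto_pi_nhds.2 fun a => tendsto_pi_nhds.2 fun b => ?_
  have hl' : Tendsto (fun N => (c N)⁻¹) atTop (𝓝 1) := by simpa using hl.inv₀ one_ne_zero
  simp only [Function.comp_def, Matrix.SpecialLinearGroup.diag2n_coe, Matrix.SpecialLinearGroup.coe_one]
  by_cases hab : a = b
  · subst hab
    by_cases h1 : a = i
    · subst h1
      simpa [Function.update, h] using hl
    · by_cases h2 : a = l
      · subst h2
        simpa [Function.update, h1] using hl'
      · simp [h1, h2]
  · simp [hab]

theorem ell_zero (hm : 1 ≤ m) {j : ℕ} (hj : 1 ≤ j) (hjm : j ≤ m) (μ : Measure (XSpace (m+1)))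
    [IsProbabilityMeasure μ] (hinv : ∀ g, Measure.map (rightTranslate (m+1) g) μ = μ)
    (U : Ultrafilter ℕ) (hU : (U : Filter ℕ) ≤ atTop) (k : Fin m → ℤ) (hk : k ≠ 0) (f : TV m) :
    ell U m j k f = 0 := by
  obtain ⟨C, hC0, hC⟩ := ell_bound hm hj hjm μ hinv
  obtain ⟨l, hl⟩ := Function.ne_iff.1 hk
  have hl' : (k l : ℝ) ≠ 0 := by exact_mod_cast hl
  let c : ℕ → ℝ := fun N => 1 + 1 / ((N:ℝ) + 1)
  have hc1 : ∀ N, 1 < c N := fun N => by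
    have : (0:ℝ) < 1 / ((N:ℝ) + 1) := by positivity
    simp only [c]; linarith
  have hc0 : ∀ N, c N ≠ 0 := fun N => by have := hc1 N; positivity
  have hc2 : ∀ N, c N ^ 2 - 1 ≠ 0 := fun N => by have := hc1 N; nlinarith
  have hct : Tendsto c atTop (𝓝 1) := by
    simpa [c] using (tendsto_one_div_add_atTop_nhds_zero_nat (𝕜 := ℝ)).const_add 1
  let x : ℕ → ℝ := fun N => 1 / (2 * (k l : ℝ)) / (c N ^ 2 - 1)
  have hx : ∀ N, c N ^ 2 * x N = x N + 1 / (2 * (k l : ℝ)) := fun N => by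
    have : (c N ^ 2 - 1) * x N = 1 / (2 * (k l : ℝ)) := mul_div_cancel₀ _ (hc2 N)
    linarith
  have h0 : ∀ s : Fin m → ℝ, UnitAddTorus.mFourier k (pr s) ≠ 0 := fun s => by
    rw [← norm_ne_zero_iff, mFourier_norm_pt]
    exact one_ne_zero
  refine mautner_abs (iot μ) (ell U m j k) C (fun v => (hC U hU k v).trans
    (mul_le_mul_of_nonneg_left (L1_le_L2 μ v) hC0)) (RR hinv) (RR_mul hinv) (RR_one hinv) (rho m)
    (RR_iot hinv) (fun N => Matrix.SpecialLinearGroup.diag2n (Fin.succ_ne_zero l) (c N) (hc0 N))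
    (fun N => hh (Pi.single l (c N ^ 2 * x N))) (fun N => hh (Pi.single l (x N))) ?_
    (fun N => (UnitAddTorus.mFourier k (pr (Pi.single l (c N ^ 2 * x N))))⁻¹)
    (fun N => (UnitAddTorus.mFourier k (pr (Pi.single l (x N))))⁻¹) ?_ ?_ ?_ ?_ ?_
    (RR_cont hinv _ (diag2n_tendsto _ _ _ hct)) f
  · intro N
    rw [hh_single, hh_single, tv_conj_diag]
  · intro N
    rw [norm_inv, mFourier_norm_pt, inv_one]
  · intro N
    rw [norm_inv, mFourier_norm_pt, inv_one]
  · intro N he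
    have h1 := inv_injective he
    rw [hx, Pi.single_add, pr_add, mFourier_add_pt, mFourier_half k l hl, mul_neg_one] at h1
    exact h0 _ (self_eq_neg.1 h1.symm)
  · intro N v
    exact ell_translate U j k v _
  · intro N v
    exact ell_translate U j k v _

/-- The limit functional. -/
def nuU (U : Ultrafilter ℕ) (m j : ℕ) (f : XSpace (m+1) → ℂ) : ℂ := ulim U (fun N => av m j N f)

theorem nuU_tendsto (U : Ultrafilter ℕ) (j : ℕ) {f : XSpace (m+1) → ℂ} (hf : TF f) :
    Tendsto (fun N => av m j N f) U (𝓝 (nuU U m j f)) := by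
  obtain ⟨B, hB, h⟩ := hf.bounded
  exact ulim_tendsto U _ B (fun N => av_bound hB h)

theorem nuU_hh (hm : 1 ≤ m) {j : ℕ} (hj : 1 ≤ j) (hjm : j ≤ m) (μ : Measure (XSpace (m+1)))
    [IsProbabilityMeasure μ] (hinv : ∀ g, Measure.map (rightTranslate (m+1) g) μ = μ)
    (U : Ultrafilter ℕ) (hU : (U : Filter ℕ) ≤ atTop) {f : XSpace (m+1) → ℂ} (hf : TF f) (s : Fin m → ℝ) :
    nuU U m j (fun x => f (rightTranslate (m+1) (hh s) x)) = nuU U m j f := by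
  obtain ⟨B, hB, hb⟩ := hf.bounded
  let Th : UnitAddTorus (Fin m) → ℂ := fun τ => ulim U (fun N => aT m j N f τ)
  have hlim : ∀ τ, Tendsto (fun N => aT m j N f τ) U (𝓝 (Th τ)) := fun τ =>
    ulim_tendsto U _ B (fun N => aT_bound hB hb τ)
  have hTc : Continuous Th := (interchange (TM m) U (fun N => aT m j N f) Th B
    (fun N τ => aT_bound hB hb τ) (fun ε hε τ => aT_equi hf hε τ) hlim).1
  let F : C(UnitAddTorus (Fin m), ℂ) := ⟨Th, hTc⟩
  have hco : ∀ k : Fin m → ℤ, k ≠ 0 → UnitAddTorus.mFourierCoeff F k = 0 := by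
    intro k hk
    have h1 : Tendsto (fun N => co m j (-k) N f) U (𝓝 (∫ τ, UnitAddTorus.mFourier (-k) τ * Th τ ∂(TM m))) := by
      refine (interchange (TM m) U (fun N τ => UnitAddTorus.mFourier (-k) τ * aT m j N f τ)
        (fun τ => UnitAddTorus.mFourier (-k) τ * Th τ) B (fun N τ => ?_) (fun ε hε τ => ?_) (fun τ => ?_)).2
      · rw [norm_mul, mFourier_norm_pt, one_mul]
        exact aT_bound hB hb τ
      · obtain ⟨V, hV, h⟩ := aT_equi (j := j) hf (half_pos hε) τ
        have h2 : ∀ᶠ σ in 𝓝 τ, ‖UnitAddTorus.mFourier (-k) σ - UnitAddTorus.mFourier (-k) τ‖ < ε / 2 / (B + 1) := by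
          have h3 := (UnitAddTorus.mFourier (-k)).continuous.continuousAt (x := τ)
          have h4 := Metric.tendsto_nhds.1 h3 (ε / 2 / (B + 1)) (by positivity)
          simpa [dist_eq_norm] using h4
        refine ⟨V ∩ {σ | ‖UnitAddTorus.mFourier (-k) σ - UnitAddTorus.mFourier (-k) τ‖ < ε / 2 / (B + 1)},
          inter_mem hV h2, fun N σ hσ => ?_⟩
        have e1 : UnitAddTorus.mFourier (-k) σ * aT m j N f σ - UnitAddTorus.mFourier (-k) τ * aT m j N f τ =
          UnitAddTorus.mFourier (-k) τ * (aT m j N f σ - aT m j N f τ) +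
          (UnitAddTorus.mFourier (-k) σ - UnitAddTorus.mFourier (-k) τ) * aT m j N f σ := by ring
        rw [e1]
        refine (norm_add_le _ _).trans ?_
        rw [norm_mul, norm_mul, mFourier_norm_pt, one_mul]
        have e2 := h N σ hσ.1
        have e3 : ‖UnitAddTorus.mFourier (-k) σ - UnitAddTorus.mFourier (-k) τ‖ * ‖aT m j N f σ‖ ≤
            ε / 2 / (B + 1) * (B + 1) := by
          refine mul_le_mul (le_of_lt hσ.2) ((aT_bound hB hb σ).trans (by linarith)) (norm_nonneg _) (by positivity)
        rw [div_mul_cancel₀ _ (by positivity)] at e3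
        linarith
      · exact (hlim τ).const_mul _
    have h2 := tendsto_nhds_unique h1 (ell_tendsto U j (-k) ⟨f, hf⟩)
    rw [ell_zero hm hj hjm μ hinv U hU (-k) (by simpa using hk)] at h2
    exact h2
  have hsum : Summable (UnitAddTorus.mFourierCoeff F) :=
    summable_of_ne_finset_zero (s := {0}) (fun k hk => hco k (by simpa using hk))
  have hconst : ∀ τ, Th τ = UnitAddTorus.mFourierCoeff F 0 := by
    intro τ
    have h1 := UnitAddTorus.hasSum_mFourier_series_apply_of_summable hsum τ
    have h2 := hasSum_single (f := fun i ↦ UnitAddTorus.mFourierCoeff F i • UnitAddTorus.mFourier i τ) 0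
      (fun k hk => by simp [hco k hk])
    have h3 := h1.unique h2
    rw [UnitAddTorus.mFourier_zero] at h3
    simpa [F] using h3
  have hpr : ∀ t : Fin m → ℝ, nuU U m j (fun x => f (rightTranslate (m+1) (hh t) x)) = Th (pr t) := by
    intro t
    simp only [nuU, Th, aT_pr]
  have h0 : nuU U m j f = Th (pr 0) := by
    rw [← hpr]
    simp [hh_zero, rightTranslate_one]
  rw [hpr, h0, hconst, hconst]

end fourierzero

end

section
/-! ### Equidistribution for test functions. -/

section equidist
variable {m : ℕ}

open Filter Topology

theorem nuU_inv (hm : 1 ≤ m) {j : ℕ} (hj : 1 ≤ j) (hjm : j ≤ m) (μ : Measure (XSpace (m+1)))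
    [IsProbabilityMeasure μ] (hinv : ∀ g, Measure.map (rightTranslate (m+1) g) μ = μ)
    (U : Ultrafilter ℕ) (hU : (U : Filter ℕ) ≤ atTop) (g : GG (m+1)) :
    ∀ f : XSpace (m+1) → ℂ, TF f →
    nuU U m j (fun x => f (rightTranslate (m+1) g x)) = nuU U m j f := by
  let P : GG (m+1) → Prop := fun g => ∀ f : XSpace (m+1) → ℂ, TF f →
    nuU U m j (fun x => f (rightTranslate (m+1) g x)) = nuU U m j f
  have hmul : ∀ A B, P A → P B → P (A * B) := by
    intro A B hA hB f hf
    have h1 := hA (fun x => f (rightTranslate (m+1) B x)) (TF.translate hf B)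
    rw [hB f hf] at h1
    rw [← h1]
    simp only [rightTranslate_mul]
  have hG : ∀ γ ∈ Gamma (m+1), P γ := by
    intro γ hγ f hf
    unfold nuU
    congr 1
    funext N
    exact avg_gamma f hγ
  have hT : ∀ {i l : Fin (m+1)} (h : i ≠ l) (z : ℤ), P (tv h (z:ℝ)) := fun h z => hG _ (tv_mem_Gamma h z)
  have hT1 : ∀ {i l : Fin (m+1)} (h : i ≠ l), P (tv h 1) := fun h => by
    have := hT h 1; rwa [Int.cast_one] at this
  have hT2 : ∀ {i l : Fin (m+1)} (h : i ≠ l), P (tv h (-1)) := fun h => by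
    have := hT h (-1); rwa [Int.cast_neg, Int.cast_one] at this
  have hH : ∀ (i : Fin (m+1)) (h : i ≠ 0) (a : ℝ), P (tv h a) := by
    intro i h a
    obtain ⟨l, rfl⟩ := Fin.exists_succ_eq.2 h
    have : P (hh (Pi.single l a)) := fun f hf => nuU_hh hm hj hjm μ hinv U hU hf _
    rwa [hh_single] at this
  have hH' : ∀ (i : Fin (m+1)) (h : 0 ≠ i) (a : ℝ), P (tv h a) := by
    intro i h a
    rw [tv_conj_weyl]
    exact hmul _ _ (hmul _ _ (hmul _ _ (hmul _ _ (hT1 _) (hT2 _)) (hT1 _)) (hH _ _ _))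
      (hmul _ _ (hmul _ _ (hT2 _) (hT1 _)) (hT2 _))
  refine GG_generation (by omega) P ?_ hmul g
  intro i l h a
  by_cases hi : i = 0
  · subst hi
    exact hH' l h a
  by_cases hl : l = 0
  · subst hl
    exact hH i h a
  have hc := tv_commutator hi (Ne.symm hl) h a 1
  rw [mul_one] at hc
  rw [hc]
  exact hmul _ _ (hmul _ _ (hmul _ _ (hH _ _ _) (hH' _ _ _)) (hH _ _ _)) (hH' _ _ _)

theorem equi_TF (hm : 1 ≤ m) {j : ℕ} (hj : 1 ≤ j) (hjm : j ≤ m) (μ : Measure (XSpace (m+1)))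
    [IsProbabilityMeasure μ] (hinv : ∀ g, Measure.map (rightTranslate (m+1) g) μ = μ)
    {f : XSpace (m+1) → ℝ} (hf : TF f) (h0 : ∀ x, 0 ≤ f x) :
    Tendsto (fun N => av m j N f) atTop (𝓝 (∫ x, f x ∂μ)) := by
  rw [tendsto_iff_ultrafilter]
  intro U hU
  obtain ⟨B, hB, hb⟩ := hf.bounded
  obtain ⟨φ, hφ, hs, hp, rfl⟩ := hf.exists_rep h0
  have hfc : TF (fun x => ((PP φ x : ℝ) : ℂ)) := TF.comp hf Complex.continuous_ofReal Complex.ofReal_zero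
  set c : ℂ := nuU U m j (fun x => ((PP φ x : ℝ) : ℂ)) with hc
  have hlim : ∀ g : GG (m+1), Tendsto (fun N => av m j N (fun x => PP φ (rightTranslate (m+1) g x))) U
      (𝓝 c.re) := by
    intro g
    have h1 := nuU_tendsto U j (TF.translate hfc g)
    rw [nuU_inv hm hj hjm μ hinv U hU g _ hfc, ← hc] at h1
    refine ((Complex.continuous_re.tendsto _).comp h1).congr fun N => ?_
    simp only [Function.comp]
    rw [av_ofReal, Complex.ofReal_re]
  have key := (interchange μ U (fun N => Th (N+1) m j φ) (fun _ => c.re) B ?_ ?_ ?_).2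
  · have h2 : ∀ N : ℕ, ∫ x, Th (N+1) m j φ x ∂μ = ∫ x, PP φ x ∂μ := fun N =>
      Th_integral hm (by omega) μ hinv hφ hs
    simp only [h2] at key
    have h3 := tendsto_nhds_unique key tendsto_const_nhds
    simp only [integral_const, probReal_univ, one_smul] at h3
    rw [← h3]
    have h4 := hlim 1
    simpa only [rightTranslate_one] using h4
  · intro N y
    obtain ⟨g, rfl⟩ := toX_surjective (m+1) y
    rw [Th_toX hp hs]
    exact av_bound hB (fun x => hb _)
  · intro ε hε y
    obtain ⟨g, rfl⟩ := toX_surjective (m+1) y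
    have h1 := av_equi (j := j) hf hε
    refine ⟨toX (m+1) '' ((fun u => g * u) '' {u | ∀ N (g : GG (m+1)),
      ‖av m j N (fun x => PP φ (rightTranslate (m+1) (g * u) x)) -
        av m j N (fun x => PP φ (rightTranslate (m+1) g x))‖ ≤ ε}), ?_, ?_⟩
    · refine (toX_isOpenMap (m+1)).image_mem_nhds ?_
      have := (Homeomorph.mulLeft g).isOpenMap.image_mem_nhds h1
      simpa using this
    · rintro N _ ⟨_, ⟨u, hu, rfl⟩, rfl⟩
      rw [Th_toX hp hs, Th_toX hp hs]
      exact hu N g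
  · intro y
    obtain ⟨g, rfl⟩ := toX_surjective (m+1) y
    refine (hlim g).congr fun N => ?_
    rw [Th_toX hp hs]
    rfl

end equidist

end

section
/-! ### The sets `OmegaTilde` have null boundary. -/

section boundary
variable {n : ℕ}

open Filter Topology

/-- Real vector of an integer vector. -/
def rv (v : Fin n → ℤ) : Fin n → ℝ := fun i => (v i : ℝ)

/-- The lattice points in the box. -/
def SS (D : ℝ) (g : GG n) : Set (Fin n → ℤ) := {v | ‖rv v ᵥ* (g : Matrix (Fin n) (Fin n) ℝ)‖ ≤ D}

theorem rv_mul_gamma {γ : GG n} (hγ : γ ∈ Gamma n) :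
    ∃ e : (Fin n → ℤ) ≃ (Fin n → ℤ), ∀ (g : GG n) v, rv v ᵥ* (γ * g).1 = rv (e v) ᵥ* g.1 := by
  obtain ⟨A, rfl⟩ := hγ
  refine ⟨⟨fun v => v ᵥ* A.1, fun v => v ᵥ* (A⁻¹).1, fun v => ?_, fun v => ?_⟩, fun g v => ?_⟩
  · simp only [Matrix.vecMul_vecMul, ← Matrix.SpecialLinearGroup.coe_mul, mul_inv_cancel,
      Matrix.SpecialLinearGroup.coe_one, Matrix.vecMul_one]
  · simp only [Matrix.vecMul_vecMul, ← Matrix.SpecialLinearGroup.coe_mul, inv_mul_cancel,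
      Matrix.SpecialLinearGroup.coe_one, Matrix.vecMul_one]
  · have h1 : rv (v ᵥ* A.1) = rv v ᵥ* (A.1.map (fun z : ℤ => (z:ℝ))) := by
      ext i
      simp [rv, Matrix.vecMul, dotProduct]
    change rv v ᵥ* _ = rv (v ᵥ* A.1) ᵥ* g.1
    rw [h1, Matrix.vecMul_vecMul]
    rfl

theorem SS_ncard_gamma {γ : GG n} (hγ : γ ∈ Gamma n) (D : ℝ) (g : GG n) :
    (SS D (γ * g)).ncard = (SS D g).ncard := by
  obtain ⟨e, he⟩ := rv_mul_gamma hγ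
  refine Set.ncard_congr (fun v _ => e v) (fun v hv => ?_) (fun v w _ _ h => e.injective h) (fun w hw => ?_)
  · have h1 : ‖rv v ᵥ* (γ * g).1‖ ≤ D := hv
    rw [he] at h1
    exact h1
  · refine ⟨e.symm w, ?_, by simp⟩
    have h1 : ‖rv (e.symm w) ᵥ* (γ * g).1‖ ≤ D := by
      rw [he, e.apply_symm_apply]
      exact hw
    exact h1

theorem mem_Omega {D : ℝ} {r : ℕ} (g : GG n) : toX n g ∈ OmegaTilde n D r ↔ (SS D g).ncard = r := by
  constructor
  · rintro ⟨g', hg', h⟩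
    have h1 : toX n g = toX n g' := hg'.symm
    obtain ⟨γ, hγ, rfl⟩ := toX_eq_iff.1 h1
    rw [← SS_ncard_gamma hγ D g]
    exact h
  · intro h
    exact ⟨g, rfl, h⟩

theorem SS_locfin (g0 : GG n) (C : ℝ) : ∃ W ∈ 𝓝 g0, {v : Fin n → ℤ | ∃ g ∈ W, v ∈ SS C g}.Finite := by
  obtain ⟨W, hW, hW0⟩ := exists_compact_mem_nhds g0
  refine ⟨W, hW0, ?_⟩
  have hK : IsCompact (Metric.closedBall (0 : Fin n → ℝ) C ×ˢ W) := (isCompact_closedBall _ _).prod hW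
  have hcont : Continuous (fun p : (Fin n → ℝ) × GG n => p.1 ᵥ* (p.2⁻¹).1) := by
    refine continuous_fst.matrix_vecMul ?_
    exact (GG_continuous_val n).comp (continuous_inv.comp continuous_snd)
  obtain ⟨B, hB⟩ := hK.exists_bound_of_continuousOn hcont.continuousOn
  refine (Set.finite_Icc (fun _ : Fin n => -⌈B⌉) (fun _ => ⌈B⌉)).subset ?_
  rintro v ⟨g, hg, hv⟩
  have h1 := hB (rv v ᵥ* g.1, g) ⟨by rw [mem_closedBall_zero_iff]; exact hv, hg⟩
  simp only [Matrix.vecMul_vecMul, ← Matrix.SpecialLinearGroup.coe_mul, mul_inv_cancel,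
      Matrix.SpecialLinearGroup.coe_one, Matrix.vecMul_one] at h1
  have h2 : ∀ i, |v i| ≤ ⌈B⌉ := fun i => by
    have h3 : |(v i : ℝ)| ≤ B := (norm_le_pi_norm (rv v) i).trans h1
    have h4 : ((|v i| : ℤ) : ℝ) ≤ (⌈B⌉ : ℝ) := by
      push_cast
      exact h3.trans (Int.le_ceil B)
    exact_mod_cast h4
  exact ⟨fun i => (abs_le.1 (h2 i)).1, fun i => (abs_le.1 (h2 i)).2⟩

theorem SS_finite (g : GG n) (C : ℝ) : (SS C g).Finite := by
  obtain ⟨W, hW, h⟩ := SS_locfin g C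
  exact h.subset fun v hv => ⟨g, mem_of_mem_nhds hW, hv⟩

theorem vm_cont (v : Fin n → ℤ) : Continuous (fun g : GG n => rv v ᵥ* g.1) :=
  continuous_const.matrix_vecMul (GG_continuous_val n)

/-- Bad set: lattices with a point on the face of the box. -/
def EE (n : ℕ) (D : ℝ) (i : Fin n) : Set (XSpace n) :=
  {x | ∃ g : GG n, toX n g = x ∧ ∃ v : Fin n → ℤ, v ∈ SS D g ∧ |(rv v ᵥ* g.1) i| = D}

theorem mem_EE {D : ℝ} {i : Fin n} (g : GG n) :
    toX n g ∈ EE n D i ↔ ∃ v : Fin n → ℤ, v ∈ SS D g ∧ |(rv v ᵥ* g.1) i| = D := by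
  constructor
  · rintro ⟨g', hg', v, h, h'⟩
    obtain ⟨γ, hγ, rfl⟩ := toX_eq_iff.1 hg'.symm
    obtain ⟨e, he⟩ := rv_mul_gamma hγ
    rw [he] at h'
    refine ⟨e v, ?_, h'⟩
    have h1 : ‖rv v ᵥ* (γ * g).1‖ ≤ D := h
    rw [he] at h1
    exact h1
  · rintro h
    exact ⟨g, rfl, h⟩

theorem EE_closed (D : ℝ) (i : Fin n) : IsClosed (EE n D i) := by
  rw [← (toX_isQuotientMap n).isClosed_preimage]
  have e : toX n ⁻¹' (EE n D i) = ⋃ v : Fin n → ℤ, {g | v ∈ SS D g ∧ |(rv v ᵥ* g.1) i| = D} := by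
    ext g
    simp only [Set.mem_preimage, Set.mem_iUnion]
    exact mem_EE g
  rw [e]
  refine LocallyFinite.isClosed_iUnion (fun g0 => ?_) (fun v => ?_)
  · obtain ⟨W, hW, h⟩ := SS_locfin g0 D
    refine ⟨W, hW, h.subset ?_⟩
    rintro v ⟨g, hg, hg'⟩
    exact ⟨g, hg', hg.1⟩
  · refine IsClosed.inter ?_ ?_
    · exact isClosed_le (vm_cont v).norm continuous_const
    · exact isClosed_eq ((continuous_apply i).comp (vm_cont v)).abs continuous_const

theorem frontier_Omega {D : ℝ} (hD : 0 < D) (r : ℕ) :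
    frontier (OmegaTilde n D r) ⊆ ⋃ i, EE n D i := by
  intro x hx
  by_contra hne
  obtain ⟨g0, rfl⟩ := toX_surjective n x
  have hne' : ∀ v : Fin n → ℤ, ‖rv v ᵥ* g0.1‖ ≠ D := by
    intro v hv
    apply hne
    by_contra hcon
    have h1 : ∀ i, ‖(rv v ᵥ* g0.1) i‖ < D := by
      intro i
      refine lt_of_le_of_ne ((norm_le_pi_norm _ i).trans hv.le) fun h => hcon ?_
      exact Set.mem_iUnion.2 ⟨i, (mem_EE g0).2 ⟨v, hv.le, h⟩⟩
    exact absurd hv ((pi_norm_lt_iff hD).2 h1).ne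
  obtain ⟨W, hW, hfin⟩ := SS_locfin g0 D
  have hev : ∀ᶠ g in 𝓝 g0, SS D g = SS D g0 := by
    have h1 : ∀ᶠ g in 𝓝 g0, ∀ v ∈ {v : Fin n → ℤ | ∃ g ∈ W, v ∈ SS D g}, (v ∈ SS D g ↔ v ∈ SS D g0) := by
      rw [eventually_all_finite hfin]
      intro v _
      have hc : Tendsto (fun g : GG n => ‖rv v ᵥ* g.1‖) (𝓝 g0) (𝓝 ‖rv v ᵥ* g0.1‖) :=
        (vm_cont v).norm.tendsto g0
      rcases lt_or_gt_of_ne (hne' v) with h | h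
      · filter_upwards [hc.eventually (gt_mem_nhds h)] with g hg
        exact ⟨fun _ => h.le, fun _ => le_of_lt hg⟩
      · filter_upwards [hc.eventually (lt_mem_nhds h)] with g hg
        exact ⟨fun h' => absurd h' (not_le.2 hg), fun h' => absurd h' (not_le.2 h)⟩
    filter_upwards [h1, hW] with g hg hgW
    ext v
    constructor
    · intro hv
      exact (hg v ⟨g, hgW, hv⟩).1 hv
    · intro hv
      exact (hg v ⟨g0, mem_of_mem_nhds hW, hv⟩).2 hv
  have hnb : ∀ᶠ y in 𝓝 (toX n g0), (y ∈ OmegaTilde n D r ↔ toX n g0 ∈ OmegaTilde n D r) := by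
    have h2 := (toX_isOpenMap n).image_mem_nhds hev
    filter_upwards [h2] with y hy
    obtain ⟨g, hg, rfl⟩ := hy
    rw [mem_Omega, mem_Omega, hg]
  by_cases hm : toX n g0 ∈ OmegaTilde n D r
  · refine hx.2 (mem_interior_iff_mem_nhds.2 ?_)
    filter_upwards [hnb] with y hy
    exact hy.2 hm
  · have h3 := mem_closure_iff_frequently.1 hx.1
    refine h3 ?_
    filter_upwards [hnb] with y hy
    exact fun h => hm (hy.1 h)

theorem EE_null (hn : 2 ≤ n) {D : ℝ} (hD : 0 < D) (i : Fin n) (μ : Measure (XSpace n))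
    [IsProbabilityMeasure μ] (hinv : ∀ g, Measure.map (rightTranslate n g) μ = μ) :
    μ (EE n D i) = 0 := by
  have : Nontrivial (Fin n) := Fin.nontrivial_iff_two_le.2 hn
  obtain ⟨l, hl⟩ := exists_ne i
  let c : ℕ → ℝ := fun k => 1 + 1 / ((k:ℝ) + 1)
  have hc1 : ∀ N, 1 < c N := fun N => by
    have : (0:ℝ) < 1 / ((N:ℝ) + 1) := by positivity
    simp only [c]; linarith
  have hc2 : ∀ N, c N ≤ 2 := fun N => by
    have : 1 / ((N:ℝ) + 1) ≤ 1 := by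
      rw [div_le_one (by positivity)]
      have : (0:ℝ) ≤ N := by positivity
      linarith
    simp only [c]; linarith
  have hc0 : ∀ N, c N ≠ 0 := fun N => by have := hc1 N; positivity
  have hcinj : Function.Injective c := by
    intro a b hab
    have h1 : 1 / ((a:ℝ) + 1) = 1 / ((b:ℝ) + 1) := add_left_cancel hab
    rw [one_div, one_div, _root_.inv_inj] at h1
    exact_mod_cast add_right_cancel h1
  let a : ℕ → GG n := fun k => Matrix.SpecialLinearGroup.diag2n hl.symm (c k) (hc0 k)
  have ha : ∀ k (w : Fin n → ℝ) b, (w ᵥ* (a k).1) b =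
      w b * (if b = i then c k else if b = l then (c k)⁻¹ else 1) := by
    intro k w b
    change (w ᵥ* Matrix.diagonal _) b = _
    rw [Matrix.vecMul_diagonal]
  let S : ℕ → Set (XSpace n) := fun k => rightTranslate n (a k) ⁻¹' (EE n D i)
  have hSm : ∀ k, MeasurableSet (S k) := fun k =>
    (rightTranslate_continuous n (a k)).measurable (EE_closed D i).measurableSet
  have hSμ : ∀ k, μ (S k) = μ (EE n D i) := fun k => by
    have h1 := Measure.map_apply (μ := μ) (rightTranslate_continuous n (a k)).measurable
      (EE_closed D i).measurableSet
    rw [hinv] at h1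
    exact h1.symm
  have hSfin : ∀ x, {k | x ∈ S k}.Finite := by
    intro x
    obtain ⟨g, rfl⟩ := toX_surjective n x
    have h1 : {k | toX n g ∈ S k} ⊆ ⋃ v ∈ SS (2 * D) g, {k | c k * |(rv v ᵥ* g.1) i| = D} := by
      intro k hk
      have h2 : rightTranslate n (a k) (toX n g) ∈ EE n D i := hk
      rw [rightTranslate_toX, mem_EE] at h2
      obtain ⟨v, hv, hvi⟩ := h2
      have h4 : rv v ᵥ* (g * a k).1 = (rv v ᵥ* g.1) ᵥ* (a k).1 := by
        rw [Matrix.vecMul_vecMul]; rfl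
      have hv' : ‖rv v ᵥ* (g * a k).1‖ ≤ D := hv
      rw [h4] at hvi hv'
      have hck := hc1 k
      refine Set.mem_biUnion (x := v) ?_ ?_
      · change ‖_‖ ≤ _
        rw [pi_norm_le_iff_of_nonneg (by positivity)]
        intro b
        have h5 := (norm_le_pi_norm _ b).trans hv'
        rw [ha, norm_mul] at h5
        have h6 : (1:ℝ)/2 ≤ ‖(if b = i then c k else if b = l then (c k)⁻¹ else 1)‖ := by
          split_ifs
          · rw [Real.norm_of_nonneg (by linarith)]; linarith
          · rw [norm_inv, Real.norm_of_nonneg (by linarith), one_div]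
            exact inv_anti₀ (by linarith) (hc2 k)
          · norm_num
        have h7 := mul_le_mul_of_nonneg_left h6 (norm_nonneg ((rv v ᵥ* g.1) b))
        linarith
      · rw [ha, if_pos rfl, abs_mul, abs_of_pos (by linarith : 0 < c k), mul_comm] at hvi
        exact hvi
    refine Set.Finite.subset ((SS_finite g (2 * D)).biUnion fun v _ => ?_) h1
    refine Set.Subsingleton.finite fun k hk k' hk' => hcinj ?_
    have h2 : c k * |(rv v ᵥ* g.1) i| = D := hk
    have h3 : c k' * |(rv v ᵥ* g.1) i| = D := hk'
    have h4 : |(rv v ᵥ* g.1) i| ≠ 0 := by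
      intro h
      rw [h, mul_zero] at h2
      exact hD.ne h2
    exact mul_right_cancel₀ h4 (h2.trans h3.symm)
  let T : ℕ → Set (XSpace n) := fun k => ⋃ p ≥ k, S p
  have hTm : ∀ k, MeasurableSet (T k) := fun k => MeasurableSet.iUnion fun p => MeasurableSet.iUnion fun _ => hSm p
  have hTa : Antitone T := fun k k' hk => Set.biUnion_subset_biUnion_left fun p hp => le_trans hk hp
  have h1 := tendsto_measure_iInter_atTop (μ := μ) (fun k => (hTm k).nullMeasurableSet) hTa
    ⟨0, measure_ne_top _ _⟩
  have h2 : ⋂ k, T k = ∅ := by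
    ext x
    simp only [Set.mem_iInter, Set.mem_empty_iff_false, iff_false]
    intro h
    obtain ⟨b, hb⟩ := (hSfin x).bddAbove
    obtain ⟨p, hp, hx⟩ := Set.mem_iUnion₂.1 (h (b+1))
    have := hb hx
    omega
  rw [h2, measure_empty] at h1
  have h3 : ∀ k, μ (EE n D i) ≤ μ (T k) := fun k => by
    rw [← hSμ k]
    exact measure_mono (Set.subset_biUnion_of_mem (u := fun p => S p) (le_refl k))
  exact le_antisymm (ge_of_tendsto h1 (Eventually.of_forall h3)) zero_le

end boundary

end

section
/-! ### Weak convergence and sets with null boundary. -/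

section portmanteau
variable {m : ℕ}

open Filter Topology

theorem open_approx {n : ℕ} (μ : Measure (XSpace n)) [IsProbabilityMeasure μ] {O : Set (XSpace n)}
    (hO : IsOpen O) {ε : ℝ} (hε : 0 < ε) : ∃ f : XSpace n → ℝ, TF f ∧ (∀ x, 0 ≤ f x) ∧
      (∀ x, f x ≤ Set.indicator O (fun _ => 1) x) ∧ μ.real O - ε < ∫ x, f x ∂μ := by
  have hO' : IsOpen (toX n ⁻¹' O) := hO.preimage (toX_continuous n)
  have hex : ∃ K : Set (GG n), IsCompact K ∧ K ⊆ toX n ⁻¹' O ∧ μ.real O - ε < μ.real (toX n '' K) := by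
    have : SigmaCompactSpace (toX n ⁻¹' O) := by
      have := hO'.locallyCompactSpace
      infer_instance
    let Kn : ℕ → Set (GG n) := fun k => Subtype.val '' (compactCovering (toX n ⁻¹' O) k)
    have hmono : Monotone (fun k => toX n '' Kn k) := fun k k' h =>
      Set.image_mono (Set.image_mono (compactCovering_subset _ h))
    have hU : ⋃ k, toX n '' Kn k = O := by
      rw [← Set.image_iUnion, ← Set.image_iUnion, iUnion_compactCovering, Set.image_univ, Subtype.range_val]
      exact Set.image_preimage_eq _ (toX_surjective n)
    have h1 := tendsto_measure_iUnion_atTop (μ := μ) hmono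
    rw [hU] at h1
    have h2 := (ENNReal.tendsto_toReal (measure_ne_top μ O)).comp h1
    obtain ⟨k, hk⟩ := (h2.eventually (lt_mem_nhds (sub_lt_self _ hε))).exists
    refine ⟨Kn k, (isCompact_compactCovering _ k).image continuous_subtype_val, ?_, hk⟩
    rintro _ ⟨y, -, rfl⟩
    exact y.2
  obtain ⟨K, hK, hKO, hKμ⟩ := hex
  obtain ⟨w, hw1, hw0, hwc, hw01⟩ := exists_continuous_one_zero_of_isCompact hK hO'.isClosed_compl
    (Set.disjoint_compl_right_iff_subset.2 hKO)
  have hTF := PP_TF w.continuous hwc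
  have hf : TF (fun x => min 1 (PP w x)) := TF.comp hTF (u := fun z => min 1 z) (by fun_prop) (by simp)
  have hf0 : ∀ x, 0 ≤ min 1 (PP w x) := fun x => le_min zero_le_one (PP_nonneg (fun g => (hw01 g).1) x)
  refine ⟨_, hf, hf0, fun x => ?_, ?_⟩
  · by_cases hx : x ∈ O
    · rw [Set.indicator_of_mem hx]
      exact min_le_left _ _
    · rw [Set.indicator_of_notMem hx]
      obtain ⟨g, rfl⟩ := toX_surjective n x
      have : PP w (toX n g) = 0 := by
        rw [PP_toX]
        refine finsum_eq_zero_of_forall_eq_zero fun γ => hw0 ?_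
        change toX n (γ * g) ∉ O
        rwa [toX_gamma_mul γ.2]
      rw [this]
      simp
  · refine hKμ.trans_le ?_
    have h1 : toX n '' K ⊆ {x | 1 ≤ min 1 (PP w x)} := by
      rintro _ ⟨g, hg, rfl⟩
      change (1:ℝ) ≤ min 1 (PP w (toX n g))
      refine le_min le_rfl ?_
      rw [PP_toX]
      have h2 := single_le_finsum (f := fun γ : Gamma n => w (γ * g)) 1 (PP_fin hwc g) (fun γ => (hw01 _).1)
      have h3 : w g = 1 := hw1 hg
      simpa [h3] using h2
    have h2 := mul_meas_ge_le_integral_of_nonneg (μ := μ) (Eventually.of_forall hf0) (hf.integrable μ) 1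
    rw [one_mul] at h2
    exact (measureReal_mono h1).trans h2

theorem av_mono {j N : ℕ} {f f' : XSpace (m+1) → ℝ} (h : ∀ x, f x ≤ f' x) : av m j N f ≤ av m j N f' := by
  unfold av avg
  exact smul_le_smul_of_nonneg_left (Finset.sum_le_sum fun L _ => h _) (by positivity)

theorem av_one {j N : ℕ} (hj : j ≤ m + 1) : av m j N (fun _ => (1:ℝ)) = 1 := by
  unfold av avg
  have := latF_card_pos (N := N+1) hj
  rw [Finset.sum_const, smul_eq_mul, nsmul_eq_mul, mul_one, inv_mul_cancel₀]
  positivity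

theorem av_liminf (hm : 1 ≤ m) {j : ℕ} (hj : 1 ≤ j) (hjm : j ≤ m) (μ : Measure (XSpace (m+1)))
    [IsProbabilityMeasure μ] (hinv : ∀ g, Measure.map (rightTranslate (m+1) g) μ = μ)
    (A : Set (XSpace (m+1))) {ε : ℝ} (hε : 0 < ε) :
    ∀ᶠ N in atTop, μ.real (interior A) - ε < av m j N (Set.indicator A (fun _ => (1:ℝ))) := by
  obtain ⟨f, hf, h0, h1, h2⟩ := open_approx μ (isOpen_interior (s := A)) hε
  filter_upwards [(equi_TF hm hj hjm μ hinv hf h0).eventually (lt_mem_nhds h2)] with N hN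
  refine hN.trans_le (av_mono fun x => (h1 x).trans ?_)
  exact Set.indicator_le_indicator_of_subset interior_subset (fun _ => zero_le_one) x

theorem av_set (hm : 1 ≤ m) {j : ℕ} (hj : 1 ≤ j) (hjm : j ≤ m) (μ : Measure (XSpace (m+1)))
    [IsProbabilityMeasure μ] (hinv : ∀ g, Measure.map (rightTranslate (m+1) g) μ = μ)
    (A : Set (XSpace (m+1))) (hA : μ (frontier A) = 0) :
    Tendsto (fun N => av m j N (Set.indicator A (fun _ => (1:ℝ)))) atTop (𝓝 (μ.real A)) := by
  have hsum : ∀ N, av m j N (Set.indicator A (fun _ => (1:ℝ))) + av m j N (Set.indicator Aᶜ (fun _ => (1:ℝ))) = 1 := by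
    intro N
    rw [← av_add]
    refine Eq.trans ?_ (av_one (m := m) (j := j) (N := N) (by omega))
    congr 1
    funext x
    by_cases hx : x ∈ A <;> simp [hx]
  have e1 : μ.real (interior A) = μ.real A := by
    unfold Measure.real
    rw [measure_interior_of_null_frontier hA]
  have e2 : μ.real (interior Aᶜ) = 1 - μ.real A := by
    rw [interior_compl, probReal_compl_eq_one_sub isClosed_closure.measurableSet]
    unfold Measure.real
    rw [measure_closure_of_null_frontier hA]
  rw [Metric.tendsto_nhds]
  intro ε hε
  filter_upwards [av_liminf hm hj hjm μ hinv A hε, av_liminf hm hj hjm μ hinv Aᶜ hε] with N h1 h2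
  rw [e1] at h1
  rw [e2] at h2
  have := hsum N
  rw [Real.dist_eq, abs_lt]
  constructor <;> linarith

theorem av_Omega (hm : 1 ≤ m) {j : ℕ} (hj : 1 ≤ j) (hjm : j ≤ m) (μ : Measure (XSpace (m+1)))
    [IsProbabilityMeasure μ] (hinv : ∀ g, Measure.map (rightTranslate (m+1) g) μ = μ)
    {D : ℝ} (hD : 0 < D) (r : ℕ) :
    Tendsto (fun N => av m j N (Set.indicator (OmegaTilde (m+1) D r) (fun _ => (1:ℝ)))) atTop
      (𝓝 (μ.real (OmegaTilde (m+1) D r))) := by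
  refine av_set hm hj hjm μ hinv _ ?_
  refine measure_mono_null (frontier_Omega hD r) ?_
  exact measure_iUnion_null fun i => EE_null (by omega) hD i μ hinv

theorem pt_mem_Omega {N j : ℕ} [NeZero N] {L : AddSubgroup (Fin (m+1) → ℤ)}
    (hL : L ∈ latticeSet N (m+1) j) (D : ℝ) (r : ℕ) :
    pt N m j L ∈ OmegaTilde (m+1) D r ↔ Set.ncard {v : Fin (m+1) → ℤ | v ∈ L ∧
            ‖(fun i => (v i : ℝ))‖ ≤ D * (N : ℝ) ^ ((j : ℝ) / ((m+1 : ℕ) : ℝ))} = r := by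
  obtain ⟨h1, h2⟩ := bas_spec hL
  unfold pt
  rw [mem_Omega]
  set M := bas N m j L with hM
  have hs := scl_pos N (m+1) j
  have hrv : ∀ v : Fin (m+1) → ℤ, rv v ᵥ* (nrm N j M).1 = (scl N (m+1) j)⁻¹ • rv (v ᵥ* M) := by
    intro v
    have e := nrm_coe (m := m) (N := N) (j := j) (M := M) h1.1
    have e' : (nrm N j M).1 = (scl N (m+1) j)⁻¹ • M.map (fun z : ℤ => (z:ℝ)) := e
    rw [e', Matrix.vecMul_smul]
    congr 1
    ext i
    simp [rv, Matrix.vecMul, dotProduct]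
  have hnorm : ∀ v : Fin (m+1) → ℤ, v ∈ SS D (nrm N j M) ↔ ‖rv (v ᵥ* M)‖ ≤ D * scl N (m+1) j := by
    intro v
    have : v ∈ SS D (nrm N j M) ↔ ‖rv v ᵥ* (nrm N j M).1‖ ≤ D := Iff.rfl
    rw [this, hrv, norm_smul, norm_inv, Real.norm_of_nonneg hs.le, inv_mul_le_iff₀ hs, mul_comm D]
  have hinj : Function.Injective (fun v : Fin (m+1) → ℤ => v ᵥ* M) :=
    fun v w h => sub_eq_zero.1 (Matrix.eq_zero_of_vecMul_eq_zero (MM_det_ne h1)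
      (by rw [Matrix.sub_vecMul]; exact sub_eq_zero.2 h))
  suffices h : (SS D (nrm N j M)).ncard = Set.ncard {v : Fin (m+1) → ℤ | v ∈ L ∧
            ‖(fun i => (v i : ℝ))‖ ≤ D * (N : ℝ) ^ ((j : ℝ) / ((m+1 : ℕ) : ℝ))} by rw [h]
  refine Set.ncard_congr (fun v _ => v ᵥ* M) (fun v hv => ⟨?_, (hnorm v).1 hv⟩) (fun v w _ _ h => hinj h) ?_
  · rw [← h2, mem_rowL]
    exact ⟨v, rfl⟩
  · rintro w ⟨hw, hw'⟩
    rw [← h2, mem_rowL] at hw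
    obtain ⟨v, rfl⟩ := hw
    exact ⟨v, (hnorm v).2 hw', rfl⟩

end portmanteau

end

open Filter in
/-- Let `n ≥ 2`, `1 ≤ j ≤ n−1`, `0 < D < 1`, `r ≥ 1`, and let `μ` be the
right-invariant Borel probability measure on `X = SL_n(ℤ)\SL_n(ℝ)`. As `N → ∞` over all
positive integers, the proportion of `L ∈ L_{N,j}(n)` with
`#{v ∈ L : ‖v‖∞ ≤ D·N^{j/n}} = r` tends to `c_{n,r} = μ(Ω̃_{n,r})`; i.e. the number of
Hecke translates of `ℤⁿ` by `T_{N,j}` lying in `Ω̃_{n,r}` is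
`(μ(Ω̃_{n,r}) + o(1))·#L_{N,j}(n)`. -/
theorem prop_hecke_translates_in_OmegaTilde (n j r : ℕ)
    (hn : 2 ≤ n) (hj1 : 1 ≤ j) (hj : j ≤ n - 1) (hr : 1 ≤ r)
    (D : ℝ) (hD0 : 0 < D) (hD1 : D < 1)
    (μ : Measure (XSpace n)) (hprob : IsProbabilityMeasure μ)
    (hinv : ∀ g, Measure.map (rightTranslate n g) μ = μ) :
    Tendsto (fun N : ℕ =>
      (Set.ncard {L ∈ latticeSet N n j |
          Set.ncard {v : Fin n → ℤ | v ∈ L ∧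
            ‖(fun i => (v i : ℝ))‖ ≤ D * (N : ℝ) ^ ((j : ℝ) / (n : ℝ))} = r} : ℝ) /
        (Set.ncard (latticeSet N n j) : ℝ))
      atTop (nhds ((μ (OmegaTilde n D r)).toReal)) := by
  obtain ⟨m, rfl⟩ : ∃ m, n = m + 1 := ⟨n - 1, by omega⟩
  rw [← tendsto_add_atTop_iff_nat 1]
  refine (av_Omega (m := m) (by omega) hj1 (by omega) μ hinv hD0 r).congr fun N => ?_
  unfold av avg
  rw [← latF_card (m := m) (N := N+1) (j := j), smul_eq_mul, div_eq_inv_mul]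
  congr 1
  classical
  have e : {L ∈ latticeSet (N+1) (m+1) j |
          Set.ncard {v : Fin (m+1) → ℤ | v ∈ L ∧
            ‖(fun i => (v i : ℝ))‖ ≤ D * ((N+1 : ℕ) : ℝ) ^ ((j : ℝ) / ((m+1 : ℕ) : ℝ))} = r} =
      (((latF (N+1) m j).filter (fun L => pt (N+1) m j L ∈ OmegaTilde (m+1) D r) :
        Finset (AddSubgroup (Fin (m+1) → ℤ))) : Set (AddSubgroup (Fin (m+1) → ℤ))) := by
    ext L
    simp only [Set.mem_setOf_eq, Finset.coe_filter, mem_latF]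
    refine and_congr_right fun hL => ?_
    exact (pt_mem_Omega hL D r).symm
  rw [e, Set.ncard_coe_finset, Finset.card_filter]
  push_cast
  refine Finset.sum_congr rfl fun L _ => ?_
  simp only [Set.indicator_apply]
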